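/- Let p and q be prime numbers, let k be a finite field extension of the p-adic field ℚ_p and let ℓ be a finite field extension of the q-adic field ℚ_q (these are nonarchimedean local fields of characteristic 0, hence of characteristic ≠ 2). Let a, b ∈ k and c, d ∈ ℓ be nonzero. If the fields k_{a,b} and ℓ_{c,d} are Witt equivalent, then k and ℓ are Witt equivalent. -/

import Mathlib

open MvPolynomial

noncomputable section

/-- The defining polynomial `a·x² + b·y² − 1` of the affine conic. -/
def conicPoly (k : Type*) [Field k] (a b : k) : MvPolynomial (Fin 2) k :=
  C a * X 0 ^ 2 + C b * X 1 ^ 2 - 1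

/-- The coordinate ring `k[x,y]/(a·x² + b·y² − 1)` of the affine conic. -/
abbrev ConicRing (k : Type*) [Field k] (a b : k) : Type _ :=
  MvPolynomial (Fin 2) k ⧸ Ideal.span {conicPoly k a b}

/-- `K` (together with the embedding `ι : k →+* K`) is a model of the function field
`k_{a,b}`, i.e. the quotient field of `k[x,y]/(a·x² + b·y² − 1)`. -/
def IsConicFunctionField (k : Type*) [Field k] (a b : k)
    (K : Type*) [Field K] (ι : k →+* K) : Prop :=
  ∃ f : ConicRing k a b →+* K,
    Function.Injective f ∧
    f.comp (algebraMap k (ConicRing k a b)) = ι ∧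
    ∀ z : K, ∃ p q : ConicRing k a b, f q ≠ 0 ∧ z = f p / f q

/-- The subgroup of squares in `Kˣ`. -/
def sqSubgroup (K : Type*) [Field K] : Subgroup Kˣ :=
  MonoidHom.range (powMonoidHom 2 : Kˣ →* Kˣ)

/-- The square class group `Kˣ/Kˣ²`. -/
abbrev SqClass (K : Type*) [Field K] := Kˣ ⧸ sqSubgroup K

/-- The square class of a unit. -/
def sqCl {K : Type*} [Field K] (u : Kˣ) : SqClass K := QuotientGroup.mk u

/-- `α : Kˣ/Kˣ² → Lˣ/Lˣ²` is a Witt equivalence: it sends `-1` to `-1` and preserves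
binary value sets. -/
structure IsWittEquiv {K L : Type*} [Field K] [Field L]
    (α : SqClass K ≃* SqClass L) : Prop where
  map_neg_one : α (sqCl (-1)) = sqCl (-1)
  represents : ∀ (a b c : Kˣ) (a' b' c' : Lˣ),
    α (sqCl a) = sqCl a' → α (sqCl b) = sqCl b' → α (sqCl c) = sqCl c' →
    ((∃ x y : K, (c : K) = (a : K) * x ^ 2 + (b : K) * y ^ 2) ↔
      (∃ x y : L, (c' : L) = (a' : L) * x ^ 2 + (b' : L) * y ^ 2))

/-- Two fields are Witt equivalent if there is a Witt equivalence between them. -/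
def WittEquivalent (K L : Type*) [Field K] [Field L] : Prop :=
  ∃ α : SqClass K ≃* SqClass L, IsWittEquiv α

/-- An ordering of a field `F`. -/
structure IsOrdering {F : Type*} [Field F] (P : Set F) : Prop where
  add_mem : ∀ x ∈ P, ∀ y ∈ P, x + y ∈ P
  mul_mem : ∀ x ∈ P, ∀ y ∈ P, x * y ∈ P
  total : ∀ x : F, x ∈ P ∨ -x ∈ P
  antisymm : ∀ x : F, x ∈ P → -x ∈ P → x = 0

universe u v

/-- Multiplicative subsets `T ⊆ H` of a field, both containing the nonzero squares, `H` of index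
at most two, satisfying the rigidity conditions out of which a valuation can be built. -/
structure RigidPair {K : Type*} [Field K] (H T : Set K) : Prop where
  zero_notMem : (0 : K) ∉ H
  subset : T ⊆ H
  mul_H : ∀ x ∈ H, ∀ y ∈ H, x * y ∈ H
  mul_T : ∀ x ∈ T, ∀ y ∈ T, x * y ∈ T
  sq_mem : ∀ x : K, x ≠ 0 → x ^ 2 ∈ T
  neg_one : (-1 : K) ∈ T
  index : ∀ x y : K, x ≠ 0 → y ≠ 0 → x ∉ H → y ∉ H → x * y ∈ H
  rigid : ∀ x : K, x ≠ 0 → x ∉ H → 1 + x ∈ T ∨ (1 + x) * x ∈ T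
  add_H : ∀ y ∈ H, y ∉ T → 1 + y ∈ H
  unit : ∀ f ∈ H, f ∉ T → ∃ g, f * g ∈ T ∧ 1 + g ∉ T ∧ (1 + g) * g ∉ T
  nontriv : ∃ f ∈ H, f ∉ T

namespace RigidPair

variable {K : Type*} [Field K] {H T : Set K}

/-- The dominance relation between elements of opposite parity. -/
def Dom (T : Set K) (a b : K) : Prop := (a + b) * a ∈ T

lemma ne_zero_of_T (h : RigidPair H T) {x : K} (hx : x ∈ T) : x ≠ 0 := by
  rintro rfl; exact h.zero_notMem (h.subset hx)

lemma one_T (h : RigidPair H T) : (1 : K) ∈ T := by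
  simpa using h.sq_mem 1 one_ne_zero

lemma T_cancel (h : RigidPair H T) {x y : K} (hx : x ∈ T) (hxy : x * y ∈ T) : y ∈ T := by
  have h0 := h.ne_zero_of_T hx
  have := h.mul_T _ (h.mul_T _ hx _ hxy) _ (h.sq_mem x⁻¹ (inv_ne_zero h0))
  have e : x * (x * y) * x⁻¹ ^ 2 = y := by field_simp
  rwa [e] at this

lemma H_cancel (h : RigidPair H T) {x y : K} (hx : x ∈ H) (hxy : x * y ∈ H) : y ∈ H := by
  have h0 : x ≠ 0 := by rintro rfl; exact h.zero_notMem hx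
  have := h.mul_H _ (h.mul_H _ hx _ hxy) _ (h.subset (h.sq_mem x⁻¹ (inv_ne_zero h0)))
  have e : x * (x * y) * x⁻¹ ^ 2 = y := by field_simp
  rwa [e] at this

/-- transitivity of congruence modulo `T` -/
lemma T_tr (h : RigidPair H T) {a b c : K} (h1 : a * b ∈ T) (h2 : b * c ∈ T) : a * c ∈ T := by
  have h0 : b ≠ 0 := right_ne_zero_of_mul (h.ne_zero_of_T h1)
  have := h.mul_T _ h1 _ h2
  refine h.T_cancel (h.sq_mem b h0) ?_
  convert this using 1; ring

lemma H_tr (h : RigidPair H T) {a b c : K} (h1 : a * b ∈ H) (h2 : b * c ∈ H) : a * c ∈ H := by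
  have h0 : a * b ≠ 0 := by intro e; rw [e] at h1; exact h.zero_notMem h1
  have := h.mul_H _ h1 _ h2
  refine h.H_cancel (h.subset (h.sq_mem b (right_ne_zero_of_mul h0))) ?_
  convert this using 1; ring

lemma T_symm {a b : K} (h1 : a * b ∈ T) : b * a ∈ T := by rwa [mul_comm]

lemma sq_iff_T (h : RigidPair H T) {a c : K} (ha : a ≠ 0) : a ^ 2 * c ∈ T ↔ c ∈ T :=
  ⟨h.T_cancel (h.sq_mem a ha), h.mul_T _ (h.sq_mem a ha) _⟩

lemma sq_iff_H (h : RigidPair H T) {a c : K} (ha : a ≠ 0) : a ^ 2 * c ∈ H ↔ c ∈ H :=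
  ⟨h.H_cancel (h.subset (h.sq_mem a ha)), h.mul_H _ (h.subset (h.sq_mem a ha)) _⟩

lemma index' (h : RigidPair H T) {a b c : K} (hb : b ≠ 0) (hac : a * c ≠ 0) (h1 : a * b ∉ H)
    (h2 : b * c ∉ H) : a * c ∈ H := by
  have := h.index _ _ (mul_ne_zero (left_ne_zero_of_mul hac) hb)
    (mul_ne_zero hb (right_ne_zero_of_mul hac)) h1 h2
  refine (h.sq_iff_H hb).1 ?_
  convert this using 1; ring

lemma rigid' (h : RigidPair H T) {a b : K} (ha : a ≠ 0) (hb : b ≠ 0) (hab : a * b ∉ H) :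
    Dom T a b ∨ Dom T b a := by
  have e1 : a ^ 2 * (b / a) = a * b := by field_simp
  have := h.rigid (b / a) (div_ne_zero hb ha) (fun hx => hab (by
    rw [← e1]; exact (h.sq_iff_H ha).2 hx))
  unfold Dom
  rcases this with h1 | h1
  · left
    rw [← h.sq_iff_T ha] at h1
    convert h1 using 1; field_simp
  · right
    rw [← h.sq_iff_T ha] at h1
    convert h1 using 1; field_simp; ring

lemma add_H' (h : RigidPair H T) {a b : K} (ha : a ≠ 0) (hab : a * b ∈ H) (hab' : a * b ∉ T) :
    (a + b) * a ∈ H := by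
  have e1 : a ^ 2 * (b / a) = a * b := by field_simp
  have := h.add_H (b / a) ((h.sq_iff_H ha).1 (by rwa [e1])) (fun hx => hab' (by
    rw [← e1]; exact (h.sq_iff_T ha).2 hx))
  rw [← h.sq_iff_H ha] at this
  convert this using 1; field_simp

lemma not_both (h : RigidPair H T) {a b : K} (hab : a * b ∉ H) (h1 : Dom T a b) (h2 : Dom T b a) :
    False := by
  unfold Dom at h1 h2
  apply hab
  apply h.subset
  rw [add_comm b a] at h2
  exact h.T_tr (T_symm h1) h2

lemma dom_iff (h : RigidPair H T) {a b : K} (ha : a ≠ 0) (hb : b ≠ 0) (hab : a * b ∉ H) :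
    ¬ Dom T a b ↔ Dom T b a :=
  ⟨fun h1 => (h.rigid' ha hb hab).resolve_left h1, fun h1 h2 => h.not_both hab h2 h1⟩

lemma dom_scale (h : RigidPair H T) {a b c : K} (hc : c ≠ 0) : Dom T (c * a) (c * b) ↔ Dom T a b := by
  unfold Dom
  rw [← h.sq_iff_T hc (c := (a + b) * a)]
  ring_nf

lemma dom_tr (h : RigidPair H T) {a b d : K} (hb0 : b ≠ 0) (hab : a * b ∉ H) (hbd : b * d ∉ H)
    (had0 : a * d ≠ 0) (had : a * d ∉ T) (h1 : Dom T a b) (h2 : Dom T b d) : (a + d) * a ∈ T := by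
  have ha : a ≠ 0 := left_ne_zero_of_mul had0
  have hd : d ≠ 0 := right_ne_zero_of_mul had0
  have hadH := h.index' hb0 had0 hab hbd
  unfold Dom at h1 h2
  -- `a + b + d` has the parity of `a`
  have s0 : a + b ≠ 0 := left_ne_zero_of_mul (h.ne_zero_of_T h1)
  have s1 : (a + b) * d ∈ H := h.H_tr (h.subset h1) hadH
  have s2 : (a + b) * d ∉ T := fun hx => had (h.T_tr (T_symm h1) hx)
  have s3 := h.add_H' s0 s1 s2
  have s4 : (a + b + d) * a ∈ H := h.H_tr s3 (h.subset h1)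
  -- compare with `a + (b + d)`
  have t0 : b + d ≠ 0 := left_ne_zero_of_mul (h.ne_zero_of_T h2)
  have t1 : a * (b + d) ∉ H := fun hx => hab (h.H_tr hx (h.subset h2))
  have t2 : (a + b + d) * a ∈ T := by
    rcases h.rigid' ha t0 t1 with h3 | h3
    · unfold Dom at h3; rw [add_assoc]; exact h3
    · exfalso
      unfold Dom at h3
      have : (a + b + d) * (b + d) ∈ T := by convert h3 using 1; ring
      exact t1 (h.H_tr (by rw [mul_comm]; exact s4) (h.subset this))
  -- subtract `b`
  have e0 : a + b + d ≠ 0 := left_ne_zero_of_mul (h.ne_zero_of_T t2)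
  have e1 : (a + b + d) * (-b) ∉ H := fun hx => by
    apply hab
    have : a * (-b) ∈ H := h.H_tr (h.subset (T_symm t2)) hx
    have := h.mul_H _ this _ (h.subset h.neg_one)
    convert this using 1; ring
  have e2 := h.add_H' ha hadH had
  rcases h.rigid' e0 (neg_ne_zero.2 hb0) e1 with h3 | h3
  · unfold Dom at h3
    have e3 : (a + d) * (a + b + d) ∈ T := by convert h3 using 1; ring
    exact h.T_tr e3 t2
  · exfalso
    unfold Dom at h3
    have e3 : (a + d) * (-b) ∈ T := by convert h3 using 1; ring
    apply e1
    exact h.H_tr (h.H_tr s4 (by rw [mul_comm]; exact e2)) (h.subset e3)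

lemma dom_neg_aux (h : RigidPair H T) {x : K} (hx0 : x ≠ 0) (hx : x ∉ H) (h1 : Dom T 1 x) :
    Dom T 1 (-x) := by
  have hx' : -x ∉ H := fun hh => hx (by
    have := h.mul_H _ hh _ (h.subset h.neg_one); simpa using this)
  by_contra hcon
  have h2 := (h.dom_iff one_ne_zero (neg_ne_zero.2 hx0) (by simpa using hx')).1 hcon
  obtain ⟨f0, hf0, hf0'⟩ := h.nontriv
  obtain ⟨f, hf1, hf2, hf3⟩ := h.unit f0 hf0 hf0'
  have hf : f ∈ H := h.H_cancel hf0 (h.subset hf1)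
  have hf' : f ∉ T := fun hh => hf0' (h.T_cancel hh (by rwa [mul_comm]))
  have f0 : f ≠ 0 := by rintro rfl; exact h.zero_notMem hf
  have hfx : f * x ∉ H := fun hh => hx (h.H_cancel hf hh)
  have hfx' : f * (-x) ∉ H := fun hh => hx' (h.H_cancel hf hh)
  rcases h.rigid' f0 hx0 hfx with h3 | h3
  · rcases h.rigid' f0 (neg_ne_zero.2 hx0) hfx' with h4 | h4
    · apply hf3
      have := h.dom_tr (a := f) (b := -x) (d := 1) (neg_ne_zero.2 hx0) hfx' (by simpa using hx')
        (by simpa using f0) (by simpa using hf') h4 h2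
      rwa [add_comm 1 f]
    · -- `f > x` and `-x > f`
      unfold Dom at h1 h2 h3 h4
      have hH := h.add_H f hf hf'
      have p1 : 1 + x ≠ 0 := left_ne_zero_of_mul (h.ne_zero_of_T h1)
      have p2 : -x + f ≠ 0 := left_ne_zero_of_mul (h.ne_zero_of_T h4)
      have p3 : f + x ≠ 0 := left_ne_zero_of_mul (h.ne_zero_of_T h3)
      have p4 : -x + 1 ≠ 0 := left_ne_zero_of_mul (h.ne_zero_of_T h2)
      rw [mul_one] at h1
      have q1 : (-x + f) ∉ H := fun hh => hx' (h.H_cancel hh (h.subset h4))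
      have q4 : (-x + 1) ∉ H := fun hh => hx' (h.H_cancel hh (h.subset h2))
      have r1 : 1 + f ∈ T := by
        rcases h.rigid' p1 p2 (fun hh => q1 (h.H_cancel (h.subset h1) hh)) with h5 | h5
        · unfold Dom at h5
          refine h.T_cancel h1 ?_
          convert h5 using 1; ring
        · exfalso
          unfold Dom at h5
          refine q1 (h.H_cancel hH (h.subset ?_))
          convert h5 using 1; ring
      have r2 : (1 + f) * f ∈ T := by
        have q3 : f + x ∈ H := h.H_cancel hf (by rw [mul_comm]; exact h.subset h3)
        rcases h.rigid' p3 p4 (fun hh => q4 (h.H_cancel q3 hh)) with h5 | h5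
        · unfold Dom at h5
          refine h.T_tr ?_ h3
          convert h5 using 1; ring
        · exfalso
          unfold Dom at h5
          refine q4 (h.H_cancel hH (h.subset ?_))
          convert h5 using 1; ring
      exact hf3 r2
  · apply hf2
    have := h.dom_tr (a := 1) (b := x) (d := f) hx0 (by simpa using hx)
        (by rwa [mul_comm]) (by simpa using f0) (by simpa using hf') h1 h3
    simpa using this

lemma neg_notMem (h : RigidPair H T) {x : K} (hx : x ∉ H) : -x ∉ H := fun hh => hx (by
    have := h.mul_H _ hh _ (h.subset h.neg_one); simpa using this)

lemma dom_neg_right (h : RigidPair H T) {a x : K} (ha : a ≠ 0) (hx0 : x ≠ 0) (hx : a * x ∉ H)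
    (h1 : Dom T a x) : Dom T a (-x) := by
  have e1 : a ^ 2 * (x / a) = a * x := by field_simp
  have := h.dom_neg_aux (x := x / a) (div_ne_zero hx0 ha)
    (fun hh => hx (by rw [← e1]; exact (h.sq_iff_H ha).2 hh))
    (by rw [← h.dom_scale ha]; convert h1 using 1 <;> field_simp)
  rw [← h.dom_scale ha] at this
  convert this using 1 <;> field_simp

lemma dom_neg_left (h : RigidPair H T) {a x : K} (ha : a ≠ 0) (hx0 : x ≠ 0) (hx : a * x ∉ H)
    (h1 : Dom T a x) : Dom T (-a) x := by
  have := h.dom_neg_right ha hx0 hx h1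
  rw [← h.dom_scale (c := -1) (by simp)] at this
  simpa using this

/-- Elements of `H` that behave like units. -/
def IsU (H T : Set K) (g : K) : Prop := g ∈ H ∧ ∀ x : K, x ≠ 0 → x ∉ H → (Dom T 1 x ↔ Dom T g x)

lemma exists_unit (h : RigidPair H T) {f : K} (hf0 : f ∈ H) (hf0' : f ∉ T) :
    ∃ g, f * g ∈ T ∧ IsU H T g := by
  obtain ⟨g, hg1, hg2, hg3⟩ := h.unit f hf0 hf0'
  have hg : g ∈ H := h.H_cancel hf0 (h.subset hg1)
  have hg' : g ∉ T := fun hh => hf0' (h.T_cancel hh (by rwa [mul_comm]))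
  have g0 : g ≠ 0 := by rintro rfl; exact h.zero_notMem hg
  refine ⟨g, hg1, hg, fun x hx0 hx => ⟨fun h1 => ?_, fun h1 => ?_⟩⟩
  · by_contra h2
    have hgx : g * x ∉ H := fun hh => hx (h.H_cancel hg hh)
    rw [h.dom_iff g0 hx0 hgx] at h2
    have := h.dom_tr (a := 1) (b := x) (d := g) hx0 (by simpa using hx)
        (by rwa [mul_comm]) (by simpa using g0) (by simpa using hg') h1 h2
    exact hg2 (by simpa using this)
  · by_contra h2
    have hgx : g * x ∉ H := fun hh => hx (h.H_cancel hg hh)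
    rw [h.dom_iff one_ne_zero hx0 (by simpa using hx)] at h2
    have := h.dom_tr (a := g) (b := x) (d := 1) hx0 hgx (by simpa using hx) (by simpa using g0)
      (by simpa using hg') h1 h2
    exact hg3 (by rwa [add_comm 1 g])

lemma IsU.scale (h : RigidPair H T) {g : K} (hg : IsU H T g) {c x : K} (hc : c ≠ 0) (hx : x ≠ 0)
    (hcx : c * x ∉ H) : Dom T c x ↔ Dom T (c * g) x := by
  have e1 : c ^ 2 * (x / c) = c * x := by field_simp
  have := hg.2 (x / c) (div_ne_zero hx hc)
    (fun hh => hcx (by rw [← e1]; exact (h.sq_iff_H hc).2 hh))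
  rw [← h.dom_scale hc, ← h.dom_scale hc (a := g)] at this
  have e2 : c * (x / c) = x := by field_simp
  simpa [e2] using this

lemma exists_U (h : RigidPair H T) : ∃ g, g ∉ T ∧ IsU H T g := by
  obtain ⟨f, hf, hf'⟩ := h.nontriv
  obtain ⟨g, hg1, hg2⟩ := h.exists_unit hf hf'
  exact ⟨g, fun hh => hf' (h.T_cancel hh (by rwa [mul_comm])), hg2⟩

/-- There are no cycles of length four. -/
lemma no_cycle (h : RigidPair H T) {a b c d : K} (hb0 : b ≠ 0) (hc0 : c ≠ 0) (had0 : a * d ≠ 0)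
    (hab : a * b ∉ H) (hbd : b * d ∉ H) (hac : a * c ∉ H)
    (h1 : Dom T a b) (h2 : Dom T b d) (h3 : Dom T d c) (h4 : Dom T c a) : False := by
  have ha : a ≠ 0 := left_ne_zero_of_mul had0
  have hd : d ≠ 0 := right_ne_zero_of_mul had0
  have hadH := h.index' hb0 had0 hab hbd
  have hcd : c * d ∉ H := fun hh => hac (h.H_tr hadH (by rwa [mul_comm]))
  wlog had : a * d ∉ T generalizing d
  · obtain ⟨g, hg, hgU⟩ := h.exists_U
    have g0 : g ≠ 0 := by rintro rfl; exact h.zero_notMem hgU.1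
    have hbdg : b * (d * g) ∉ H := fun hh => hbd (h.H_cancel hgU.1 (by convert hh using 1; ring))
    have hcdg : c * (d * g) ∉ H := fun hh => hcd (h.H_cancel hgU.1 (by convert hh using 1; ring))
    refine this (d := d * g) (mul_ne_zero ha (mul_ne_zero hd g0)) hbdg ?_ ?_
      (mul_ne_zero hd g0) ?_ hcdg ?_
    · rw [← h.dom_iff (mul_ne_zero hd g0) hb0 (by rwa [mul_comm]), ← hgU.scale h hd hb0
        (by rwa [mul_comm]), h.dom_iff hd hb0 (by rwa [mul_comm])]
      exact h2
    · rw [← hgU.scale h hd hc0 (by rwa [mul_comm])]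
      exact h3
    · rw [← mul_assoc]; exact h.mul_H _ hadH _ hgU.1
    · intro hh
      rw [not_not] at had
      exact hg (h.T_cancel had (by rwa [← mul_assoc] at hh))
  have q1 := h.dom_tr hb0 hab hbd had0 had h1 h2
  have q2 := h.dom_tr (a := d) (b := c) (d := a) hc0 (by rwa [mul_comm]) (by rwa [mul_comm])
    (by rwa [mul_comm]) (by rwa [mul_comm]) h3 h4
  rw [add_comm] at q2
  exact had (h.T_tr (T_symm q1) q2)

/-- The valuation ring attached to a rigid pair. -/
def Mem (H T : Set K) (a : K) : Prop :=
  a = 0 ∨ (a ≠ 0 ∧ a ∉ H ∧ Dom T 1 a) ∨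
    (a ∈ H ∧ ∀ x : K, x ≠ 0 → x ∉ H → Dom T a x → Dom T 1 x)

lemma mul_notMem (h : RigidPair H T) {a b : K} (ha : a ∈ H) (hb : b ∉ H) : a * b ∉ H :=
  fun hh => hb (h.H_cancel ha hh)

lemma mul_notMem' (h : RigidPair H T) {a b : K} (ha : a ∈ H) (hb : b ∉ H) : b * a ∉ H :=
  fun hh => hb (h.H_cancel ha (by rwa [mul_comm]))

lemma ne_zero (h : RigidPair H T) {a : K} (ha : a ∈ H) : a ≠ 0 := by
  rintro rfl; exact h.zero_notMem ha

lemma inv_H (h : RigidPair H T) {a : K} (ha : a ∈ H) : a⁻¹ ∈ H := by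
  refine h.H_cancel ha ?_
  rw [mul_inv_cancel₀ (h.ne_zero ha)]; exact h.subset h.one_T

lemma inv_notMem (h : RigidPair H T) {a : K} (ha : a ∉ H) : a⁻¹ ∉ H := fun hh => by
  have := h.inv_H hh; rw [inv_inv] at this; exact ha this

lemma Mem.mul (h : RigidPair H T) {a b : K} (ha : Mem H T a) (hb : Mem H T b) :
    Mem H T (a * b) := by
  rcases ha with rfl | ⟨a0, ha, ha'⟩ | ⟨ha, ha'⟩
  · left; simp
  · rcases hb with rfl | ⟨b0, hb, hb'⟩ | ⟨hb, hb'⟩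
    · left; simp
    · right; right
      refine ⟨h.index _ _ a0 b0 ha hb, fun z z0 hz hz' => ?_⟩
      by_contra hcon
      rw [h.dom_iff one_ne_zero z0 (by simpa using hz)] at hcon
      refine h.no_cycle (a := 1) (b := a) (d := a * b) (c := z) a0 z0 (by simp [a0, b0])
        (by simpa using ha) ?_ (by simpa using hz) ha' ?_ hz' hcon
      · exact h.mul_notMem' (h.index _ _ a0 b0 ha hb) ha
      · have := (h.dom_scale a0 (a := 1) (b := b)).2 hb'
        simpa using this
    · right; left
      refine ⟨mul_ne_zero a0 (h.ne_zero hb), h.mul_notMem' hb ha, ?_⟩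
      apply hb' _ (mul_ne_zero a0 (h.ne_zero hb)) (h.mul_notMem' hb ha)
      have := (h.dom_scale (h.ne_zero hb) (a := 1) (b := a)).2 ha'
      rwa [mul_one, mul_comm b a] at this
  · rcases hb with rfl | ⟨b0, hb, hb'⟩ | ⟨hb, hb'⟩
    · left; simp
    · right; left
      refine ⟨mul_ne_zero (h.ne_zero ha) b0, h.mul_notMem ha hb, ?_⟩
      apply ha' _ (mul_ne_zero (h.ne_zero ha) b0) (h.mul_notMem ha hb)
      have := (h.dom_scale (h.ne_zero ha) (a := 1) (b := b)).2 hb'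
      rwa [mul_one] at this
    · right; right
      refine ⟨h.mul_H _ ha _ hb, fun x x0 hx hx' => ?_⟩
      have a0 := h.ne_zero ha
      apply ha' x x0 hx
      have := hb' (a⁻¹ * x) (mul_ne_zero (inv_ne_zero a0) x0) (h.mul_notMem (h.inv_H ha) hx) (by
        rw [← h.dom_scale a0]; convert hx' using 1; field_simp)
      rw [← h.dom_scale a0] at this
      convert this using 1
      · simp
      · field_simp

lemma Mem.total (h : RigidPair H T) (a : K) : Mem H T a ∨ Mem H T a⁻¹ := by
  by_cases a0 : a = 0
  · left; left; exact a0
  by_cases ha : a ∈ H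
  · by_contra! hcon
    obtain ⟨h1, h2⟩ := hcon
    have h1 : ∃ x : K, x ≠ 0 ∧ x ∉ H ∧ Dom T a x ∧ ¬ Dom T 1 x := by
      by_contra! hh; exact h1 (Or.inr (Or.inr ⟨ha, hh⟩))
    have h2 : ∃ x : K, x ≠ 0 ∧ x ∉ H ∧ Dom T a⁻¹ x ∧ ¬ Dom T 1 x := by
      by_contra! hh; exact h2 (Or.inr (Or.inr ⟨h.inv_H ha, hh⟩))
    obtain ⟨x, x0, hx, hx1, hx2⟩ := h1
    obtain ⟨y, y0, hy, hy1, hy2⟩ := h2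
    rw [h.dom_iff one_ne_zero x0 (by simpa using hx)] at hx2
    rw [h.dom_iff one_ne_zero y0 (by simpa using hy)] at hy2
    rw [← h.dom_scale a0, mul_inv_cancel₀ a0] at hy1
    rw [← h.dom_scale a0, mul_one] at hy2
    refine h.no_cycle (a := a) (b := x) (d := 1) (c := a * y) x0 (mul_ne_zero a0 y0)
      (by simpa using a0) (h.mul_notMem ha hx) (by simpa using hx) ?_ hx1 hx2 hy1 hy2
    exact h.mul_notMem ha (h.mul_notMem ha hy)
  · by_cases h1 : Dom T 1 a
    · left; right; left; exact ⟨a0, ha, h1⟩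
    · right; right; left
      refine ⟨inv_ne_zero a0, h.inv_notMem ha, ?_⟩
      rw [h.dom_iff one_ne_zero a0 (by simpa using ha)] at h1
      rw [← h.dom_scale a0, mul_inv_cancel₀ a0, mul_one]; exact h1

lemma Mem.neg (h : RigidPair H T) {a : K} (ha : Mem H T a) : Mem H T (-a) := by
  rcases ha with rfl | ⟨a0, ha, ha'⟩ | ⟨ha, ha'⟩
  · left; simp
  · right; left
    exact ⟨neg_ne_zero.2 a0, h.neg_notMem ha, h.dom_neg_aux a0 ha ha'⟩
  · right; right
    have hn : -a ∈ H := by have := h.mul_H _ ha _ (h.subset h.neg_one); simpa using this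
    refine ⟨hn, fun x x0 hx hx' => ha' x x0 hx ?_⟩
    have := h.dom_neg_left (h.ne_zero hn) x0 (h.mul_notMem hn hx) hx'
    simpa using this

lemma Mem.one_add_odd (h : RigidPair H T) {a : K} (a0 : a ≠ 0) (ha : a ∉ H) (h1 : Dom T 1 a) :
    Mem H T (1 + a) := by
  right; right
  unfold Dom at h1; rw [mul_one] at h1
  have hH := h.subset h1
  refine ⟨hH, fun z z0 hz hz' => ?_⟩
  by_contra hcon
  rw [h.dom_iff one_ne_zero z0 (by simpa using hz)] at hcon
  wlog haz : z * a ∉ T generalizing z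
  · obtain ⟨g, hg, hgU⟩ := h.exists_U
    have g0 := h.ne_zero hgU.1
    have hgz := h.mul_notMem' hgU.1 hz
    rw [not_not] at haz
    refine this (z * g) (mul_ne_zero z0 g0) hgz ?_ ?_ ?_
    · rw [← h.dom_iff (mul_ne_zero z0 g0) (h.ne_zero hH) (h.mul_notMem' hH hgz), ← hgU.scale h z0
        (h.ne_zero hH) (h.mul_notMem' hH hz), h.dom_iff z0 (h.ne_zero hH) (h.mul_notMem' hH hz)]
      exact hz'
    · rw [← hgU.scale h z0 one_ne_zero (by simpa using hz)]
      exact hcon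
    · intro hh
      apply hg
      apply h.T_cancel haz
      convert hh using 1; ring
  unfold Dom at hz' hcon
  have e1 : 1 + a + z ∈ T := h.T_cancel h1 (by rwa [mul_comm])
  have e0 : z + 1 ≠ 0 := left_ne_zero_of_mul (h.ne_zero_of_T hcon)
  have ez : z + 1 ∉ H := fun hh => hz (h.H_cancel hh (h.subset hcon))
  have := h.add_H' (a := z + 1) (b := a) e0 (h.index _ _ e0 a0 ez ha)
    (fun hh => haz (h.T_tr (T_symm hcon) hh))
  apply ez
  refine h.H_cancel (h.subset e1) ?_
  convert this using 1; ring

lemma mem_of_H (h : RigidPair H T) {a : K} (ha : a ∈ H) (hm : Mem H T a) :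
    ∀ x : K, x ≠ 0 → x ∉ H → Dom T a x → Dom T 1 x := by
  rcases hm with rfl | h1 | h1
  · exact absurd ha h.zero_notMem
  · exact absurd ha h1.2.1
  · exact h1.2

lemma isU_of_mem (h : RigidPair H T) {a : K} (ha : a ∈ H) (h1 : Mem H T a) (h2 : Mem H T a⁻¹) :
    IsU H T a := by
  have a0 := h.ne_zero ha
  refine ⟨ha, fun x x0 hx => ⟨fun h3 => ?_, h.mem_of_H ha h1 x x0 hx⟩⟩
  have := h.mem_of_H (h.inv_H ha) h2 (a⁻¹ * x) (mul_ne_zero (inv_ne_zero a0) x0)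
    (h.mul_notMem (h.inv_H ha) hx)
    (by rw [← h.dom_scale a0, mul_inv_cancel₀ a0, mul_inv_cancel_left₀ a0]; exact h3)
  rwa [← h.dom_scale a0, mul_one, mul_inv_cancel_left₀ a0] at this

lemma one_add_isU (h : RigidPair H T) {a : K} (a0 : a ≠ 0) (ha : a ∉ H) (h1 : Dom T 1 a) :
    IsU H T (1 + a) := by
  have hm := Mem.one_add_odd h a0 ha h1
  have h1' := h1
  unfold Dom at h1'; rw [mul_one] at h1'
  have hH := h.subset h1'
  refine h.isU_of_mem hH hm ?_
  have e0 := h.ne_zero hH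
  have e : (1 + a)⁻¹ = 1 + (-(a / (1 + a))) := by field_simp; ring
  have hodd : a / (1 + a) ∉ H := by rw [div_eq_mul_inv]; exact h.mul_notMem' (h.inv_H hH) ha
  have q0 : a / (1 + a) ≠ 0 := div_ne_zero a0 e0
  rw [e]
  refine Mem.one_add_odd h (neg_ne_zero.2 q0) (h.neg_notMem hodd) (h.dom_neg_aux q0 hodd ?_)
  rw [← h.dom_scale e0, mul_one, mul_div_cancel₀ _ e0]
  by_contra hcon
  rw [h.dom_iff e0 a0 (h.mul_notMem hH ha)] at hcon
  have := h.dom_neg_left a0 e0 (h.mul_notMem' hH ha) hcon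
  unfold Dom at this
  have e2 : (-a + (1 + a)) * -a = -a := by ring
  rw [e2] at this
  exact h.neg_notMem ha (h.subset this)

lemma Mem.one_add (h : RigidPair H T) {a : K} (ha : Mem H T a) : Mem H T (1 + a) := by
  have h1m : Mem H T 1 := Or.inr (Or.inr ⟨h.subset h.one_T, fun _ _ _ hh => hh⟩)
  rcases ha with rfl | ⟨a0, ha, ha'⟩ | ⟨ha, ha'⟩
  · simpa using h1m
  · exact Mem.one_add_odd h a0 ha ha'
  by_cases e0 : 1 + a = 0
  · left; exact e0
  by_cases hH : 1 + a ∈ H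
  · right; right
    refine ⟨hH, fun z z0 hz hz' => ?_⟩
    by_contra hcon
    have hcon' := hcon
    rw [h.dom_iff one_ne_zero z0 (by simpa using hz)] at hcon
    have a0 := h.ne_zero ha
    have hza : Dom T z a := by
      rw [← h.dom_iff a0 z0 (h.mul_notMem ha hz)]
      exact fun hh => hcon' (ha' z z0 hz hh)
    have hu : IsU H T (1 + z⁻¹) := h.one_add_isU (inv_ne_zero z0) (h.inv_notMem hz) (by
      rw [← h.dom_scale z0, mul_one, mul_inv_cancel₀ z0]; exact hcon)
    rw [hu.scale h z0 a0 (h.mul_notMem' ha hz)] at hza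
    have e2 : z * (1 + z⁻¹) = z + 1 := by field_simp
    rw [e2] at hza
    unfold Dom at hza hcon
    have : (z + (1 + a)) * z ∈ T := by
      have := h.T_tr hza hcon
      rwa [add_assoc] at this
    exact h.not_both (h.mul_notMem hH hz) hz' this
  · right; left
    refine ⟨e0, hH, ?_⟩
    by_contra hcon
    rw [h.dom_iff one_ne_zero e0 (by simpa using hH)] at hcon
    have := h.dom_neg_right e0 one_ne_zero (by simpa using hH) hcon
    unfold Dom at this
    have e2 : 1 + a + -1 = a := by ring
    rw [e2] at this
    exact h.mul_notMem ha hH (h.subset this)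

lemma Mem.add (h : RigidPair H T) {a b : K} (ha : Mem H T a) (hb : Mem H T b) :
    Mem H T (a + b) := by
  by_cases a0 : a = 0
  · simpa [a0] using hb
  by_cases b0 : b = 0
  · simpa [b0] using ha
  rcases Mem.total h (a / b) with h1 | h1
  · have := Mem.mul h hb (Mem.one_add h h1)
    convert this using 1; field_simp; ring
  · rw [inv_div] at h1
    have := Mem.mul h ha (Mem.one_add h h1)
    convert this using 1; field_simp

/-- The valuation ring attached to a rigid pair. -/
def valuationSubring (h : RigidPair H T) : ValuationSubring K where
  carrier := {a | Mem H T a}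
  mul_mem' := Mem.mul h
  one_mem' := Or.inr (Or.inr ⟨h.subset h.one_T, fun _ _ _ hh => hh⟩)
  add_mem' := Mem.add h
  zero_mem' := Or.inl rfl
  neg_mem' := Mem.neg h
  mem_or_inv_mem' := Mem.total h

lemma mem_of_unit (h : RigidPair H T) {a : K} (a0 : a ≠ 0) (h1 : Mem H T a) (h2 : Mem H T a⁻¹) :
    a ∈ H := by
  by_contra ha
  rcases h1 with h1 | h1 | h1
  · exact a0 h1
  · rcases h2 with h2 | h2 | h2
    · exact inv_ne_zero a0 h2
    · have := h2.2.2
      rw [← h.dom_scale a0, mul_one, mul_inv_cancel₀ a0] at this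
      exact h.not_both (by simpa using ha) h1.2.2 this
    · exact h.inv_notMem ha h2.1
  · exact ha h1.1

lemma one_add_mem_T (h : RigidPair H T) {a : K} (h1 : Mem H T a) (h2 : a ≠ 0 → ¬ Mem H T a⁻¹) :
    1 + a ∈ T := by
  rcases h1 with rfl | ⟨a0, ha, ha'⟩ | ⟨ha, ha'⟩
  · simpa using h.one_T
  · unfold Dom at ha'; rwa [mul_one] at ha'
  have a0 := h.ne_zero ha
  have : ∃ x : K, x ≠ 0 ∧ x ∉ H ∧ Dom T a⁻¹ x ∧ ¬ Dom T 1 x := by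
      by_contra! hh; exact h2 a0 (Or.inr (Or.inr ⟨h.inv_H ha, hh⟩))
  obtain ⟨y, y0, hy, hy1, hy2⟩ := this
  rw [h.dom_iff one_ne_zero y0 (by simpa using hy)] at hy2
  rw [← h.dom_scale a0, mul_inv_cancel₀ a0] at hy1
  rw [← h.dom_scale a0, mul_one] at hy2
  obtain ⟨z, rfl⟩ : ∃ z, z = a * y := ⟨_, rfl⟩
  set z := a * y with hz
  have z0 : z ≠ 0 := mul_ne_zero a0 y0
  have hzH : z ∉ H := h.mul_notMem ha hy
  -- now `1 > z > a`
  have u1 := h.one_add_isU z0 hzH hy1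
  have u2 : IsU H T (1 + (-(a / z))) := by
    have q0 : a / z ≠ 0 := div_ne_zero a0 z0
    have qH : a / z ∉ H := by rw [div_eq_mul_inv]; exact h.mul_notMem ha (h.inv_notMem hzH)
    refine h.one_add_isU (neg_ne_zero.2 q0) (h.neg_notMem qH) (h.dom_neg_aux q0 qH ?_)
    rw [← h.dom_scale z0, mul_one, mul_div_cancel₀ _ z0]; exact hy2
  have e1 : z * (1 + (-(a / z))) = z - a := by field_simp; ring
  have hza0 : z - a ≠ 0 := by rw [← e1]; exact mul_ne_zero z0 (h.ne_zero u2.1)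
  have hzaH : z - a ∉ H := by rw [← e1]; exact h.mul_notMem' u2.1 hzH
  have p1 : Dom T 1 (z - a) := by
    rw [← h.dom_iff hza0 one_ne_zero (by simpa using hzaH), ← e1,
      ← u2.scale h z0 one_ne_zero (by simpa using hzH), h.dom_iff z0 one_ne_zero
      (by simpa using hzH)]
    exact hy1
  rw [u1.2 _ hza0 hzaH] at p1
  have p2 := h.dom_neg_right (h.ne_zero u1.1) hza0 (h.mul_notMem u1.1 hzaH) p1
  unfold Dom at p2 hy1
  rw [mul_one] at hy1
  refine h.T_cancel hy1 ?_
  convert p2 using 1; ring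

theorem exists_valuationSubring (h : RigidPair H T) :
    ∃ O : ValuationSubring K, (∀ u, O.valuation u = 1 → u ∈ H) ∧
      (∀ f ∈ H, ∃ t ∈ T, O.valuation (f * t) = 1) ∧ (∀ m, O.valuation m < 1 → 1 + m ∈ T) := by
  refine ⟨h.valuationSubring, fun u hu => ?_, fun f hf => ?_, fun m hm => ?_⟩
  · have u0 : u ≠ 0 := by rintro rfl; simp at hu
    refine h.mem_of_unit u0 ?_ ?_
    · exact (h.valuationSubring.valuation_le_one_iff u).1 hu.le
    · refine (h.valuationSubring.valuation_le_one_iff u⁻¹).1 ?_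
      simp [hu]
  · by_cases hf' : f ∈ T
    · have f0 := h.ne_zero hf
      refine ⟨f⁻¹, h.T_cancel hf' (by rw [mul_inv_cancel₀ f0]; exact h.one_T), ?_⟩
      rw [mul_inv_cancel₀ f0]; simp
    · obtain ⟨g, hg, hgU⟩ := h.exists_unit hf hf'
      have f0 := h.ne_zero hf
      have g0 := h.ne_zero hgU.1
      refine ⟨f⁻¹ * g, ?_, ?_⟩
      · refine h.T_cancel (h.sq_mem f f0) ?_
        convert hg using 1; field_simp
      · rw [mul_inv_cancel_left₀ f0]
        have m1 : h.valuationSubring.valuation g ≤ 1 := by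
          rw [h.valuationSubring.valuation_le_one_iff]
          exact Or.inr (Or.inr ⟨hgU.1, fun x x0 hx => (hgU.2 x x0 hx).2⟩)
        have m2 : h.valuationSubring.valuation g⁻¹ ≤ 1 := by
          rw [h.valuationSubring.valuation_le_one_iff]
          refine Or.inr (Or.inr ⟨h.inv_H hgU.1, fun x x0 hx hd => ?_⟩)
          rw [← h.dom_scale g0, mul_inv_cancel₀ g0,
            hgU.2 _ (mul_ne_zero g0 x0) (h.mul_notMem hgU.1 hx)] at hd
          rw [← h.dom_scale g0, mul_one]; exact hd
        refine le_antisymm m1 ?_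
        rw [map_inv₀] at m2
        exact (inv_le_one₀ (zero_lt_iff.2 ((Valuation.ne_zero_iff _).2 g0))).1 m2
  · refine h.one_add_mem_T ?_ fun m0 hh => ?_
    · exact (h.valuationSubring.valuation_le_one_iff m).1 hm.le
    · have := (h.valuationSubring.valuation_le_one_iff m⁻¹).2 hh
      rw [map_inv₀] at this
      exact absurd ((inv_le_one₀ (zero_lt_iff.2 ((Valuation.ne_zero_iff _).2 m0))).1 this)
        (not_le.2 hm)

end RigidPair

section SquareClasses

variable {K : Type*} [Field K]

lemma sqCl_eq_iff {u w : Kˣ} : sqCl u = sqCl w ↔ ∃ r : Kˣ, w = u * r ^ 2 := by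
  unfold sqCl
  rw [QuotientGroup.eq]
  constructor
  · rintro ⟨r, hr⟩
    exact ⟨r, by rw [← mul_inv_cancel_left u w, ← hr]; rfl⟩
  · rintro ⟨r, rfl⟩
    exact ⟨r, by simp⟩

lemma sqCl_surj (x : SqClass K) : ∃ u : Kˣ, sqCl u = x := QuotientGroup.mk_surjective x

lemma sqCl_mul (u w : Kˣ) : sqCl (u * w) = sqCl u * sqCl w := rfl

lemma sqClass_mul_comm (x y : SqClass K) : x * y = y * x := by
  obtain ⟨u, rfl⟩ := sqCl_surj x
  obtain ⟨w, rfl⟩ := sqCl_surj y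
  rw [← sqCl_mul, ← sqCl_mul, mul_comm]

/-- `Value x d`: the class `d` is represented by the binary form `⟨1, x⟩`. -/
def Value (x d : SqClass K) : Prop :=
  ∃ u w : Kˣ, sqCl u = x ∧ sqCl w = d ∧ ∃ s t : K, (w : K) = s ^ 2 + u * t ^ 2

lemma value_iff {u w : Kˣ} :
    Value (sqCl u) (sqCl w) ↔ ∃ s t : K, (w : K) = s ^ 2 + u * t ^ 2 := by
  constructor
  · rintro ⟨u', w', hu, hw, s, t, e⟩
    obtain ⟨r, rfl⟩ := sqCl_eq_iff.1 hw
    obtain ⟨r', rfl⟩ := sqCl_eq_iff.1 hu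
    refine ⟨s * r, t * r * (r' : K)⁻¹, ?_⟩
    have hr' := r'.ne_zero
    push_cast
    rw [e]; field_simp
  · rintro ⟨s, t, e⟩
    exact ⟨u, w, rfl, rfl, s, t, e⟩

lemma IsWittEquiv.value_iff {L : Type*} [Field L] {α : SqClass K ≃* SqClass L}
    (hα : IsWittEquiv α) (x d : SqClass K) : Value (α x) (α d) ↔ Value x d := by
  obtain ⟨u, rfl⟩ := sqCl_surj x
  obtain ⟨w, rfl⟩ := sqCl_surj d
  obtain ⟨u', hu'⟩ := sqCl_surj (α (sqCl u))
  obtain ⟨w', hw'⟩ := sqCl_surj (α (sqCl w))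
  rw [← hu', ← hw', _root_.value_iff, _root_.value_iff]
  have := hα.represents 1 u w 1 u' w' (by
    have h1 : sqCl (1 : Kˣ) = 1 := rfl
    have h2 : sqCl (1 : Lˣ) = 1 := rfl
    rw [h1, h2, map_one]) hu'.symm hw'.symm
  simpa using this.symm

end SquareClasses

/-- Group-theoretic conditions on a pair of subgroups `T ≤ H` expressing that `H` is the even part
of a valuation with suitable residue field. -/
structure SpecialPair {G : Type*} [Group G] (R : G → G → Prop) (ε : G) (H T : Subgroup G) :
    Prop where
  le : T ≤ H
  index : ∀ x y, x ∉ H → y ∉ H → x * y ∈ H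
  neg_one : ε ∈ H
  rigid : ∀ x, x ∉ H → ∀ d, R x d → d ∈ T ∨ d * x ∈ T
  gen : ∀ t ∈ T, ∃ x₁ x₂ d₁ d₂, x₁ ∉ H ∧ x₂ ∉ H ∧ d₁ ∈ H ∧ d₂ ∈ H ∧ R x₁ d₁ ∧ R x₂ d₂ ∧
    t = d₁ * d₂
  add : ∀ y ∈ H, ε * y ∉ T → ∀ d, R y d → d ∈ H
  unit : ∀ y ∈ H, ε * y ∉ T → ∃ d, R y d ∧ d ∉ T ∧ d * y ∉ T
  index_two : ∀ y ∈ H, ε * y ∉ T → ∃ h ∈ H, (∀ t ∈ T, ∀ d, R y d → h ≠ t * d) ∧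
    ∀ g ∈ H, ∃ t ∈ T, ∃ d, R y d ∧ (g = t * d ∨ g * h = t * d)
  nontriv : ∃ y ∈ H, y ∉ T ∧ ε * y ∉ T

lemma SpecialPair.comap {G G' : Type*} [Group G] [Group G'] {R : G → G → Prop}
    {R' : G' → G' → Prop} {ε : G} {ε' : G'} {H T : Subgroup G} (h : SpecialPair R ε H T)
    (e : G' ≃* G) (he : e ε' = ε) (hR : ∀ x d, R (e x) (e d) ↔ R' x d) :
    SpecialPair R' ε' (H.comap e.toMonoidHom) (T.comap e.toMonoidHom) where
  le := fun x hx => h.le hx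
  index := fun x y hx hy => by
    have := h.index _ _ hx hy
    rwa [← map_mul] at this
  neg_one := by
    change e ε' ∈ H; rw [he]; exact h.neg_one
  rigid := fun x hx d hd => by
    have := h.rigid _ hx (e d) ((hR x d).2 hd)
    change e d ∈ T ∨ e (d * x) ∈ T
    rwa [map_mul]
  gen := fun t ht => by
    obtain ⟨x₁, x₂, d₁, d₂, h1, h2, h3, h4, h5, h6, h7⟩ := h.gen _ ht
    obtain ⟨x₁, rfl⟩ := e.surjective x₁
    obtain ⟨x₂, rfl⟩ := e.surjective x₂
    obtain ⟨d₁, rfl⟩ := e.surjective d₁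
    obtain ⟨d₂, rfl⟩ := e.surjective d₂
    refine ⟨x₁, x₂, d₁, d₂, h1, h2, h3, h4, (hR _ _).1 h5, (hR _ _).1 h6, ?_⟩
    rw [← map_mul] at h7
    exact e.injective h7
  add := fun y hy hy' d hd => by
    refine h.add (e y) hy (fun hh => hy' ?_) (e d) ((hR _ _).2 hd)
    change e (ε' * y) ∈ T
    rwa [map_mul, he]
  unit := fun y hy hy' => by
    obtain ⟨d, h1, h2, h3⟩ := h.unit (e y) hy (fun hh => hy' (by
      change e (ε' * y) ∈ T
      rwa [map_mul, he]))
    obtain ⟨d, rfl⟩ := e.surjective d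
    refine ⟨d, (hR _ _).1 h1, h2, fun hh => h3 ?_⟩
    rw [← map_mul]; exact hh
  index_two := fun y hy hy' => by
    obtain ⟨g, h1, h2, h3⟩ := h.index_two (e y) hy (fun hh => hy' (by
      change e (ε' * y) ∈ T
      rwa [map_mul, he]))
    obtain ⟨g, rfl⟩ := e.surjective g
    refine ⟨g, h1, fun t ht d hd hh => h2 (e t) ht (e d) ((hR _ _).2 hd) ?_, fun g' hg' => ?_⟩
    · rw [hh, map_mul]
    · obtain ⟨t, ht, d, hd, h4⟩ := h3 (e g') hg'
      obtain ⟨t, rfl⟩ := e.surjective t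
      obtain ⟨d, rfl⟩ := e.surjective d
      refine ⟨t, ht, d, (hR _ _).1 hd, ?_⟩
      rw [← map_mul, ← map_mul, e.injective.eq_iff, e.injective.eq_iff] at h4
      exact h4
  nontriv := by
    obtain ⟨y, h1, h2, h3⟩ := h.nontriv
    obtain ⟨y, rfl⟩ := e.surjective y
    refine ⟨y, h1, h2, fun hh => h3 ?_⟩
    have hh : e (ε' * y) ∈ T := hh
    rwa [map_mul, he] at hh

/-- The intersection of all subgroups `H` occurring in special pairs. -/
def specialCore (K : Type*) [Field K] : Set (SqClass K) :=
  {y | ∀ H T : Subgroup (SqClass K), SpecialPair Value (sqCl (-1)) H T → y ∈ H}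

lemma IsWittEquiv.mem_specialCore {K L : Type*} [Field K] [Field L] {α : SqClass K ≃* SqClass L}
    (hα : IsWittEquiv α) {y : SqClass K} (hy : y ∈ specialCore K) : α y ∈ specialCore L :=
  fun _ _ h => hy _ _ (h.comap α hα.map_neg_one hα.value_iff)

lemma IsWittEquiv.symm {K L : Type*} [Field K] [Field L] {α : SqClass K ≃* SqClass L}
    (hα : IsWittEquiv α) : IsWittEquiv α.symm where
  map_neg_one := by rw [← hα.map_neg_one, MulEquiv.symm_apply_apply]
  represents := fun a b c a' b' c' h1 h2 h3 => by
    refine (hα.represents a' b' c' a b c ?_ ?_ ?_).symm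
    · rw [← h1, MulEquiv.apply_symm_apply]
    · rw [← h2, MulEquiv.apply_symm_apply]
    · rw [← h3, MulEquiv.apply_symm_apply]

lemma IsWittEquiv.mem_specialCore_iff {K L : Type*} [Field K] [Field L]
    {α : SqClass K ≃* SqClass L} (hα : IsWittEquiv α) {y : SqClass K} :
    α y ∈ specialCore L ↔ y ∈ specialCore K :=
  ⟨fun h => by simpa using hα.symm.mem_specialCore h, hα.mem_specialCore⟩

section Lift

variable {K : Type*} [Field K]

/-- The nonzero elements whose square class lies in `S`. -/
def liftSet (S : Subgroup (SqClass K)) : Set K := {x | ∃ u : Kˣ, (u : K) = x ∧ sqCl u ∈ S}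

lemma coe_mem_liftSet {S : Subgroup (SqClass K)} {u : Kˣ} : (u : K) ∈ liftSet S ↔ sqCl u ∈ S :=
  ⟨fun ⟨w, hw, hw'⟩ => by rwa [← Units.ext hw], fun h => ⟨u, rfl, h⟩⟩

lemma ne_zero_of_liftSet {S : Subgroup (SqClass K)} {x : K} (hx : x ∈ liftSet S) : x ≠ 0 := by
  obtain ⟨u, rfl, -⟩ := hx; exact u.ne_zero

lemma mul_mem_liftSet {S : Subgroup (SqClass K)} {x y : K} (hx : x ∈ liftSet S)
    (hy : y ∈ liftSet S) : x * y ∈ liftSet S := by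
  obtain ⟨u, rfl, hu⟩ := hx
  obtain ⟨w, rfl, hw⟩ := hy
  exact ⟨u * w, by simp, S.mul_mem hu hw⟩

lemma sq_mem_liftSet {S : Subgroup (SqClass K)} {x : K} (hx : x ≠ 0) : x ^ 2 ∈ liftSet S := by
  refine ⟨(Units.mk0 x hx) ^ 2, by simp, ?_⟩
  have : sqCl ((Units.mk0 x hx) ^ 2) = sqCl 1 := (sqCl_eq_iff.2 ⟨Units.mk0 x hx, by simp⟩).symm
  rw [this]; exact S.one_mem

end Lift

section Consequences

variable {K : Type*} [Field K] {H T : Subgroup (SqClass K)}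

lemma SpecialPair.rigid_elem (h : SpecialPair Value (sqCl (-1)) H T) {x d s t : K} (hx : x ≠ 0)
    (hxH : x ∉ liftSet H) (hd : d ≠ 0) (e : d = s ^ 2 + x * t ^ 2) :
    d ∈ liftSet T ∨ d * x ∈ liftSet T := by
  lift x to Kˣ using isUnit_iff_ne_zero.2 hx
  lift d to Kˣ using isUnit_iff_ne_zero.2 hd
  rw [coe_mem_liftSet] at hxH
  rw [← Units.val_mul, coe_mem_liftSet, coe_mem_liftSet]
  exact h.rigid _ hxH _ (value_iff.2 ⟨s, t, e⟩)

lemma neg_one_mem_liftSet {S : Subgroup (SqClass K)} (h : sqCl (-1) ∈ S) : (-1 : K) ∈ liftSet S :=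
  ⟨-1, by simp, h⟩

lemma SpecialPair.index_elem (h : SpecialPair Value (sqCl (-1)) H T) {x y : K} (hx : x ≠ 0)
    (hy : y ≠ 0) (hxH : x ∉ liftSet H) (hyH : y ∉ liftSet H) : x * y ∈ liftSet H := by
  lift x to Kˣ using isUnit_iff_ne_zero.2 hx
  lift y to Kˣ using isUnit_iff_ne_zero.2 hy
  rw [coe_mem_liftSet] at hxH hyH
  rw [← Units.val_mul, coe_mem_liftSet]
  exact h.index _ _ hxH hyH

theorem SpecialPair.rigidPair (h : SpecialPair Value (sqCl (-1)) H T) (hT : sqCl (-1) ∈ T) :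
    RigidPair (liftSet H) (liftSet T) where
  zero_notMem := fun h0 => ne_zero_of_liftSet h0 rfl
  subset := by rintro _ ⟨u, rfl, hu⟩; exact ⟨u, rfl, h.le hu⟩
  mul_H := fun x hx y hy => mul_mem_liftSet hx hy
  mul_T := fun x hx y hy => mul_mem_liftSet hx hy
  sq_mem := fun x hx => sq_mem_liftSet hx
  neg_one := neg_one_mem_liftSet hT
  index := fun x y hx hy hx' hy' => h.index_elem hx hy hx' hy'
  rigid := fun x hx hx' => by
    have h0 : 1 + x ≠ 0 := fun e => hx' (by
      rw [eq_neg_of_add_eq_zero_right e]; exact neg_one_mem_liftSet (h.le hT))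
    exact h.rigid_elem (s := 1) (t := 1) hx hx' h0 (by ring)
  add_H := fun y hy hy' => by
    have h0 : 1 + y ≠ 0 := fun e => hy' (by
      rw [eq_neg_of_add_eq_zero_right e]; exact neg_one_mem_liftSet hT)
    have hy0 := ne_zero_of_liftSet hy
    lift y to Kˣ using isUnit_iff_ne_zero.2 hy0
    rw [coe_mem_liftSet] at hy hy'
    refine ⟨Units.mk0 _ h0, rfl, ?_⟩
    refine h.add _ hy (fun hh => hy' ((T.mul_mem_cancel_left hT).1 hh)) _
      (value_iff.2 ⟨1, 1, by simp⟩)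
  unit := fun f hf hf' => by
    have hf0 := ne_zero_of_liftSet hf
    lift f to Kˣ using isUnit_iff_ne_zero.2 hf0
    rw [coe_mem_liftSet] at hf hf'
    obtain ⟨d, h1, h2, h3⟩ := h.unit _ hf (fun hh => hf' ((T.mul_mem_cancel_left hT).1 hh))
    obtain ⟨d, rfl⟩ := sqCl_surj d
    obtain ⟨s, t, e⟩ := value_iff.1 h1
    rw [← coe_mem_liftSet] at h2
    rw [← sqCl_mul, ← coe_mem_liftSet] at h3
    have hs : s ≠ 0 := by
      rintro rfl
      have ht : t ≠ 0 := by rintro rfl; exact d.ne_zero (by simp at e)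
      apply h3
      have : ((d * f : Kˣ) : K) = (f * t) ^ 2 := by push_cast; rw [e]; ring
      rw [this]; exact sq_mem_liftSet (mul_ne_zero hf0 ht)
    have ht : t ≠ 0 := by
      rintro rfl
      apply h2
      have : (d : K) = s ^ 2 := by rw [e]; ring
      rw [this]; exact sq_mem_liftSet hs
    have e2 : (d : K) = s ^ 2 * (1 + f * (t / s) ^ 2) := by rw [e]; field_simp
    refine ⟨f * (t / s) ^ 2, ?_, fun hh => h2 ?_, fun hh => h3 ?_⟩
    · have : (f : K) * (f * (t / s) ^ 2) = (f * (t / s)) ^ 2 := by ring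
      rw [this]; exact sq_mem_liftSet (mul_ne_zero hf0 (div_ne_zero ht hs))
    · rw [e2]; exact mul_mem_liftSet (sq_mem_liftSet hs) hh
    · have : ((d * f : Kˣ) : K) = (s * (s / t)) ^ 2 *
        ((1 + f * (t / s) ^ 2) * (f * (t / s) ^ 2)) := by
        push_cast; rw [e2]; field_simp
      rw [this]; exact mul_mem_liftSet (sq_mem_liftSet (mul_ne_zero hs (div_ne_zero hs ht))) hh
  nontriv := by
    obtain ⟨y, h1, h2, h3⟩ := h.nontriv
    obtain ⟨y, rfl⟩ := sqCl_surj y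
    exact ⟨y, coe_mem_liftSet.2 h1, fun hh => h2 (coe_mem_liftSet.1 hh)⟩

end Consequences

/-- `b` is a norm from the quadratic extension obtained by adjoining a square root of `a`. -/
def NormRel {k : Type*} [Field k] (a b : k) : Prop := ∃ s t : k, b = s ^ 2 - a * t ^ 2

/-- Fields whose quadratic Hilbert symbol is bilinear and nondegenerate. -/
structure HilbertField (k : Type*) [Field k] : Prop where
  two_ne : (2 : k) ≠ 0
  exists_not : ∀ a : k, a ≠ 0 → ¬ IsSquare a → ∃ b : k, b ≠ 0 ∧ ¬ NormRel a b
  mul_of_not : ∀ a b c : k, a ≠ 0 → b ≠ 0 → c ≠ 0 → ¬ NormRel a b → ¬ NormRel a c →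
    NormRel a (b * c)

/-- There are more than four square classes. -/
def ManySquareClasses (k : Type*) [Field k] : Prop :=
  ∀ c e : k, c ≠ 0 → e ≠ 0 → ∃ u : k, u ≠ 0 ∧ ¬ IsSquare u ∧ ¬ IsSquare (u * c) ∧
    ¬ IsSquare (u * e) ∧ ¬ IsSquare (u * (c * e))

section Norm

variable {k : Type*} [Field k] {a b c : k}

lemma NormRel.mul (h1 : NormRel a b) (h2 : NormRel a c) : NormRel a (b * c) := by
  obtain ⟨s, t, rfl⟩ := h1
  obtain ⟨s', t', rfl⟩ := h2
  exact ⟨s * s' + a * t * t', s * t' + t * s', by ring⟩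

lemma NormRel.sq (a r : k) : NormRel a (r ^ 2) := ⟨r, 0, by ring⟩

lemma NormRel.neg_self (a : k) : NormRel a (-a) := ⟨0, 1, by ring⟩

lemma NormRel.of_sq_mul {r : k} (hr : r ≠ 0) (h : NormRel a (r ^ 2 * b)) : NormRel a b := by
  have := h.mul (NormRel.sq a r⁻¹)
  convert this using 1; field_simp

lemma NormRel.of_isSquare (h2 : (2 : k) ≠ 0) (ha : a ≠ 0) (h : IsSquare a) (b : k) :
    NormRel a b := by
  obtain ⟨r, rfl⟩ := h
  have hr : r ≠ 0 := left_ne_zero_of_mul ha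
  exact ⟨(b + 1) / 2, (b - 1) / (2 * r), by field_simp; ring⟩

lemma NormRel.symm (h2 : (2 : k) ≠ 0) (hb : b ≠ 0) (h : NormRel a b) : NormRel b a := by
  obtain ⟨s, t, e⟩ := h
  by_cases ht : t = 0
  · exact NormRel.of_isSquare h2 hb ⟨s, by rw [e, ht]; ring⟩ _
  · refine ⟨s / t, 1 / t, ?_⟩
    field_simp
    rw [e]; ring

namespace HilbertField

variable (hk : HilbertField k)
include hk

lemma mul_iff (ha : a ≠ 0) (hb : b ≠ 0) (hc : c ≠ 0) :
    NormRel a (b * c) ↔ (NormRel a b ↔ NormRel a c) := by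
  constructor
  · intro h
    constructor
    · intro h1
      have := h1.mul h
      refine NormRel.of_sq_mul hb ?_
      convert this using 1; ring
    · intro h1
      have := h1.mul h
      refine NormRel.of_sq_mul hc ?_
      convert this using 1; ring
  · intro h
    by_cases h1 : NormRel a b
    · exact h1.mul (h.1 h1)
    · exact hk.mul_of_not a b c ha hb hc h1 (fun h2 => h1 (h.2 h2))

lemma symm_iff (ha : a ≠ 0) (hb : b ≠ 0) : NormRel a b ↔ NormRel b a :=
  ⟨NormRel.symm hk.two_ne hb, NormRel.symm hk.two_ne ha⟩

lemma mul_iff' (ha : a ≠ 0) (hb : b ≠ 0) (hc : c ≠ 0) :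
    NormRel (b * c) a ↔ (NormRel b a ↔ NormRel c a) := by
  rw [hk.symm_iff (mul_ne_zero hb hc) ha, hk.mul_iff ha hb hc, hk.symm_iff ha hb,
    hk.symm_iff ha hc]

lemma self_iff (ha : a ≠ 0) : NormRel a a ↔ NormRel a (-1) := by
  have := hk.mul_iff (a := a) (b := a) (c := -1) ha ha (by simp)
  have h2 := NormRel.neg_self a
  rw [mul_neg_one] at this
  tauto

end HilbertField

end Norm

lemma ManySquareClasses.of_card {k : Type*} [Field k] (h : 4 < Nat.card (SqClass k)) :
    ManySquareClasses k := by
  intro c e hc he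
  by_contra! hcon
  have : Finite (SqClass k) := Nat.finite_of_card_ne_zero (by omega)
  have hsub : (Set.univ : Set (SqClass k)) ⊆ {sqCl 1, sqCl (Units.mk0 c hc)⁻¹,
      sqCl (Units.mk0 e he)⁻¹, sqCl (Units.mk0 c hc * Units.mk0 e he)⁻¹} := by
    rintro x -
    obtain ⟨u, rfl⟩ := sqCl_surj x
    have key : ∀ w : kˣ, IsSquare ((u : k) * w) → sqCl u = sqCl w⁻¹ := by
      rintro w ⟨r, hr⟩
      have hr0 : r ≠ 0 := by rintro rfl; simp at hr
      refine sqCl_eq_iff.2 ⟨(Units.mk0 r hr0)⁻¹, ?_⟩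
      ext
      push_cast
      have := u.ne_zero
      have := w.ne_zero
      field_simp
      rw [Units.val_mk0, eq_div_iff (pow_ne_zero _ hr0), mul_comm (w : k), hr]; ring
    have h4 := hcon u u.ne_zero
    by_cases h1 : IsSquare (u : k)
    · left; simpa using key 1 (by simpa using h1)
    by_cases h2 : IsSquare ((u : k) * c)
    · right; left; simpa using key (Units.mk0 c hc) h2
    by_cases h3 : IsSquare ((u : k) * e)
    · right; right; left; simpa using key (Units.mk0 e he) h3
    · right; right; right
      exact key (Units.mk0 c hc * Units.mk0 e he) (h4 h1 h2 h3)
  have h1 := Set.ncard_le_ncard hsub (Set.toFinite _)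
  rw [Set.ncard_univ] at h1
  have h2 : ∀ a b c d : SqClass k, ({a, b, c, d} : Set (SqClass k)).ncard ≤ 4 := fun a b c d => by
    refine (Set.ncard_insert_le _ _).trans ?_
    have := Set.ncard_insert_le b ({c, d} : Set (SqClass k))
    have := Set.ncard_insert_le c ({d} : Set (SqClass k))
    rw [Set.ncard_singleton] at this
    omega
  have := h2 (sqCl 1) (sqCl (Units.mk0 c hc)⁻¹) (sqCl (Units.mk0 e he)⁻¹)
    (sqCl (Units.mk0 c hc * Units.mk0 e he)⁻¹)
  omega

section Dyadic

variable {k K : Type*} [Field k] [Field K] {H T : Subgroup (SqClass K)}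

lemma mem_liftSet_of_mul {S : Subgroup (SqClass K)} {x y : K} (hx : x ∈ liftSet S)
    (hxy : x * y ∈ liftSet S) : y ∈ liftSet S := by
  have h0 := ne_zero_of_liftSet hx
  have := mul_mem_liftSet (mul_mem_liftSet hx hxy) (sq_mem_liftSet (inv_ne_zero h0))
  convert this using 1; field_simp

lemma SpecialPair.neg_one_mem (hk : HilbertField k) (hbig : ManySquareClasses k) (φ : k →+* K)
    (h : SpecialPair Value (sqCl (-1)) H T) {c : k} (hc0 : c ≠ 0) (hc : φ c ∉ liftSet H) :
    sqCl (-1) ∈ T := by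
  have hn1 : (-1 : K) ∈ liftSet H := neg_one_mem_liftSet h.neg_one
  have hTH : liftSet T ⊆ liftSet H := by rintro _ ⟨u, rfl, hu⟩; exact ⟨u, rfl, h.le hu⟩
  suffices hs : (-1 : K) ∈ liftSet T by
    have : (-1 : K) = ((-1 : Kˣ) : K) := by simp
    rwa [this, coe_mem_liftSet] at hs
  have φ0 : ∀ {x : k}, x ≠ 0 → φ x ≠ 0 := fun hx => (map_ne_zero φ).2 hx
  -- represented elements of `H` lie in `T`
  have rep : ∀ x d : k, x ≠ 0 → d ≠ 0 → φ x ∉ liftSet H → φ d ∈ liftSet H → NormRel (-x) d →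
      φ d ∈ liftSet T := by
    rintro x d hx hd hxH hdH ⟨s, t, e⟩
    refine (h.rigid_elem (s := φ s) (t := φ t) (φ0 hx) hxH (φ0 hd) ?_).resolve_right
      fun hh => hxH (mem_liftSet_of_mul hdH (hTH hh))
    rw [e]; simp
  by_cases hA : ∃ x : k, x ≠ 0 ∧ φ x ∉ liftSet H ∧ NormRel (-x) (-1)
  · obtain ⟨x, hx, hxH, hN⟩ := hA
    have := rep x (-1) hx (by simp) hxH (by simpa using hn1) hN
    simpa using this
  push Not at hA
  have m1 : (-1 : k) ≠ 0 := by simp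
  have hbil : ∀ x : k, x ≠ 0 →
      (NormRel (-x) (-1) ↔ (NormRel (-1 : k) (-1) ↔ NormRel x (-1))) := by
    intro x hx
    have := hk.mul_iff' (a := (-1 : k)) (b := (-1 : k)) (c := x) m1 m1 hx
    rwa [neg_one_mul] at this
  have hmulH : ∀ {x s : k}, φ x ∉ liftSet H → φ s ∈ liftSet H → φ (x * s) ∉ liftSet H := by
    intro x s hx hs hh
    rw [map_mul, mul_comm] at hh
    exact hx (mem_liftSet_of_mul hs hh)
  -- elements of `k` lying in `H` are orthogonal to `-1`
  have hperp : ∀ s : k, s ≠ 0 → φ s ∈ liftSet H → NormRel (-1) s := by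
    intro s hs hsH
    have h1 := hA c hc0 hc
    have h2 := hA (c * s) (mul_ne_zero hc0 hs) (hmulH hc hsH)
    have h3 := hk.mul_iff' (a := (-1 : k)) (b := -c) (c := s) m1 (neg_ne_zero.2 hc0) hs
    rw [neg_mul] at h3
    rw [hk.symm_iff m1 hs]
    tauto
  have h11 : NormRel (-1 : k) (-1) := hperp (-1) m1 (by simpa using hn1)
  have hns : ¬ IsSquare (-1 : k) := fun hh =>
    hA c hc0 hc (by
      have := hbil c hc0
      have h3 := NormRel.of_isSquare hk.two_ne m1 hh c
      rw [hk.symm_iff m1 hc0] at h3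
      tauto)
  obtain ⟨w, hw0, hw⟩ := hk.exists_not (-1 : k) m1 hns
  have key : ∀ u : k, u ≠ 0 → φ u ∈ liftSet H → ¬ IsSquare u → ¬ IsSquare (-u) →
      φ u ∈ liftSet T := by
    intro u hu huH hu1 hu2
    obtain ⟨x, hx0, hx1, hx2⟩ : ∃ x : k, x ≠ 0 ∧ NormRel u x ∧ ¬ NormRel (-1) x := by
      by_contra! hcon
      obtain ⟨z, hz0, hz⟩ := hk.exists_not (-u) (neg_ne_zero.2 hu) hu2
      have e1 : ∀ y : k, y ≠ 0 → (NormRel (-u) y ↔ (NormRel (-1) y ↔ NormRel u y)) := by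
        intro y hy
        have := hk.mul_iff' (a := y) (b := -1) (c := u) hy m1 hu
        rwa [neg_one_mul] at this
      have e2 := hcon (z * w) (mul_ne_zero hz0 hw0)
      rw [hk.mul_iff hu hz0 hw0, hk.mul_iff m1 hz0 hw0] at e2
      have e3 := hcon w hw0
      have e4 := e1 z hz0
      have e5 := hcon z hz0
      tauto
    have hxH : φ x ∉ liftSet H := fun hh => hx2 (hperp x hx0 hh)
    refine rep x u hx0 hu hxH huH ?_
    have e1 := hk.mul_iff' (a := u) (b := -1) (c := x) hu m1 hx0
    rw [neg_one_mul] at e1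
    rw [hk.symm_iff hu hx0] at hx1
    have e2 := hperp u hu huH
    tauto
  obtain ⟨u, hu, huH, hu1, hu2⟩ : ∃ u : k, u ≠ 0 ∧ φ u ∈ liftSet H ∧ ¬ IsSquare u ∧
      ¬ IsSquare (-u) := by
    obtain ⟨u, hu0, h1, h2, h3, h4⟩ := hbig c (-1) hc0 m1
    by_cases hu : φ u ∈ liftSet H
    · exact ⟨u, hu0, hu, h1, by simpa using h3⟩
    · refine ⟨u * c, mul_ne_zero hu0 hc0, ?_, h2, by simpa using h4⟩
      rw [map_mul]; exact h.index_elem (φ0 hu0) (φ0 hc0) hu hc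
  have q1 := key u hu huH hu1 hu2
  have q2 := key (-u) (neg_ne_zero.2 hu) (by
    have := mul_mem_liftSet hn1 huH
    simpa using this) hu2 (by simpa using hu1)
  refine mem_liftSet_of_mul (sq_mem_liftSet (φ0 hu)) ?_
  have := mul_mem_liftSet q1 q2
  rw [map_neg] at this
  convert this using 1; ring

/-- Adding a high power of two does not change the square class. -/
def DyadicApprox (k : Type*) [Field k] : Prop :=
  ∀ c : k, c ≠ 0 → ∃ m : ℕ, 0 < m ∧ ∃ r : k, c + 2 ^ m = c * r ^ 2

theorem SpecialPair.mem_of_dyadic (hk : HilbertField k) (hbig : ManySquareClasses k)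
    (happ : DyadicApprox k) (φ : k →+* K) (h : SpecialPair Value (sqCl (-1)) H T) {c : k}
    (hc0 : c ≠ 0) : φ c ∈ liftSet H := by
  by_contra hc
  have hT := h.neg_one_mem hk hbig φ hc0 hc
  have hTH : liftSet T ⊆ liftSet H := by rintro _ ⟨u, rfl, hu⟩; exact ⟨u, rfl, h.le hu⟩
  obtain ⟨O, hO1, hO2, hO3⟩ := (h.rigidPair hT).exists_valuationSubring
  set v := O.valuation with hv
  have φ0 : ∀ {x : k}, x ≠ 0 → φ x ≠ 0 := fun hx => (map_ne_zero φ).2 hx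
  have v2le : v 2 ≤ 1 := by
    rw [hv, O.valuation_le_one_iff]
    have := O.add_mem _ _ O.one_mem O.one_mem
    rwa [one_add_one_eq_two] at this
  -- the residue characteristic is two
  have v2 : v 2 < 1 := by
    refine lt_of_le_of_ne v2le fun h2 => ?_
    wlog hvc : v (φ c) < 1 generalizing c
    · refine this (c := c⁻¹) (inv_ne_zero hc0) (fun hh => hc ?_) ?_
      · have := mul_mem_liftSet hh (sq_mem_liftSet (φ0 hc0))
        convert this using 1
        rw [map_inv₀]
        have := φ0 hc0
        field_simp
      · rw [map_inv₀, map_inv₀]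
        have h1 : v (φ c) ≠ 1 := fun h1 => hc (hO1 _ h1)
        exact inv_lt_one_of_one_lt₀ (lt_of_le_of_ne (not_lt.1 hvc) (Ne.symm h1))
    obtain ⟨m, hm, r, e⟩ := happ c hc0
    have h1 : v (φ (c + 2 ^ m)) = 1 := by
      have h3 : v ((2 : K) ^ m) = 1 := by rw [map_pow, h2, one_pow]
      rw [map_add, map_pow, map_ofNat, Valuation.map_add_eq_of_lt_right _ (by rwa [h3]), h3]
    have h4 := hO1 _ h1
    have hr : r ≠ 0 := by
      rintro rfl
      rw [e] at h1
      simp at h1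
    rw [e, map_mul, mul_comm, map_pow] at h4
    exact hc (mem_liftSet_of_mul (sq_mem_liftSet (φ0 hr)) h4)
  -- the elements of `T` are principal units up to squares
  have hgen1 : ∀ x d : SqClass K, x ∉ H → d ∈ H → Value x d → ∀ u : Kˣ, sqCl u = d →
      ∃ m z : K, v m < 1 ∧ (u : K) = (1 + m) * z ^ 2 := by
    rintro x d hx hd hxd u rfl
    obtain ⟨x, rfl⟩ := sqCl_surj x
    rw [← coe_mem_liftSet] at hx hd
    obtain ⟨s, t, e⟩ := value_iff.1 hxd
    have hs : s ≠ 0 := by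
      rintro rfl
      have ht : t ≠ 0 := by rintro rfl; exact u.ne_zero (by simp at e)
      apply hx
      refine mem_liftSet_of_mul (sq_mem_liftSet ht) ?_
      convert hd using 1; rw [e]; ring
    have e' : (u : K) = (1 + x * (t / s) ^ 2) * s ^ 2 := by rw [e]; field_simp
    by_cases ht : t = 0
    · exact ⟨0, s, by simp, by rw [e, ht]; ring⟩
    set z : K := x * (t / s) ^ 2 with hz
    have hzH : z ∉ liftSet H := fun hh => hx (by
      refine mem_liftSet_of_mul (sq_mem_liftSet (div_ne_zero ht hs)) ?_
      rwa [hz, mul_comm] at hh)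
    have z0 : z ≠ 0 := mul_ne_zero x.ne_zero (pow_ne_zero _ (div_ne_zero ht hs))
    rcases lt_trichotomy (v z) 1 with h1 | h1 | h1
    · exact ⟨z, s, h1, e'⟩
    · exact absurd (hO1 _ h1) hzH
    · exfalso
      have h2 : v z⁻¹ < 1 := by rw [map_inv₀]; exact inv_lt_one_of_one_lt₀ h1
      have h3 := hTH (hO3 _ h2)
      apply hzH
      refine mem_liftSet_of_mul (mul_mem_liftSet h3 (sq_mem_liftSet hs)) ?_
      convert hd using 1
      rw [e']; field_simp; ring
  have hgen : ∀ t : Kˣ, sqCl t ∈ T → ∃ m z : K, v m < 1 ∧ (t : K) = (1 + m) * z ^ 2 := by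
    intro t ht
    obtain ⟨x₁, x₂, d₁, d₂, h1, h2, h3, h4, h5, h6, h7⟩ := h.gen _ ht
    obtain ⟨d₁, rfl⟩ := sqCl_surj d₁
    obtain ⟨d₂, rfl⟩ := sqCl_surj d₂
    obtain ⟨m₁, z₁, hm₁, e₁⟩ := hgen1 _ _ h1 h3 h5 d₁ rfl
    obtain ⟨m₂, z₂, hm₂, e₂⟩ := hgen1 _ _ h2 h4 h6 d₂ rfl
    rw [← sqCl_mul] at h7
    obtain ⟨r, hr⟩ := sqCl_eq_iff.1 h7.symm
    refine ⟨m₁ + m₂ + m₁ * m₂, z₁ * z₂ * r, ?_, ?_⟩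
    · refine v.map_add_lt (v.map_add_lt hm₁ hm₂) ?_
      rw [map_mul]; exact mul_lt_one_of_nonneg_of_lt_one_left zero_le hm₁ hm₂.le
    · rw [hr]; push_cast; rw [e₁, e₂]; ring
  -- choose a unit `y` in `H` but not in `T`
  obtain ⟨y, hyH, hyT, hyv⟩ : ∃ y : Kˣ, sqCl y ∈ H ∧ sqCl y ∉ T ∧ v y = 1 := by
    obtain ⟨y, h1, h2, h3⟩ := h.nontriv
    obtain ⟨y, rfl⟩ := sqCl_surj y
    obtain ⟨t, ⟨t, rfl, ht⟩, ht'⟩ := hO2 y (coe_mem_liftSet.2 h1)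
    refine ⟨y * t, H.mul_mem h1 (h.le ht), fun hh => h2 ?_, by simpa using ht'⟩
    rw [sqCl_mul] at hh
    exact (T.mul_mem_cancel_right ht).1 hh
  have hny : sqCl (-1) * sqCl y ∉ T := fun hh => hyT ((T.mul_mem_cancel_left hT).1 hh)
  obtain ⟨g, hgH, hg1, hg2⟩ := h.index_two _ hyH hny
  let P : K → Prop := fun α => ∃ w : Kˣ, (w : K) = α ∧ ∃ t ∈ T, ∃ d, Value (sqCl y) d ∧
    sqCl w = t * d
  have P_sq : ∀ α r : K, r ≠ 0 → P (r ^ 2 * α) → P α := by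
    rintro α r hr ⟨w, hw, t, ht, d, hd, e⟩
    refine ⟨w * (Units.mk0 r hr)⁻¹ ^ 2, ?_, t, ht, d, hd, ?_⟩
    · push_cast; rw [hw, Units.val_mk0]; field_simp
    · rw [← e]; exact (sqCl_eq_iff.2 ⟨_, rfl⟩).symm
  have P_of : ∀ α s r : K, v α = 1 → v (α - (s ^ 2 + y * r ^ 2)) < 1 → P α := by
    intro α s r hα hd
    set δ := s ^ 2 + y * r ^ 2 with hδ
    have h1 : v δ = 1 := by
      have : δ = α - (α - δ) := by ring
      rw [this, Valuation.map_sub_eq_of_lt_left v (by rwa [hα]), hα]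
    have δ0 : δ ≠ 0 := by intro h0; rw [h0] at h1; simp at h1
    have α0 : α ≠ 0 := by intro h0; rw [h0] at hα; simp at hα
    have h2 : v ((α - δ) / δ) < 1 := by rw [map_div₀, h1, div_one]; exact hd
    obtain ⟨t, ht, htT⟩ := hO3 _ h2
    refine ⟨Units.mk0 α α0, rfl, sqCl t, htT, sqCl (Units.mk0 δ δ0),
      value_iff.2 ⟨s, r, by simp [hδ]⟩, ?_⟩
    rw [← sqCl_mul]
    congr 1
    ext
    push_cast
    rw [ht, Units.val_mk0, Units.val_mk0]; field_simp; ring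
  have P_to : ∀ α : K, v α = 1 → P α → ∃ s r : K, v s ≤ 1 ∧ v r ≤ 1 ∧
      v (α - (s ^ 2 + y * r ^ 2)) < 1 := by
    rintro α hα ⟨w, rfl, t, ht, d, hd, e⟩
    obtain ⟨t, rfl⟩ := sqCl_surj t
    obtain ⟨d, rfl⟩ := sqCl_surj d
    obtain ⟨m, z, hm, ez⟩ := hgen t ht
    obtain ⟨s, r, ed⟩ := value_iff.1 hd
    rw [← sqCl_mul] at e
    obtain ⟨q, hq⟩ := sqCl_eq_iff.1 e.symm
    obtain ⟨S, R, eSR⟩ : ∃ S R : K, (w : K) = (1 + m) * (S ^ 2 + y * R ^ 2) := by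
      refine ⟨s * z * q, r * z * q, ?_⟩
      rw [hq]; push_cast; rw [ez, ed]; ring
    have hm1 : v (1 + m) = 1 := by
      rw [v.map_one_add_of_lt hm]
    set δ := S ^ 2 + y * R ^ 2 with hδ
    have hδ1 : v δ = 1 := by
      rw [eSR, map_mul, hm1, one_mul] at hα; exact hα
    have vyR : v (y * R ^ 2) = v R ^ 2 := by rw [map_mul, hyv, one_mul, map_pow]
    have hSR : v S ≤ 1 ∧ v R ≤ 1 := by
      rcases lt_trichotomy (v S) (v R) with h1 | h1 | h1
      · have h2 : v δ = v R ^ 2 := by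
          rw [hδ, Valuation.map_add_eq_of_lt_right v, vyR]
          rw [vyR, map_pow]; exact pow_lt_pow_left₀ h1 zero_le two_ne_zero
        rw [hδ1] at h2
        have h3 : v R ≤ 1 := (pow_le_one_iff_of_nonneg zero_le two_ne_zero).1 h2.symm.le
        exact ⟨h1.le.trans h3, h3⟩
      · by_contra hcon
        have h2 : 1 < v R := by
          by_contra h2; exact hcon ⟨h1.le.trans (not_lt.1 h2), not_lt.1 h2⟩
        have R0 : R ≠ 0 := by rintro rfl; simp at h2
        have S0 : S ≠ 0 := by rintro rfl; rw [← h1] at h2; simp at h2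
        have h3 : v (-(δ / S ^ 2)) < 1 := by
          rw [Valuation.map_neg, map_div₀, hδ1, map_pow, h1, one_div]
          exact inv_lt_one_of_one_lt₀ (one_lt_pow₀ h2 two_ne_zero)
        have h4 := hO3 _ h3
        have h5 : 1 + -(δ / S ^ 2) = (R / S) ^ 2 * (-1 * y) := by
          rw [hδ]; field_simp; ring
        rw [h5] at h4
        have h6 := mem_liftSet_of_mul (sq_mem_liftSet (div_ne_zero R0 S0)) h4
        apply hny
        rw [← sqCl_mul, ← coe_mem_liftSet]
        simpa using h6
      · have h2 : v δ = v S ^ 2 := by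
          rw [hδ, Valuation.map_add_eq_of_lt_left v, map_pow]
          rw [vyR, map_pow]; exact pow_lt_pow_left₀ h1 zero_le two_ne_zero
        rw [hδ1] at h2
        have h3 : v S ≤ 1 := (pow_le_one_iff_of_nonneg zero_le two_ne_zero).1 h2.symm.le
        exact ⟨h3, h1.le.trans h3⟩
    refine ⟨S, R, hSR.1, hSR.2, ?_⟩
    have : (w : K) - (S ^ 2 + y * R ^ 2) = m * δ := by rw [eSR, hδ]; ring
    rw [this, map_mul, hδ1, mul_one]; exact hm
  -- choose the second coset representative to be a unit
  obtain ⟨g', rfl⟩ := sqCl_surj g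
  obtain ⟨h', hh'H, hh'v, hP1, hP2⟩ : ∃ h' : K, h' ∈ liftSet H ∧ v h' = 1 ∧ ¬ P h' ∧
      ∀ α ∈ liftSet H, P α ∨ P (α * h') := by
    obtain ⟨t, ⟨t, rfl, ht⟩, ht'⟩ := hO2 g' (coe_mem_liftSet.2 hgH)
    refine ⟨g' * t, ⟨g' * t, by simp, H.mul_mem hgH (h.le ht)⟩, ht', ?_, ?_⟩
    · rintro ⟨w, hw, t₁, ht₁, d, hd, e⟩
      obtain rfl : w = g' * t := Units.ext (by simpa using hw)
      refine hg1 (t₁ * (sqCl t)⁻¹) (T.mul_mem ht₁ (T.inv_mem ht)) d hd ?_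
      rw [sqCl_mul] at e
      rw [mul_assoc, sqClass_mul_comm _ d, ← mul_assoc, ← e, mul_inv_cancel_right]
    · rintro _ ⟨w, rfl, hw⟩
      obtain ⟨t₁, ht₁, d, hd, e⟩ := hg2 _ hw
      rcases e with e | e
      · exact Or.inl ⟨w, rfl, t₁, ht₁, d, hd, e⟩
      · refine Or.inr ⟨w * (g' * t), by simp, t₁ * sqCl t, T.mul_mem ht₁ ht, d, hd, ?_⟩
        rw [sqCl_mul, sqCl_mul, ← mul_assoc, e, mul_assoc, mul_assoc,
          sqClass_mul_comm d]
  have one_add : ∀ x : K, v x = 1 → ¬ P x → v (1 + x) = 1 := by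
    intro x hx hP
    refine le_antisymm ?_ (not_lt.1 fun hlt => hP ?_)
    · refine v.map_add_le (by simp) hx.le
    · have h1 : v (-(1 + x)) < 1 := by rwa [Valuation.map_neg]
      obtain ⟨w, hw, hwT⟩ := hO3 _ h1
      have e : 1 + -(1 + x) = -x := by ring
      rw [e] at hw
      refine ⟨-w, by simp [hw], sqCl (-1) * sqCl w, T.mul_mem hT hwT, sqCl 1,
        value_iff.2 ⟨1, 0, by simp⟩, ?_⟩
      rw [← sqCl_mul, ← sqCl_mul]; simp
  have descend : ∀ x : K, v x = 1 → P (1 + x) → v (1 + x) = 1 → P x := by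
    intro x hx hP hv1
    obtain ⟨s, r, hs, hr, hsr⟩ := P_to _ hv1 hP
    refine P_of x (s + 1) r hx ?_
    have e : x - ((s + 1) ^ 2 + y * r ^ 2) = (1 + x - (s ^ 2 + y * r ^ 2)) - 2 * (s + 1) := by ring
    rw [e]
    refine v.map_sub_lt hsr ?_
    rw [map_mul]
    exact mul_lt_one_of_nonneg_of_lt_one_left zero_le v2 (v.map_add_le hs (by simp))
  have hx0 : h' ≠ 0 := ne_zero_of_liftSet hh'H
  have hinv : ∀ x : K, x ≠ 0 → P x⁻¹ → P x := by
    intro x hx hP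
    refine P_sq x x⁻¹ (inv_ne_zero hx) ?_
    convert hP using 1; field_simp
  have hv1 := one_add h' hh'v hP1
  rcases hP2 (1 + h') (hO1 _ hv1) with h1 | h1
  · exact hP1 (descend h' hh'v h1 hv1)
  · apply hP1
    apply hinv h' hx0
    have hv' : v h'⁻¹ = 1 := by rw [map_inv₀, hh'v, inv_one]
    have hP' : ¬ P h'⁻¹ := fun hh => hP1 (hinv _ hx0 hh)
    refine descend h'⁻¹ hv' (P_sq _ h' hx0 ?_) (one_add _ hv' hP')
    convert h1 using 1; field_simp; ring

end Dyadic

/-- Comparison of the number of square classes of an abelian group and of a finite index subgroup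
without elements of order two. -/
lemma index_range_sq_eq {A B : Type*} [CommGroup A] [CommGroup B] (f : B →* A)
    (hf : Function.Injective f) (hidx : f.range.index ≠ 0) (htf : ∀ b : B, b ^ 2 = 1 → b = 1) :
    (powMonoidHom 2 : A →* A).range.index =
      Nat.card (powMonoidHom 2 : A →* A).ker * (powMonoidHom 2 : B →* B).range.index := by
  set s : A →* A := powMonoidHom 2
  set sB : B →* B := powMonoidHom 2
  set H := f.range
  have e1 : H.map s = sB.range.map f := by
    ext x
    simp only [Subgroup.mem_map, MonoidHom.mem_range, H]
    constructor
    · rintro ⟨_, ⟨b, rfl⟩, rfl⟩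
      exact ⟨sB b, ⟨b, rfl⟩, by simp [s, sB]⟩
    · rintro ⟨_, ⟨b, rfl⟩, rfl⟩
      exact ⟨f b, ⟨b, rfl⟩, by simp [s, sB]⟩
  have h1 : (H.map s).relIndex s.range * s.range.index = (H.map s).index :=
    Subgroup.relIndex_mul_index (Subgroup.map_le_range _ _)
  have h2 : (H.map s).relIndex H * H.index = (H.map s).index :=
    Subgroup.relIndex_mul_index (by rw [e1]; exact Subgroup.map_le_range _ _)
  have h3 : (H.map s).relIndex H = sB.range.index := by
    rw [e1]
    simp only [H]
    rw [MonoidHom.range_eq_map f, Subgroup.relIndex_map_map_of_injective _ _ hf,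
      Subgroup.relIndex_top_right]
  have h4 : (H.map s).relIndex s.range = (H ⊔ s.ker).index := by
    rw [MonoidHom.range_eq_map s, Subgroup.relIndex_map_map]
    simp
  have h5 : H.relIndex (H ⊔ s.ker) * (H ⊔ s.ker).index = H.index :=
    Subgroup.relIndex_mul_index le_sup_left
  have h6 : H.relIndex (H ⊔ s.ker) = Nat.card s.ker := by
    rw [sup_comm, Subgroup.relIndex_sup_right, ← Subgroup.inf_relIndex_right]
    have : H ⊓ s.ker = ⊥ := by
      rw [eq_bot_iff]
      rintro _ ⟨⟨b, rfl⟩, hb⟩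
      have hb' : f b ^ 2 = 1 := hb
      rw [← map_pow, ← map_one f] at hb'
      simp [htf b (hf hb')]
    rw [this, Subgroup.relIndex_bot_left]
  rw [h6] at h5
  rw [h4] at h1
  rw [h3] at h2
  have h7 : (H ⊔ s.ker).index ≠ 0 := by
    intro h; rw [h, mul_zero] at h5; exact hidx h5.symm
  apply Nat.eq_of_mul_eq_mul_left (Nat.pos_of_ne_zero h7)
  rw [h1, ← h2, ← h5]; ring

section Complete

variable {k : Type*} [NormedField k] [CompleteSpace k] (hna : ∀ x y : k, ‖x + y‖ ≤ max ‖x‖ ‖y‖)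
  {p : k} (hp0 : p ≠ 0) (hp1 : ‖p‖ < 1)

omit [CompleteSpace k] in
lemma norm_two_le_one (hna : ∀ x y : k, ‖x + y‖ ≤ max ‖x‖ ‖y‖) : ‖(2 : k)‖ ≤ 1 := by
  have := hna 1 1
  rw [max_self, norm_one] at this
  convert this using 2; norm_num

include hna

include hp1 in
lemma exists_sq_eq_one_add {y : k} (hy : ‖y‖ ≤ 1) :
    ∃ w : k, ‖w‖ ≤ 1 ∧ (1 + 4 * p * w) ^ 2 = 1 + 8 * p * y := by
  have h2 := norm_two_le_one hna
  let f : k → k := fun w => y - 2 * p * w ^ 2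
  have hmaps : Set.MapsTo f (Metric.closedBall 0 1) (Metric.closedBall 0 1) := by
    intro w hw
    rw [mem_closedBall_zero_iff] at hw ⊢
    simp only [f, sub_eq_add_neg]
    refine (hna _ _).trans (max_le hy ?_)
    rw [norm_neg, norm_mul, norm_mul, norm_pow]
    exact mul_le_one₀ (mul_le_one₀ h2 (norm_nonneg _) hp1.le) (by positivity)
      (pow_le_one₀ (norm_nonneg _) hw)
  have hc : ContractingWith ⟨‖p‖, norm_nonneg p⟩ (hmaps.restrict f _ _) := by
    refine ⟨by exact_mod_cast hp1, LipschitzWith.of_dist_le_mul ?_⟩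
    rintro ⟨w, hw⟩ ⟨w', hw'⟩
    rw [mem_closedBall_zero_iff] at hw hw'
    rw [Subtype.dist_eq, Subtype.dist_eq]
    simp only [Set.MapsTo.val_restrict_apply, f, dist_eq_norm]
    have : y - 2 * p * w ^ 2 - (y - 2 * p * w' ^ 2) = (p * (w - w')) * (-(2 * (w + w'))) := by ring
    rw [this, norm_mul, norm_mul, norm_neg, norm_mul]
    refine mul_le_of_le_one_right (by positivity) (mul_le_one₀ h2 (norm_nonneg _) ?_)
    exact (hna _ _).trans (max_le hw hw')
  obtain ⟨w, hw, hfw, -⟩ := ContractingWith.exists_fixedPoint'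
    (Metric.isClosed_closedBall.isComplete) hmaps hc (x := 0) (by simp) (edist_ne_top _ _)
  refine ⟨w, by simpa using hw, ?_⟩
  have h : y - 2 * p * w ^ 2 = w := hfw
  linear_combination (-8 * p) * h

variable (O : Subring k) (hO : ∀ x, x ∈ O ↔ ‖x‖ ≤ 1)

omit [CompleteSpace k] in
include hp1 in
lemma norm_four_mul_lt {w : k} (hw : ‖w‖ ≤ 1) : ‖4 * p * w‖ < 1 := by
  have h2 := norm_two_le_one hna
  have : (4 * p * w : k) = p * (2 * 2 * w) := by ring
  rw [this, norm_mul, norm_mul, norm_mul]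
  refine lt_of_le_of_lt (mul_le_of_le_one_right (norm_nonneg _) ?_) hp1
  exact mul_le_one₀ (mul_le_one₀ h2 (norm_nonneg _) h2) (norm_nonneg _) hw

omit [CompleteSpace k] in
include hp1 in
lemma norm_one_add_four_mul {w : k} (hw : ‖w‖ ≤ 1) : ‖1 + 4 * p * w‖ = 1 := by
  have h := norm_four_mul_lt hna hp1 hw
  apply le_antisymm
  · exact (hna _ _).trans (max_le norm_one.le h.le)
  · by_contra! hcon
    have := hna (1 + 4 * p * w) (-(4 * p * w))
    rw [add_neg_cancel_right, norm_one, norm_neg] at this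
    exact absurd (this.trans_lt (max_lt hcon h)) (lt_irrefl _)

/-- The units congruent to one modulo `4 * p`. -/
def deepUnits : Subgroup kˣ where
  carrier := {u | ∃ w : k, ‖w‖ ≤ 1 ∧ (u : k) = 1 + 4 * p * w}
  one_mem' := ⟨0, by simp, by simp⟩
  mul_mem' := by
    rintro u v ⟨w, hw, hu⟩ ⟨w', hw', hv⟩
    refine ⟨w + w' * (1 + 4 * p * w), (hna _ _).trans (max_le hw ?_), by
      push_cast; rw [hu, hv]; ring⟩
    rw [norm_mul, norm_one_add_four_mul hna hp1 hw, mul_one]; exact hw'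
  inv_mem' := by
    rintro u ⟨w, hw, hu⟩
    have h1 : ‖(u : k)‖ = 1 := by rw [hu]; exact norm_one_add_four_mul hna hp1 hw
    refine ⟨-w * (u : k)⁻¹, by rw [norm_mul, norm_inv, h1]; simpa using hw, ?_⟩
    rw [Units.val_inv_eq_inv_val]
    have := u.ne_zero
    field_simp
    rw [hu]; ring

end Complete

section Count

variable {k : Type*} [NormedField k] [CompleteSpace k] (hna : ∀ x y : k, ‖x + y‖ ≤ max ‖x‖ ‖y‖)
  {p : k} (hp0 : p ≠ 0) (hp1 : ‖p‖ < 1) (h20 : (2 : k) ≠ 0)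
  (O : Subring k) (hO : ∀ x, x ∈ O ↔ ‖x‖ ≤ 1)

include hO h20 hp0 in
lemma index_sq_deepUnits :
    (powMonoidHom 2 : deepUnits hna hp1 →* deepUnits hna hp1).range.index =
      Nat.card (O ⧸ Ideal.span {(2 : O)}) := by
  have h40 : (4 : k) ≠ 0 := by rw [show (4 : k) = 2 * 2 by norm_num]; simpa
  have h4 : (4 * p : k) ≠ 0 := mul_ne_zero h40 hp0
  have key : ∀ u : deepUnits hna hp1, (((u : kˣ) : k) - 1) / (4 * p) ∈ O := by
    rintro ⟨u, w, hw, hu⟩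
    rw [hO, hu]
    convert hw using 2
    field_simp; ring
  let g : deepUnits hna hp1 → O := fun u => ⟨(((u : kˣ) : k) - 1) / (4 * p), key u⟩
  have hg : ∀ u : deepUnits hna hp1, ((u : kˣ) : k) = 1 + 4 * p * (g u : k) := by
    intro u; simp only [g]; field_simp; ring
  have hinj : ∀ u v, g u = g v → u = v := by
    intro u v h
    ext
    rw [hg, hg, h]
  have hp' : p ∈ O := (hO p).2 hp1.le
  have hsurj : ∀ w : O, ∃ u, g u = w := by
    intro w
    have hw := (hO _).1 w.2
    have hne : 1 + 4 * p * (w : k) ≠ 0 := by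
      rw [← norm_ne_zero_iff, norm_one_add_four_mul hna hp1 hw]; exact one_ne_zero
    refine ⟨⟨Units.mk0 _ hne, w, hw, rfl⟩, ?_⟩
    ext
    simp only [g, Units.val_mk0]
    field_simp; ring
  have hgmul : ∀ u v, g (u * v) = g u + g v + 2 * (2 * ⟨p, hp'⟩ * g u * g v) := by
    intro u v
    ext
    apply mul_left_cancel₀ h4
    have := hg (u * v)
    push_cast at this
    rw [hg u, hg v] at this
    push_cast
    rw [show ((2 : O) : k) = 2 from rfl]
    linear_combination -this
  let θ : deepUnits hna hp1 →* Multiplicative (O ⧸ Ideal.span {(2 : O)}) :=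
    MonoidHom.mk' (fun u => Multiplicative.ofAdd (Ideal.Quotient.mk _ (g u))) (by
      intro u v
      rw [← ofAdd_add, ← map_add, hgmul]
      congr 1
      rw [Ideal.Quotient.eq, Ideal.mem_span_singleton']
      exact ⟨2 * ⟨p, hp'⟩ * g u * g v, by ring⟩)
  have hθ : Function.Surjective θ := by
    intro y
    obtain ⟨w, hw⟩ := Ideal.Quotient.mk_surjective (Multiplicative.toAdd y)
    obtain ⟨u, hu⟩ := hsurj w
    exact ⟨u, by simp only [θ, MonoidHom.mk'_apply]; rw [hu, hw]; rfl⟩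
  have hker : θ.ker = (powMonoidHom 2 : deepUnits hna hp1 →* deepUnits hna hp1).range := by
    ext u
    rw [MonoidHom.mem_ker, MonoidHom.mem_range]
    have : θ u = 1 ↔ g u ∈ Ideal.span {(2 : O)} := by
      rw [← Ideal.Quotient.eq_zero_iff_mem]; rfl
    rw [this, Ideal.mem_span_singleton']
    constructor
    · rintro ⟨y, hy⟩
      obtain ⟨w, hw, e⟩ := exists_sq_eq_one_add hna hp1 ((hO _).1 y.2)
      obtain ⟨v, hv⟩ := hsurj ⟨w, (hO w).2 hw⟩
      refine ⟨v, ?_⟩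
      ext
      have h1 : (g u : k) = y * 2 := by rw [← hy]; rfl
      simp only [powMonoidHom_apply]
      push_cast
      rw [hg u, hg v, hv, e, h1]; ring
    · rintro ⟨v, rfl⟩
      refine ⟨g v + 2 * ⟨p, hp'⟩ * g v * g v, ?_⟩
      rw [powMonoidHom_apply, pow_two, hgmul]; ring
  rw [← hker, Subgroup.index_ker, MonoidHom.range_eq_top.2 hθ, Subgroup.card_top]
  rfl

include hO h20 hp0 hna hp1 in
lemma card_sqClass_eq [Finite (O ⧸ Ideal.span {(2 : O)})]
    (hfin : ∀ r : O, r ≠ 0 → Finite (O ⧸ Ideal.span {r})) :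
    Nat.card (SqClass k) = 4 * Nat.card (O ⧸ Ideal.span {(2 : O)}) := by
  set V := deepUnits hna hp1
  let P : kˣ := Units.mk0 p hp0
  have hp' : p ∈ O := (hO p).2 hp1.le
  have hVn : ∀ v : V, ‖((v : kˣ) : k)‖ = 1 := by
    rintro ⟨v, w, hw, hv⟩
    rw [hv]; exact norm_one_add_four_mul hna hp1 hw
  have hpn : 0 < ‖p‖ := norm_pos_iff.2 hp0
  let f : Multiplicative ℤ × V →* kˣ := (zpowersHom kˣ P).coprod V.subtype
  have hf : ∀ m v, ((f (m, v) : kˣ) : k) = p ^ (Multiplicative.toAdd m) * ((v : kˣ) : k) := by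
    intro m v
    simp [f, P, zpowersHom_apply]
  have hfn : ∀ x, ‖((f x : kˣ) : k)‖ = ‖p‖ ^ (Multiplicative.toAdd x.1) := by
    rintro ⟨m, v⟩
    rw [hf, norm_mul, hVn, mul_one, norm_zpow]
  have hzpow : ∀ m : ℤ, ‖p‖ ^ m = 1 → m = 0 := by
    intro m h
    exact (zpow_eq_one_iff_right₀ hpn.le hp1.ne).1 h
  have hinj : Function.Injective f := by
    rw [injective_iff_map_eq_one]
    rintro ⟨m, v⟩ h
    have h1 := hfn (m, v)
    rw [h, Units.val_one, norm_one] at h1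
    have hm : m = 1 := hzpow _ h1.symm
    subst hm
    have h2 := hf 1 v
    rw [h] at h2
    have : v = 1 := by ext; simpa using h2.symm
    rw [this]; rfl
  have htf : ∀ b : Multiplicative ℤ × V, b ^ 2 = 1 → b = 1 := by
    rintro ⟨m, v⟩ h
    rw [Prod.pow_mk, Prod.mk_eq_one] at h
    have hm : m = 1 := by
      have h1 := h.1
      have := congrArg Multiplicative.toAdd h1
      simp at this
      exact this
    rw [Prod.mk_eq_one]
    refine ⟨hm, ?_⟩
    have h2 : (((v : kˣ) : k)) ^ 2 = 1 := by
      have := congrArg (fun x : V => ((x : kˣ) : k)) h.2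
      simpa using this
    rcases (by simpa using h2 : _ ∨ _) with h3 | h3
    · ext; simpa using h3
    · exfalso
      obtain ⟨w, hw, hv⟩ := v.2
      replace h3 : (((v : kˣ) : k)) = -1 := by rw [h3]; simp
      rw [hv] at h3
      have h4 : (2 : k) * (1 + p * (2 * w)) = 0 := by linear_combination h3
      rcases mul_eq_zero.1 h4 with h5 | h5
      · exact h20 h5
      · have h6 : p * (2 * w) = -1 := by linear_combination h5
        have h7 := congrArg norm h6
        rw [norm_mul, norm_neg, norm_one, norm_mul] at h7
        have h8 : ‖p‖ * (‖(2 : k)‖ * ‖w‖) ≤ ‖p‖ := mul_le_of_le_one_right hpn.le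
          (mul_le_one₀ (norm_two_le_one hna) (norm_nonneg _) hw)
        linarith
  have hidx : f.range.index ≠ 0 := by
    have h20' : (2 : O) ≠ 0 := by
      intro h; exact h20 (congrArg Subtype.val h)
    let r : O := 2 * 2 * ⟨p, hp'⟩ ^ 2
    have hr : r ≠ 0 := mul_ne_zero (mul_ne_zero h20' h20')
      (pow_ne_zero _ (by intro h; exact hp0 (by simpa using congrArg Subtype.val h)))
    have := hfin r hr
    have hrep : ∀ y : kˣ ⧸ f.range, ∃ x : kˣ, QuotientGroup.mk x = y ∧ ‖p‖ < ‖(x : k)‖ ∧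
        ‖(x : k)‖ ≤ 1 := by
      intro y
      obtain ⟨x, rfl⟩ := QuotientGroup.mk_surjective y
      have hxp : 0 < ‖(x : k)‖ := norm_pos_iff.2 x.ne_zero
      obtain ⟨n, hn1, hn2⟩ := exists_mem_Ioc_zpow hxp (one_lt_inv_iff₀.2 ⟨hpn, hp1⟩)
      refine ⟨x * f (Multiplicative.ofAdd (n + 1), 1), ?_, ?_, ?_⟩
      · rw [QuotientGroup.mk_mul_of_mem]; exact ⟨_, rfl⟩
      · rw [Units.val_mul, norm_mul, hfn, toAdd_ofAdd, zpow_add_one₀ hpn.ne', ← mul_assoc]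
        apply lt_mul_of_one_lt_left hpn
        rw [inv_zpow, inv_lt_iff_one_lt_mul₀ (zpow_pos hpn _)] at hn1
        exact hn1
      · rw [Units.val_mul, norm_mul, hfn, toAdd_ofAdd]
        rw [inv_zpow, ← one_div, le_div_iff₀ (zpow_pos hpn _)] at hn2
        exact hn2
    choose σ hσ1 hσ2 hσ3 using hrep
    have : Finite (kˣ ⧸ f.range) := by
      refine Finite.of_injective (β := O ⧸ Ideal.span {r})
        (fun y => Ideal.Quotient.mk _ ⟨σ y, (hO _).2 (hσ3 y)⟩) ?_
      intro y z h
      rw [Ideal.Quotient.eq, Ideal.mem_span_singleton'] at h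
      obtain ⟨w, hw⟩ := h
      have hw1 : (w : k) * (4 * p ^ 2) = σ y - σ z := by
        have := congrArg Subtype.val hw
        simp only [r] at this
        push_cast at this
        rw [← this, show ((2 : O) : k) = 2 from rfl]; ring
      rw [← hσ1 y, ← hσ1 z]
      symm
      rw [QuotientGroup.eq]
      have hv : (σ z)⁻¹ * σ y ∈ V := by
        refine ⟨p * w * (σ z : k)⁻¹, ?_, ?_⟩
        · rw [norm_mul, norm_mul, norm_inv, ← div_eq_mul_inv, div_le_one (hpn.trans (hσ2 z))]
          exact (mul_le_of_le_one_right hpn.le ((hO _).1 w.2)).trans (hσ2 z).le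
        · push_cast
          have := (σ z).ne_zero
          field_simp
          linear_combination -hw1
      exact ⟨(1, ⟨_, hv⟩), by ext; rw [hf]; simp⟩
    exact Subgroup.index_ne_zero_of_finite
  have hmain := index_range_sq_eq f hinj hidx htf
  have hprod : (powMonoidHom 2 : Multiplicative ℤ × V →* Multiplicative ℤ × V).range =
      (powMonoidHom 2 : Multiplicative ℤ →* Multiplicative ℤ).range.prod
      (powMonoidHom 2 : V →* V).range := by
    ext ⟨m, v⟩
    simp [Subgroup.mem_prod]
  have hZ : (powMonoidHom 2 : Multiplicative ℤ →* Multiplicative ℤ).range.index = 2 := by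
    have : (powMonoidHom 2 : Multiplicative ℤ →* Multiplicative ℤ).range =
        AddSubgroup.toSubgroup (AddSubgroup.zmultiples (2 : ℤ)) := by
      ext m
      change _ ↔ Multiplicative.toAdd m ∈ AddSubgroup.zmultiples (2 : ℤ)
      simp only [MonoidHom.mem_range, powMonoidHom_apply, AddSubgroup.mem_zmultiples_iff]
      exact exists_congr fun y => by
        change (2 : ℕ) • (Multiplicative.toAdd y) = Multiplicative.toAdd m ↔
          (Multiplicative.toAdd y) • (2 : ℤ) = Multiplicative.toAdd m
        simp [mul_comm]
    rw [this, AddSubgroup.index_toSubgroup, Int.index_zmultiples]; rfl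
  have hker : Nat.card (powMonoidHom 2 : kˣ →* kˣ).ker = 2 := by
    have hset : ((powMonoidHom 2 : kˣ →* kˣ).ker : Set kˣ) = {1, -1} := by
      ext u
      simp only [SetLike.mem_coe, MonoidHom.mem_ker, powMonoidHom_apply, Set.mem_insert_iff,
        Set.mem_singleton_iff]
      rw [Units.ext_iff, Units.ext_iff, Units.ext_iff]; simp
    have h1 : (1 : kˣ) ≠ -1 := by
      intro h
      have := congrArg Units.val h
      push_cast at this
      exact h20 (by linear_combination this)
    rw [← SetLike.coe_sort_coe, hset, Nat.card_coe_set_eq, Set.ncard_pair h1]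
  rw [show Nat.card (SqClass k) = (powMonoidHom 2 : kˣ →* kˣ).range.index from rfl, hmain, hprod,
    Subgroup.index_prod, hZ, hker, index_sq_deepUnits hna hp0 hp1 h20 O hO]
  ring

end Count

lemma card_quotient_span_algebraMap {R S : Type*} [CommRing R] [CommRing S] [Algebra R S]
    [Module.Free R S] [Module.Finite R S] [Nontrivial R] (r : R) :
    Nat.card (S ⧸ Ideal.span {algebraMap R S r}) =
      Nat.card (R ⧸ Ideal.span {r}) ^ Module.finrank R S := by
  let b := Module.finBasis R S
  let g : S →ₗ[R] (Fin (Module.finrank R S) → R ⧸ Ideal.span {r}) :=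
    LinearMap.pi fun i => (Submodule.mkQ (Ideal.span {r})).comp (b.coord i)
  have hg : ∀ s i, g s i = Ideal.Quotient.mk (Ideal.span {r}) (b.repr s i) := fun s i => rfl
  have hsurj : Function.Surjective g := by
    intro y
    choose z hz using fun i => Ideal.Quotient.mk_surjective (y i)
    refine ⟨b.equivFun.symm z, ?_⟩
    ext i
    rw [hg, ← Module.Basis.equivFun_apply, LinearEquiv.apply_symm_apply, hz]
  have hker : ∀ s, s ∈ Ideal.span {algebraMap R S r} ↔ s ∈ LinearMap.ker g := by
    intro s
    rw [LinearMap.mem_ker, funext_iff, Ideal.mem_span_singleton']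
    constructor
    · rintro ⟨a, rfl⟩ i
      rw [hg, mul_comm, ← Algebra.smul_def, map_smul, Finsupp.smul_apply, Pi.zero_apply,
        Ideal.Quotient.eq_zero_iff_mem]
      exact Ideal.mul_mem_right _ _ (Ideal.mem_span_singleton_self r)
    · intro h
      have : ∀ i, ∃ z, z * r = b.repr s i := by
        intro i
        have := h i
        rw [hg, Pi.zero_apply, Ideal.Quotient.eq_zero_iff_mem, Ideal.mem_span_singleton'] at this
        exact this
      choose z hz using this
      refine ⟨b.equivFun.symm z, ?_⟩
      rw [mul_comm, ← Algebra.smul_def]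
      apply b.equivFun.injective
      rw [map_smul, LinearEquiv.apply_symm_apply]
      ext i
      rw [Module.Basis.equivFun_apply, ← hz, Pi.smul_apply, smul_eq_mul, mul_comm]
  have e1 : (Ideal.span {algebraMap R S r}).toAddSubgroup = g.toAddMonoidHom.ker := by
    ext s; exact hker s
  have e2 : Nat.card (S ⧸ Ideal.span {algebraMap R S r}) =
      (Ideal.span {algebraMap R S r}).toAddSubgroup.index := rfl
  rw [e2, e1, AddSubgroup.index_ker, AddMonoidHom.range_eq_top.2 hsurj, AddSubgroup.card_top,
    Nat.card_fun, Nat.card_fin]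

lemma PadicInt.finite_quotient {p : ℕ} [Fact p.Prime] {r : ℤ_[p]} (hr : r ≠ 0) :
    Finite (ℤ_[p] ⧸ Ideal.span {r}) := by
  have h1 : ∀ n, Finite (ℤ_[p] ⧸ Ideal.span {(p : ℤ_[p]) ^ n}) := by
    intro n
    rw [← PadicInt.ker_toZModPow]
    have : NeZero (p ^ n) := ⟨pow_ne_zero _ (Fact.out : p.Prime).ne_zero⟩
    exact Finite.of_injective _ (RingHom.kerLift_injective (PadicInt.toZModPow (p := p) n))
  have h2 : Ideal.span {r} = Ideal.span {(p : ℤ_[p]) ^ r.valuation} := by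
    rw [Ideal.span_singleton_eq_span_singleton]
    exact ⟨(PadicInt.unitCoeff hr)⁻¹, by
      rw [Units.mul_inv_eq_iff_eq_mul, mul_comm]; exact PadicInt.unitCoeff_spec hr⟩
  rw [h2]; exact h1 _

section Local

variable (p : ℕ) [Fact p.Prime] (k : Type*) [Field k] [Algebra ℚ_[p] k] [FiniteDimensional ℚ_[p] k]

lemma isIntegral_padicInt_iff [Algebra ℤ_[p] k] [IsScalarTower ℤ_[p] ℚ_[p] k] (x : k) :
    IsIntegral ℤ_[p] x ↔ spectralNorm ℚ_[p] k x ≤ 1 := by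
  have hx : IsIntegral ℚ_[p] x := Algebra.IsIntegral.isIntegral x
  rw [spectralNorm, spectralValue_le_one_iff (minpoly.monic hx)]
  constructor
  · intro h n
    rw [minpoly.isIntegrallyClosed_eq_field_fractions' ℚ_[p] h, Polynomial.coeff_map]
    exact PadicInt.norm_le_one _
  · intro h
    have : minpoly ℚ_[p] x ∈ Polynomial.lifts (algebraMap ℤ_[p] ℚ_[p]) := by
      rw [Polynomial.lifts_iff_coeff_lifts]
      exact fun n => ⟨⟨_, h n⟩, rfl⟩
    obtain ⟨q, hq, -, hm⟩ := Polynomial.lifts_and_degree_eq_and_monic this (minpoly.monic hx)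
    refine ⟨q, hm, ?_⟩
    have := minpoly.aeval ℚ_[p] x
    rw [← hq, Polynomial.aeval_map_algebraMap] at this
    exact this

lemma local_structure : (2 : k) ≠ 0 ∧
    Nat.card (SqClass k) =
      4 * Nat.card (ℤ_[p] ⧸ Ideal.span {(2 : ℤ_[p])}) ^ Module.finrank ℚ_[p] k ∧
    ∀ c : k, c ≠ 0 → ∃ m : ℕ, 0 < m ∧ ∃ r : k, c + (p : k) ^ m = c * r ^ 2 := by
  have h0 : CharZero k := charZero_of_injective_algebraMap (algebraMap ℚ_[p] k).injective
  have h20 : (2 : k) ≠ 0 := two_ne_zero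
  let hN := spectralNorm.normedField ℚ_[p] k
  let hC : CompleteSpace k := spectralNorm.completeSpace ℚ_[p] k
  have hn : ∀ x : k, ‖x‖ = spectralNorm ℚ_[p] k x := fun _ => rfl
  have hna : ∀ x y : k, ‖x + y‖ ≤ max ‖x‖ ‖y‖ := fun x y => isNonarchimedean_spectralNorm x y
  have hpn : ‖(p : k)‖ = ‖(p : ℚ_[p])‖ := by
    rw [hn, ← spectralNorm_extends (L := k) (p : ℚ_[p]), map_natCast]
  have hp1 : ‖(p : k)‖ < 1 := by rw [hpn]; exact Padic.norm_p_lt_one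
  have hp0 : (p : k) ≠ 0 := Nat.cast_ne_zero.2 (Fact.out : p.Prime).ne_zero
  refine ⟨h20, ?_, ?_⟩
  · let _ : Algebra ℤ_[p] k := ((algebraMap ℚ_[p] k).comp (algebraMap ℤ_[p] ℚ_[p])).toAlgebra
    have : IsScalarTower ℤ_[p] ℚ_[p] k := IsScalarTower.of_algebraMap_eq fun _ => rfl
    let O := integralClosure ℤ_[p] k
    have hO : ∀ x, x ∈ O.toSubring ↔ ‖x‖ ≤ 1 := fun x => isIntegral_padicInt_iff p k x
    have : Module.IsTorsionFree ℤ_[p] k := Module.IsTorsionFree.trans_faithfulSMul ℤ_[p] ℚ_[p] k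
    have : Module.Free ℤ_[p] O := IsIntegralClosure.module_free ℤ_[p] ℚ_[p] k O
    have : Module.Finite ℤ_[p] O := IsIntegralClosure.finite ℤ_[p] ℚ_[p] k O
    have hrank := IsIntegralClosure.rank ℤ_[p] ℚ_[p] k O
    have hfin : ∀ r : ℤ_[p], r ≠ 0 → Finite (O ⧸ Ideal.span {algebraMap ℤ_[p] O r}) := by
      intro r hr
      apply Nat.finite_of_card_ne_zero
      rw [card_quotient_span_algebraMap]
      have := PadicInt.finite_quotient hr
      exact pow_ne_zero _ Nat.card_pos.ne'
    have hfin' : ∀ r : O, r ≠ 0 → Finite (O ⧸ Ideal.span {r}) := by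
      intro r hr
      have hr' : (r : k) ≠ 0 := fun h => hr (Subtype.ext h)
      obtain ⟨N, hN⟩ := exists_pow_lt_of_lt_one (norm_pos_iff.2 hr') hp1
      have hmem : (p : k) ^ N / r ∈ O := by
        refine (hO _).2 ?_
        rw [norm_div, norm_pow]
        exact div_le_one_of_le₀ hN.le (norm_nonneg _)
      have hle : Ideal.span {algebraMap ℤ_[p] O ((p : ℤ_[p]) ^ N)} ≤ Ideal.span {r} := by
        rw [Ideal.span_singleton_le_span_singleton]
        refine ⟨⟨_, hmem⟩, ?_⟩
        ext
        simp only [map_pow, map_natCast]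
        push_cast
        field_simp
      have := hfin _ (pow_ne_zero N (Nat.cast_ne_zero.2 (Fact.out : p.Prime).ne_zero))
      exact Finite.of_surjective _ (Ideal.Quotient.factor_surjective hle)
    have h2 : (2 : O) = algebraMap ℤ_[p] O 2 := (map_ofNat _ 2).symm
    have hcard := card_quotient_span_algebraMap (R := ℤ_[p]) (S := O) 2
    rw [hrank] at hcard
    have : Finite (O.toSubring ⧸ Ideal.span {(2 : O.toSubring)}) := hfin' 2 (by
      intro h; exact h20 (congrArg Subtype.val h))
    have := card_sqClass_eq hna hp0 hp1 h20 O.toSubring hO hfin'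
    rw [← hcard, ← h2]
    exact this
  · intro c hc
    have h8 : (8 * p * c : k) ≠ 0 := mul_ne_zero (mul_ne_zero (by norm_num) hp0) hc
    obtain ⟨N, hN⟩ := exists_pow_lt_of_lt_one (norm_pos_iff.2 h8) hp1
    obtain ⟨w, -, hw⟩ := exists_sq_eq_one_add hna hp1 (y := (p : k) ^ (N + 1) / (8 * p * c)) (by
      rw [norm_div, norm_pow, pow_succ]
      exact div_le_one_of_le₀ ((mul_le_of_le_one_right (by positivity) hp1.le).trans hN.le)
        (norm_nonneg _))
    refine ⟨N + 1, by omega, 1 + 4 * p * w, ?_⟩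
    rw [hw]; field_simp

end Local

lemma mem_sqSubgroup_iff {k : Type*} [Field k] {u : kˣ} : u ∈ sqSubgroup k ↔ IsSquare (u : k) := by
  constructor
  · rintro ⟨v, rfl⟩
    exact ⟨v, by simp [pow_two]⟩
  · rintro ⟨r, hr⟩
    have hr0 : r ≠ 0 := by rintro rfl; simp at hr
    exact ⟨Units.mk0 r hr0, by ext; simp [hr, pow_two]⟩

section Quad

variable {k : Type*} [Field k] {a : k} [Fact (∀ r : k, r ^ 2 ≠ a + 0 * r)]

/-- The norm of the quadratic extension on units. -/
def quadNorm (a : k) [Fact (∀ r : k, r ^ 2 ≠ a + 0 * r)] : (QuadraticAlgebra k a 0)ˣ →* kˣ :=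
  Units.map QuadraticAlgebra.norm

/-- The inclusion of the base field on units. -/
def quadIncl (a : k) [Fact (∀ r : k, r ^ 2 ≠ a + 0 * r)] : kˣ →* (QuadraticAlgebra k a 0)ˣ :=
  Units.map (algebraMap k (QuadraticAlgebra k a 0) : k →* QuadraticAlgebra k a 0)

lemma mem_quadNorm_range_iff (u : kˣ) : u ∈ (quadNorm a).range ↔ NormRel a (u : k) := by
  constructor
  · rintro ⟨z, rfl⟩
    refine ⟨(z : QuadraticAlgebra k a 0).re, (z : QuadraticAlgebra k a 0).im, ?_⟩
    simp [quadNorm, QuadraticAlgebra.norm_def]; ring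
  · rintro ⟨s, t, h⟩
    have hz : (⟨s, t⟩ : QuadraticAlgebra k a 0) ≠ 0 := by
      intro h0
      rw [QuadraticAlgebra.ext_iff] at h0
      simp at h0
      rw [h0.1, h0.2] at h
      exact u.ne_zero (by rw [h]; ring)
    refine ⟨Units.mk0 _ hz, ?_⟩
    ext
    simp [quadNorm, QuadraticAlgebra.norm_def, h]; ring

lemma comap_quadNorm (h2 : (2 : k) ≠ 0) :
    (sqSubgroup k).comap (quadNorm a) =
      (quadIncl a).range ⊔ sqSubgroup (QuadraticAlgebra k a 0) := by
  apply le_antisymm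
  · intro z hz
    rw [Subgroup.mem_comap, mem_sqSubgroup_iff] at hz
    obtain ⟨r, hr⟩ := hz
    have hN : ((quadNorm a z : kˣ) : k) =
        (z : QuadraticAlgebra k a 0).re ^ 2 - a * (z : QuadraticAlgebra k a 0).im ^ 2 := by
      simp [quadNorm, QuadraticAlgebra.norm_def]; ring
    have hr0 : r ≠ 0 := by
      rintro rfl; rw [mul_zero] at hr; exact (quadNorm a z).ne_zero hr
    rw [hN] at hr
    set s := (z : QuadraticAlgebra k a 0).re with hs
    set t := (z : QuadraticAlgebra k a 0).im with ht
    obtain ⟨r', hr', hsr⟩ : ∃ r', s ^ 2 - a * t ^ 2 = r' * r' ∧ s + r' ≠ 0 := by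
      by_cases h : s + r = 0
      · refine ⟨-r, by rw [hr]; ring, fun h' => hr0 ?_⟩
        have : 2 * r = 0 := by linear_combination h - h'
        exact (mul_eq_zero.1 this).resolve_left h2
      · exact ⟨r, hr, h⟩
    let w : QuadraticAlgebra k a 0 := ⟨s + r', t⟩
    have hw0 : w ≠ 0 := by
      intro h0
      rw [QuadraticAlgebra.ext_iff] at h0
      exact hsr h0.1
    let c := Units.mk0 (2 * (s + r')) (mul_ne_zero h2 hsr)
    have key : z = quadIncl a c⁻¹ * (Units.mk0 w hw0) ^ 2 := by
      rw [map_inv, eq_inv_mul_iff_mul_eq]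
      ext
      · simp [quadIncl, c, w, pow_two, ← hs, ← ht]
        linear_combination hr'
      · simp [quadIncl, c, w, pow_two, ← hs, ← ht]
        ring
    rw [key]
    exact Subgroup.mul_mem_sup ⟨_, rfl⟩ ⟨_, rfl⟩
  · rw [sup_le_iff]
    constructor
    · rintro _ ⟨c, rfl⟩
      rw [Subgroup.mem_comap, mem_sqSubgroup_iff]
      exact ⟨c, by simp [quadNorm, quadIncl, pow_two]⟩
    · rintro _ ⟨w, rfl⟩
      rw [Subgroup.mem_comap]
      exact ⟨quadNorm a w, by simp⟩

lemma relIndex_comap_quadIncl (h2 : (2 : k) ≠ 0) (ha : a ≠ 0) :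
    (sqSubgroup k).relIndex ((sqSubgroup (QuadraticAlgebra k a 0)).comap (quadIncl a)) = 2 := by
  have hns : ¬ IsSquare a := by
    rintro ⟨r, hr⟩
    exact (Fact.out : ∀ r : k, r ^ 2 ≠ a + 0 * r) r (by rw [hr]; ring)
  rw [Subgroup.relIndex_eq_two_iff_exists_notMem_and]
  refine ⟨Units.mk0 a ha, ?_, ?_, ?_⟩
  · rw [Subgroup.mem_comap, mem_sqSubgroup_iff]
    refine ⟨⟨0, 1⟩, ?_⟩
    ext <;> simp [quadIncl]
  · rwa [mem_sqSubgroup_iff]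
  · intro b hb
    rw [Subgroup.mem_comap, mem_sqSubgroup_iff] at hb
    obtain ⟨z, hz⟩ := hb
    rw [QuadraticAlgebra.ext_iff] at hz
    simp [quadIncl] at hz
    obtain ⟨h3, h4⟩ := hz
    have h5 : 2 * (z.re * z.im) = 0 := by linear_combination -h4
    rcases mul_eq_zero.1 ((mul_eq_zero.1 h5).resolve_left h2) with h6 | h6
    · left
      rw [mem_sqSubgroup_iff]
      exact ⟨a * z.im, by simp [h3, h6]; ring⟩
    · right
      rw [mem_sqSubgroup_iff]
      exact ⟨z.re, by simp [h3, h6]⟩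

lemma index_quadNorm_range (h2 : (2 : k) ≠ 0) (ha : a ≠ 0) (hc : Nat.card (SqClass k) ≠ 0)
    (hE : 4 * Nat.card (SqClass (QuadraticAlgebra k a 0)) = Nat.card (SqClass k) ^ 2) :
    (quadNorm a).range.index = 2 := by
  set E := QuadraticAlgebra k a 0
  have hcard : Nat.card (SqClass k) = (sqSubgroup k).index := rfl
  have hcardE : Nat.card (SqClass E) = (sqSubgroup E).index := rfl
  have e1 : ((sqSubgroup k).comap (quadNorm a)).index = (sqSubgroup k).relIndex (quadNorm a).range :=
    Subgroup.index_comap _ _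
  have e2 : (sqSubgroup E).relIndex ((sqSubgroup k).comap (quadNorm a)) *
      ((sqSubgroup k).comap (quadNorm a)).index = (sqSubgroup E).index :=
    Subgroup.relIndex_mul_index (by rw [comap_quadNorm h2]; exact le_sup_right)
  have e3 : (sqSubgroup E).relIndex ((sqSubgroup k).comap (quadNorm a)) =
      ((sqSubgroup E).comap (quadIncl a)).index := by
    rw [comap_quadNorm h2, Subgroup.relIndex_sup_right, Subgroup.index_comap]
  have e4 : (sqSubgroup k).relIndex ((sqSubgroup E).comap (quadIncl a)) *
      ((sqSubgroup E).comap (quadIncl a)).index = (sqSubgroup k).index := by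
    refine Subgroup.relIndex_mul_index ?_
    rintro _ ⟨u, rfl⟩
    rw [Subgroup.mem_comap]
    exact ⟨quadIncl a u, by simp⟩
  rw [relIndex_comap_quadIncl h2 ha] at e4
  have e5 : (sqSubgroup k).relIndex (quadNorm a).range * (quadNorm a).range.index =
      (sqSubgroup k).index := by
    refine Subgroup.relIndex_mul_index ?_
    rintro _ ⟨u, rfl⟩
    exact ⟨quadIncl a u, by ext; simp [quadNorm, quadIncl]⟩
  rw [e3, e1] at e2
  rw [hcard, hcardE] at hE
  rw [hcard] at hc
  set m := ((sqSubgroup E).comap (quadIncl a)).index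
  set g := (sqSubgroup k).relIndex (quadNorm a).range
  set n := (quadNorm a).range.index
  have hm : m ≠ 0 := by intro h; rw [h] at e4; exact hc e4.symm
  have hg : g ≠ 0 := by intro h; rw [h, zero_mul] at e5; exact hc e5.symm
  have h3 : m = g := by
    have h4 : 4 * (m * g) = (2 * m) ^ 2 := by rw [e2, e4]; exact hE
    have : m * g = m * m := by linarith
    exact (Nat.eq_of_mul_eq_mul_left (Nat.pos_of_ne_zero hm) this).symm
  have h5 : g * n = g * 2 := by rw [e5, ← e4, h3]; ring
  exact Nat.eq_of_mul_eq_mul_left (Nat.pos_of_ne_zero hg) h5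

end Quad

section Local

variable (p : ℕ) [Fact p.Prime] (k : Type*) [Field k] [Algebra ℚ_[p] k] [FiniteDimensional ℚ_[p] k]

lemma card_padicInt_two_ne_zero : Nat.card (ℤ_[p] ⧸ Ideal.span {(2 : ℤ_[p])}) ≠ 0 := by
  have := PadicInt.finite_quotient (p := p) (two_ne_zero)
  exact Nat.card_pos.ne'

include p in
lemma card_sqClass_ne_zero : Nat.card (SqClass k) ≠ 0 := by
  rw [(local_structure p k).2.1]
  exact mul_ne_zero (by norm_num) (pow_ne_zero _ (card_padicInt_two_ne_zero p))


lemma hilbertField_local (p : ℕ) [Fact p.Prime] (k : Type*) [Field k] [Algebra ℚ_[p] k]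
    [FiniteDimensional ℚ_[p] k] : HilbertField k := by
  have h2 := (local_structure p k).1
  have main : ∀ a : k, a ≠ 0 → ¬ IsSquare a → ∃ G : Subgroup kˣ, G.index = 2 ∧
      ∀ u : kˣ, u ∈ G ↔ NormRel a (u : k) := by
    intro a ha hns
    have : Fact (∀ r : k, r ^ 2 ≠ a + 0 * r) :=
      ⟨fun r h => hns ⟨r, by rw [← pow_two, h]; ring⟩⟩
    have : FiniteDimensional ℚ_[p] (QuadraticAlgebra k a 0) :=
      Module.Finite.trans k _
    refine ⟨(quadNorm a).range, index_quadNorm_range h2 ha (card_sqClass_ne_zero p k) ?_,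
      mem_quadNorm_range_iff⟩
    have hrank := Module.finrank_mul_finrank ℚ_[p] k (QuadraticAlgebra k a 0)
    rw [QuadraticAlgebra.finrank_eq_two] at hrank
    rw [(local_structure p k).2.1, (local_structure p (QuadraticAlgebra k a 0)).2.1, ← hrank]
    ring
  refine ⟨h2, ?_, ?_⟩
  · intro a ha hns
    obtain ⟨G, hG, hGm⟩ := main a ha hns
    have : ∃ u, u ∉ G := by
      by_contra! h
      rw [(Subgroup.eq_top_iff' G).2 h, Subgroup.index_top] at hG
      omega
    obtain ⟨u, hu⟩ := this
    exact ⟨u, u.ne_zero, by rwa [← hGm]⟩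
  · intro a b c ha hb hc h1 h3
    by_cases hs : IsSquare a
    · exact absurd (NormRel.of_isSquare h2 ha hs b) h1
    obtain ⟨G, hG, hGm⟩ := main a ha hs
    have := Subgroup.mul_mem_iff_of_index_two hG (a := Units.mk0 b hb) (b := Units.mk0 c hc)
    rw [hGm, hGm, hGm] at this
    push_cast at this
    simp only [Units.val_mk0] at this
    tauto

lemma card_sqClass_of_odd (hp : p ≠ 2) : Nat.card (SqClass k) = 4 := by
  have hu : IsUnit (2 : ℤ_[p]) := by
    rw [PadicInt.isUnit_iff]
    have : ((2 : ℕ) : ℤ_[p]) = 2 := by norm_num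
    rw [← this, PadicInt.norm_natCast_eq_one_iff]
    exact (Nat.coprime_primes Fact.out Nat.prime_two).2 hp
  rw [(local_structure p k).2.1, Ideal.span_singleton_eq_top.2 hu]
  simp

lemma card_sqClass_of_two [Algebra ℚ_[2] k] [FiniteDimensional ℚ_[2] k] :
    4 < Nat.card (SqClass k) := by
  rw [(local_structure 2 k).2.1]
  have h1 : 1 < Nat.card (ℤ_[2] ⧸ Ideal.span {(2 : ℤ_[2])}) := by
    have := PadicInt.finite_quotient (p := 2) (two_ne_zero)
    rw [Finite.one_lt_card_iff_nontrivial, Ideal.Quotient.nontrivial_iff, Ne,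
      Ideal.span_singleton_eq_top]
    exact PadicInt.p_nonunit
  have h2 : 0 < Module.finrank ℚ_[2] k := Module.finrank_pos
  have := one_lt_pow₀ h1 h2.ne'
  omega

lemma manySquareClasses_of_two [Algebra ℚ_[2] k] [FiniteDimensional ℚ_[2] k] :
    ManySquareClasses k :=
  ManySquareClasses.of_card (card_sqClass_of_two k)

lemma dyadicApprox_of_two [Algebra ℚ_[2] k] [FiniteDimensional ℚ_[2] k] :
    DyadicApprox k := by
  intro c hc
  obtain ⟨m, hm, r, hr⟩ := (local_structure 2 k).2.2 c hc
  exact ⟨m, hm, r, by exact_mod_cast hr⟩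

end Local

section Forms

open Module

lemma exists_pairing_eq_one {V : Type*} [AddCommGroup V] [Module (ZMod 2) V]
    (B : V →ₗ[ZMod 2] V →ₗ[ZMod 2] ZMod 2) (hnd : ∀ x, (∀ y, B x y = 0) → x = 0)
    {x : V} (hx : x ≠ 0) : ∃ y, B x y = 1 := by
  by_contra! h
  refine hx (hnd x fun y => ?_)
  have h1 := h y
  revert h1
  generalize B x y = z
  revert z
  decide

lemma exists_self_pairing_eq_one {U : Type*} [AddCommGroup U] [Module (ZMod 2) U]
    [FiniteDimensional (ZMod 2) U] (C : U →ₗ[ZMod 2] U →ₗ[ZMod 2] ZMod 2) (c : U)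
    (hs : ∀ x y, C x y = C y x) (hnd : ∀ x, (∀ y, C x y = 0) → x = 0) (hc : ∀ x, C x x = C x c)
    (hc0 : c ≠ 0) {n : ℕ} (hn : finrank (ZMod 2) U = n) :
    ∃ x, C x x = 1 ∧ (x = c ↔ n = 1) := by
  obtain ⟨x, hx⟩ := exists_pairing_eq_one C hnd hc0
  rw [hs, ← hc] at hx
  by_cases h1 : n = 1
  · refine ⟨x, hx, ?_⟩
    simp only [h1, iff_true]
    rw [h1] at hn
    obtain ⟨r, hr⟩ := (finrank_eq_one_iff_of_nonzero' c hc0).1 hn x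
    have : r = 0 ∨ r = 1 := by clear hr; revert r; decide
    rcases this with rfl | rfl
    · rw [← hr] at hx; simp at hx
    · rw [← hr, one_smul]
  · simp only [h1, iff_false]
    by_cases hxc : x = c
    · subst hxc
      have : ∃ z, z ∉ Submodule.span (ZMod 2) {x} := by
        by_contra! h
        exact h1 (hn ▸ finrank_eq_one_iff'.2 ⟨x, hc0, fun w => Submodule.mem_span_singleton.1 (h w)⟩)
      obtain ⟨z, hz⟩ := this
      have hzx : z ≠ x := by rintro rfl; exact hz (Submodule.mem_span_singleton_self _)
      have hz0 : z ≠ 0 := by rintro rfl; exact hz (Submodule.zero_mem _)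
      have : C z x = 0 ∨ C z x = 1 := by
        generalize C z x = r
        revert r; decide
      rcases this with h | h
      · refine ⟨x + z, ?_, by simpa using hz0⟩
        rw [hc, map_add, LinearMap.add_apply, h, hx, add_zero]
      · exact ⟨z, by rw [hc, h], hzx⟩
    · exact ⟨x, hx, hxc⟩

/-- Nondegenerate symmetric bilinear forms over the field with two elements, together with their
characteristic vectors, are classified by the dimension and the vanishing of that vector. -/
theorem exists_isometry (n : ℕ) : ∀ (V : Type u) (W : Type v)
    [AddCommGroup V] [Module (ZMod 2) V] [FiniteDimensional (ZMod 2) V]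
    [AddCommGroup W] [Module (ZMod 2) W] [FiniteDimensional (ZMod 2) W]
    (B : V →ₗ[ZMod 2] V →ₗ[ZMod 2] ZMod 2) (B' : W →ₗ[ZMod 2] W →ₗ[ZMod 2] ZMod 2)
    (w : V) (w' : W) (_ : ∀ x y, B x y = B y x) (_ : ∀ x y, B' x y = B' y x)
    (_ : ∀ x, (∀ y, B x y = 0) → x = 0) (_ : ∀ x, (∀ y, B' x y = 0) → x = 0)
    (_ : ∀ x, B x x = B x w) (_ : ∀ x, B' x x = B' x w') (_ : w = 0 ↔ w' = 0)
    (_ : finrank (ZMod 2) V = n) (_ : finrank (ZMod 2) W = n),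
    ∃ e : V →ₗ[ZMod 2] W, ∀ x y, B' (e x) (e y) = B x y := by
  induction n using Nat.strong_induction_on with
  | _ n ih =>
  intro V W _ _ _ _ _ _ B B' w w' hs hs' hnd hnd' hw hw' hww hn hn'
  rcases Nat.eq_zero_or_pos n with h0 | hpos
  · subst h0
    have := finrank_zero_iff.1 hn
    exact ⟨0, fun x y => by rw [Subsingleton.elim x 0]; simp⟩
  have two : ∀ z : ZMod 2, z + z = 0 := by decide
  by_cases hw0 : w = 0
  · have hw0' := hww.1 hw0
    have halt : ∀ x, B x x = 0 := fun x => by rw [hw, hw0, map_zero]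
    have halt' : ∀ x, B' x x = 0 := fun x => by rw [hw', hw0', map_zero]
    have := finrank_pos_iff.1 (hn ▸ hpos)
    have := finrank_pos_iff.1 (hn' ▸ hpos)
    obtain ⟨x, hx⟩ := exists_ne (0 : V)
    obtain ⟨x', hx'⟩ := exists_ne (0 : W)
    obtain ⟨y, hxy⟩ := exists_pairing_eq_one B hnd hx
    obtain ⟨y', hxy'⟩ := exists_pairing_eq_one B' hnd' hx'
    have hyx : B y x = 1 := by rw [hs, hxy]
    have hyx' : B' y' x' = 1 := by rw [hs', hxy']
    let P := LinearMap.ker ((B x).prod (B y))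
    let P' := LinearMap.ker ((B' x').prod (B' y'))
    have hP : ∀ z, z ∈ P ↔ B x z = 0 ∧ B y z = 0 := by intro z; simp [P]
    have hP' : ∀ z, z ∈ P' ↔ B' x' z = 0 ∧ B' y' z = 0 := by intro z; simp [P']
    have hproj : ∀ z, z + (B y z • x + B x z • y) ∈ P := by
      intro z
      rw [hP]
      simp [halt, hxy, hyx, two]
    have hproj' : ∀ z, z + (B' y' z • x' + B' x' z • y') ∈ P' := by
      intro z
      rw [hP']
      simp [halt', hxy', hyx', two]
    have hfr : finrank (ZMod 2) P + 2 = n := by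
      have h1 := LinearMap.finrank_range_add_finrank_ker ((B x).prod (B y))
      have h2 : LinearMap.range ((B x).prod (B y)) = ⊤ := by
        rw [LinearMap.range_eq_top]
        rintro ⟨s, t⟩
        exact ⟨t • x + s • y, by simp [halt, hxy, hyx]⟩
      rw [h2, finrank_top, finrank_prod, finrank_self, hn] at h1
      change _ + finrank (ZMod 2) P = n at h1
      omega
    have hfr' : finrank (ZMod 2) P' + 2 = n := by
      have h1 := LinearMap.finrank_range_add_finrank_ker ((B' x').prod (B' y'))
      have h2 : LinearMap.range ((B' x').prod (B' y')) = ⊤ := by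
        rw [LinearMap.range_eq_top]
        rintro ⟨s, t⟩
        exact ⟨t • x' + s • y', by simp [halt', hxy', hyx']⟩
      rw [h2, finrank_top, finrank_prod, finrank_self, hn'] at h1
      change _ + finrank (ZMod 2) P' = n at h1
      omega
    obtain ⟨e, he⟩ := ih (n - 2) (by omega) P P' (B.compl₁₂ P.subtype P.subtype)
      (B'.compl₁₂ P'.subtype P'.subtype) 0 0 (fun _ _ => hs _ _) (fun _ _ => hs' _ _) (by
        intro z hz
        ext
        refine hnd z fun t => ?_
        have h1 := hz ⟨_, hproj t⟩
        have h2 := (hP z).1 z.2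
        rw [hs, hs y] at h2
        simpa [h2.1, h2.2] using h1) (by
        intro z hz
        ext
        refine hnd' z fun t => ?_
        have h1 := hz ⟨_, hproj' t⟩
        have h2 := (hP' z).1 z.2
        rw [hs', hs' y'] at h2
        simpa [h2.1, h2.2] using h1) (by simp [halt]) (by simp [halt']) (by simp) (by omega)
        (by omega)
    let pr : V →ₗ[ZMod 2] P := LinearMap.codRestrict P
      (LinearMap.id + ((B y).smulRight x + (B x).smulRight y)) hproj
    refine ⟨(P'.subtype ∘ₗ e ∘ₗ pr) + ((B y).smulRight x' + (B x).smulRight y'), fun s t => ?_⟩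
    have h1 := he (pr s) (pr t)
    simp only [LinearMap.compl₁₂_apply, Submodule.subtype_apply] at h1
    have hpr : ∀ z, ((pr z : P) : V) = z + (B y z • x + B x z • y) := fun z => rfl
    have a1 := ((hP' _).1 (e (pr s)).2)
    have a2 := ((hP' _).1 (e (pr t)).2)
    have b1 := a1.1
    have b2 := a1.2
    rw [hs'] at b1 b2
    rw [hpr, hpr] at h1
    simp only [map_add, LinearMap.add_apply, map_smul, LinearMap.smul_apply, smul_eq_mul, halt, hxy,
      hyx] at h1
    simp only [map_add, LinearMap.add_apply, map_smul, LinearMap.smul_apply, smul_eq_mul, halt',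
      hxy', hyx', LinearMap.smulRight_apply, LinearMap.comp_apply, Submodule.subtype_apply, a2.1,
      a2.2, b1, b2, h1]
    rw [hs s x, hs s y]
    generalize B s t = z1
    generalize B y s = z2
    generalize B x s = z3
    generalize B y t = z4
    generalize B x t = z5
    revert z1 z2 z3 z4 z5
    decide
  · have hw0' : w' ≠ 0 := fun h => hw0 (hww.2 h)
    obtain ⟨x, hx, hxw⟩ := exists_self_pairing_eq_one B w hs hnd hw hw0 hn
    obtain ⟨x', hx', hxw'⟩ := exists_self_pairing_eq_one B' w' hs' hnd' hw' hw0' hn'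
    let P := LinearMap.ker (B x)
    let P' := LinearMap.ker (B' x')
    have hP : ∀ z, z ∈ P ↔ B x z = 0 := by intro z; simp [P]
    have hP' : ∀ z, z ∈ P' ↔ B' x' z = 0 := by intro z; simp [P']
    have hproj : ∀ z, z + B x z • x ∈ P := by
      intro z
      rw [hP]
      simp [hx, two]
    have hproj' : ∀ z, z + B' x' z • x' ∈ P' := by
      intro z
      rw [hP']
      simp [hx', two]
    have hfr : finrank (ZMod 2) P + 1 = n := by
      have h1 := LinearMap.finrank_range_add_finrank_ker (B x)
      have h2 : LinearMap.range (B x) = ⊤ := by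
        rw [LinearMap.range_eq_top]
        exact fun s => ⟨s • x, by simp [hx]⟩
      rw [h2, finrank_top, finrank_self, hn] at h1
      change _ + finrank (ZMod 2) P = n at h1
      omega
    have hfr' : finrank (ZMod 2) P' + 1 = n := by
      have h1 := LinearMap.finrank_range_add_finrank_ker (B' x')
      have h2 : LinearMap.range (B' x') = ⊤ := by
        rw [LinearMap.range_eq_top]
        exact fun s => ⟨s • x', by simp [hx']⟩
      rw [h2, finrank_top, finrank_self, hn'] at h1
      change _ + finrank (ZMod 2) P' = n at h1
      omega
    have hself : ∀ z : V, z + z = 0 := fun z => by rw [← two_smul (ZMod 2), show (2 : ZMod 2) = 0 from rfl, zero_smul]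
    have hself' : ∀ z : W, z + z = 0 := fun z => by rw [← two_smul (ZMod 2), show (2 : ZMod 2) = 0 from rfl, zero_smul]
    have hwP : w + x ∈ P := by
      have := hproj w
      rwa [← hw, hx, one_smul] at this
    have hwP' : w' + x' ∈ P' := by
      have := hproj' w'
      rwa [← hw', hx', one_smul] at this
    obtain ⟨e, he⟩ := ih (n - 1) (by omega) P P' (B.compl₁₂ P.subtype P.subtype)
      (B'.compl₁₂ P'.subtype P'.subtype) ⟨_, hwP⟩ ⟨_, hwP'⟩
      (fun _ _ => hs _ _) (fun _ _ => hs' _ _) (by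
        intro z hz
        ext
        refine hnd z fun t => ?_
        have h1 := hz ⟨_, hproj t⟩
        have h2 := (hP z).1 z.2
        rw [hs] at h2
        simpa [h2] using h1) (by
        intro z hz
        ext
        refine hnd' z fun t => ?_
        have h1 := hz ⟨_, hproj' t⟩
        have h2 := (hP' z).1 z.2
        rw [hs'] at h2
        simpa [h2] using h1) (by
        intro z
        have h2 := (hP z).1 z.2
        rw [hs] at h2
        simp [hw, h2]) (by
        intro z
        have h2 := (hP' z).1 z.2
        rw [hs'] at h2
        simp [hw', h2]) (by
        rw [Submodule.mk_eq_zero, Submodule.mk_eq_zero, add_eq_zero_iff_eq_neg,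
          add_eq_zero_iff_eq_neg, ← add_eq_zero_iff_eq_neg.1 (hself x),
          ← add_eq_zero_iff_eq_neg.1 (hself' x'), eq_comm, hxw, eq_comm (a := w'), hxw']) (by omega)
        (by omega)
    let pr : V →ₗ[ZMod 2] P := LinearMap.codRestrict P
      (LinearMap.id + (B x).smulRight x) hproj
    refine ⟨(P'.subtype ∘ₗ e ∘ₗ pr) + (B x).smulRight x', fun s t => ?_⟩
    have h1 := he (pr s) (pr t)
    simp only [LinearMap.compl₁₂_apply, Submodule.subtype_apply] at h1
    have hpr : ∀ z, ((pr z : P) : V) = z + B x z • x := fun z => rfl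
    have a2 := (hP' _).1 (e (pr t)).2
    have b1 := (hP' _).1 (e (pr s)).2
    rw [hs'] at b1
    rw [hpr, hpr] at h1
    simp only [map_add, LinearMap.add_apply, map_smul, LinearMap.smul_apply, smul_eq_mul, hx] at h1
    simp only [map_add, LinearMap.add_apply, map_smul, LinearMap.smul_apply, smul_eq_mul, hx',
      LinearMap.smulRight_apply, LinearMap.comp_apply, Submodule.subtype_apply, a2, b1, h1]
    rw [hs s x]
    generalize B s t = z1
    generalize B x s = z2
    generalize B x t = z3
    revert z1 z2 z3
    decide

end Forms

section Symbol

variable {k : Type*} [Field k]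

instance sqClassModule (k : Type*) [Field k] : Module (ZMod 2) (Additive (SqClass k)) :=
  AddCommGroup.zmodModule (n := 2) (by
    intro x
    obtain ⟨u, hu⟩ := sqCl_surj (K := k) (Additive.toMul x)
    have h1 : Additive.toMul x * Additive.toMul x = 1 := by
      rw [← hu]
      change sqCl (u * u) = sqCl 1
      exact sqCl_eq_iff.2 ⟨u⁻¹, by group⟩
    exact (@two_nsmul _ AddCommGroup.toAddGroup.toAddMonoid x).trans (congrArg Additive.ofMul h1))

open Classical in
/-- The quadratic Hilbert symbol, with values written additively. -/
def hilbertSymbol (x y : Additive (SqClass k)) : ZMod 2 :=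
  if NormRel ((Quotient.out (Additive.toMul x) : kˣ) : k)
    ((Quotient.out (Additive.toMul y) : kˣ) : k) then 0 else 1

lemma exists_out_sqCl (u : kˣ) : ∃ r : kˣ, (Quotient.out (sqCl u) : kˣ) = u * r ^ 2 :=
  sqCl_eq_iff.1 (Quotient.out_eq (sqCl u)).symm

lemma normRel_mul_sq_iff {a b r s : k} (hr : r ≠ 0) (hs : s ≠ 0) :
    NormRel (a * r ^ 2) (b * s ^ 2) ↔ NormRel a b := by
  constructor
  · rintro ⟨x, y, h⟩
    refine ⟨x / s, r * y / s, ?_⟩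
    field_simp
    rw [h]
  · rintro ⟨x, y, h⟩
    refine ⟨x * s, y * s / r, ?_⟩
    field_simp
    rw [h]

lemma hilbertSymbol_eq_zero_iff (u v : kˣ) :
    hilbertSymbol (Additive.ofMul (sqCl u)) (Additive.ofMul (sqCl v)) = 0 ↔
      NormRel (u : k) (v : k) := by
  obtain ⟨r, hr⟩ := exists_out_sqCl u
  obtain ⟨s, hs⟩ := exists_out_sqCl v
  rw [← normRel_mul_sq_iff r.ne_zero s.ne_zero, ← Units.val_pow_eq_pow_val,
    ← Units.val_pow_eq_pow_val, ← Units.val_mul, ← Units.val_mul, ← hr, ← hs]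
  unfold hilbertSymbol
  split_ifs with h <;> simpa using h

lemma ZMod.two_eq_of_eq_zero_iff {x y : ZMod 2} (h : x = 0 ↔ y = 0) : x = y := by
  revert h; revert x y; decide

lemma sqClass_induction {P : Additive (SqClass k) → Prop}
    (h : ∀ u : kˣ, P (Additive.ofMul (sqCl u))) (x) : P x := by
  obtain ⟨u, hu⟩ := sqCl_surj (Additive.toMul x)
  have := h u
  rwa [hu] at this

variable (hk : HilbertField k)
include hk

lemma hilbertSymbol_comm (x y : Additive (SqClass k)) : hilbertSymbol x y = hilbertSymbol y x := by
  induction x using sqClass_induction with | _ u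
  induction y using sqClass_induction with | _ v
  apply ZMod.two_eq_of_eq_zero_iff
  rw [hilbertSymbol_eq_zero_iff, hilbertSymbol_eq_zero_iff, hk.symm_iff u.ne_zero v.ne_zero]

lemma hilbertSymbol_add_right (x y z : Additive (SqClass k)) :
    hilbertSymbol x (y + z) = hilbertSymbol x y + hilbertSymbol x z := by
  induction x using sqClass_induction with | _ u
  induction y using sqClass_induction with | _ v
  induction z using sqClass_induction with | _ w
  have : Additive.ofMul (sqCl v) + Additive.ofMul (sqCl w) = Additive.ofMul (sqCl (v * w)) := rfl
  rw [this]
  have key : ∀ x y z : ZMod 2, (x = 0 ↔ (y = 0 ↔ z = 0)) → x = y + z := by decide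
  apply key
  rw [hilbertSymbol_eq_zero_iff, hilbertSymbol_eq_zero_iff, hilbertSymbol_eq_zero_iff,
    Units.val_mul, hk.mul_iff u.ne_zero v.ne_zero w.ne_zero]

/-- The Hilbert symbol as a bilinear form. -/
def hilbertForm : Additive (SqClass k) →ₗ[ZMod 2] Additive (SqClass k) →ₗ[ZMod 2] ZMod 2 :=
  AddMonoidHom.toZModLinearMap 2 (AddMonoidHom.mk' (fun x => AddMonoidHom.toZModLinearMap 2
    (AddMonoidHom.mk' (hilbertSymbol x) (hilbertSymbol_add_right hk x))) (by
      intro x y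
      ext z
      change hilbertSymbol (x + y) z = hilbertSymbol x z + hilbertSymbol y z
      rw [hilbertSymbol_comm hk, hilbertSymbol_add_right hk, hilbertSymbol_comm hk z,
        hilbertSymbol_comm hk z]))

lemma hilbertForm_apply (x y : Additive (SqClass k)) : hilbertForm hk x y = hilbertSymbol x y := rfl

omit hk in
lemma sqCl_eq_one_iff {u : kˣ} : sqCl u = 1 ↔ IsSquare (u : k) := by
  rw [← mem_sqSubgroup_iff]
  exact QuotientGroup.eq_one_iff u

lemma hilbertForm_nondegenerate (x : Additive (SqClass k)) (h : ∀ y, hilbertForm hk x y = 0) :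
    x = 0 := by
  induction x using sqClass_induction with | _ u
  by_contra hne
  have hns : ¬ IsSquare (u : k) := fun hs => hne (congrArg Additive.ofMul (sqCl_eq_one_iff.2 hs))
  obtain ⟨b, hb, hnb⟩ := hk.exists_not u u.ne_zero hns
  exact hnb ((hilbertSymbol_eq_zero_iff u (Units.mk0 b hb)).1 (h _))

lemma hilbertForm_self (x : Additive (SqClass k)) :
    hilbertForm hk x x = hilbertForm hk x (Additive.ofMul (sqCl (-1))) := by
  induction x using sqClass_induction with | _ u
  apply ZMod.two_eq_of_eq_zero_iff
  rw [hilbertForm_apply, hilbertForm_apply, hilbertSymbol_eq_zero_iff, hilbertSymbol_eq_zero_iff,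
    hk.self_iff u.ne_zero, Units.val_neg, Units.val_one]

end Symbol

lemma exists_rep_iff_normRel {k : Type*} [Field k] {a b c : k} (ha : a ≠ 0) :
    (∃ x y : k, c = a * x ^ 2 + b * y ^ 2) ↔ NormRel (-(a * b)) (a * c) := by
  constructor
  · rintro ⟨x, y, rfl⟩
    exact ⟨a * x, y, by ring⟩
  · rintro ⟨s, t, h⟩
    refine ⟨s / a, t, ?_⟩
    apply mul_left_cancel₀ ha
    rw [h]
    field_simp
    ring

/-- Fields with bilinear nondegenerate Hilbert symbols and finitely many square classes are
classified up to Witt equivalence by the number of square classes and the class of `-1`. -/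
theorem HilbertField.wittEquivalent {k : Type u} {l : Type v} [Field k] [Field l]
    (hk : HilbertField k) (hl : HilbertField l) (hfin : Finite (SqClass k))
    (hfin' : Finite (SqClass l)) (hcard : Nat.card (SqClass k) = Nat.card (SqClass l))
    (hneg : IsSquare (-1 : k) ↔ IsSquare (-1 : l)) : WittEquivalent k l := by
  have : Finite (Additive (SqClass k)) := hfin
  have : Finite (Additive (SqClass l)) := hfin'
  have hrank : Module.finrank (ZMod 2) (Additive (SqClass k)) =
      Module.finrank (ZMod 2) (Additive (SqClass l)) := by
    have h1 := Module.natCard_eq_pow_finrank (K := ZMod 2) (V := Additive (SqClass k))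
    have h2 := Module.natCard_eq_pow_finrank (K := ZMod 2) (V := Additive (SqClass l))
    have h3 : Nat.card (Additive (SqClass k)) = Nat.card (Additive (SqClass l)) := hcard
    rw [h1, h2] at h3
    refine Nat.pow_right_injective ?_ h3
    rw [Nat.card_zmod]
  have hww : Additive.ofMul (sqCl (-1 : kˣ)) = 0 ↔ Additive.ofMul (sqCl (-1 : lˣ)) = 0 := by
    rw [ofMul_eq_zero, ofMul_eq_zero, sqCl_eq_one_iff, sqCl_eq_one_iff]
    simpa using hneg
  obtain ⟨e, he⟩ := exists_isometry _ (Additive (SqClass k)) (Additive (SqClass l))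
    (hilbertForm hk) (hilbertForm hl) _ _
    (hilbertSymbol_comm hk) (hilbertSymbol_comm hl) (hilbertForm_nondegenerate hk)
    (hilbertForm_nondegenerate hl) (hilbertForm_self hk) (hilbertForm_self hl) hww rfl hrank.symm
  have hinj : Function.Injective e := by
    rw [injective_iff_map_eq_zero]
    intro x hx
    refine hilbertForm_nondegenerate hk x fun y => ?_
    rw [← he, hx, map_zero, LinearMap.zero_apply]
  have hbij : Function.Bijective e := hinj.bijective_of_nat_card_le hcard.ge
  let E := LinearEquiv.ofBijective e hbij
  let α : SqClass k ≃* SqClass l :=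
    { toFun := fun x => Additive.toMul (E (Additive.ofMul x))
      invFun := fun y => Additive.toMul (E.symm (Additive.ofMul y))
      left_inv := fun x => by simp
      right_inv := fun x => by simp
      map_mul' := fun x y => by rw [ofMul_mul, map_add]; rfl }
  have hα : ∀ x, Additive.ofMul (α x) = e (Additive.ofMul x) := fun x => rfl
  have hneg1 : α (sqCl (-1)) = sqCl (-1) := by
    apply Additive.ofMul.injective
    rw [hα, ← sub_eq_zero]
    refine hilbertForm_nondegenerate hl _ fun y => ?_
    obtain ⟨x, rfl⟩ := hbij.2 y
    rw [map_sub, LinearMap.sub_apply, sub_eq_zero]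
    have h1 := hilbertForm_self hk x
    rw [← he, ← he] at h1
    rw [hilbertForm_apply, hilbertForm_apply, hilbertSymbol_comm hl,
      hilbertSymbol_comm hl (Additive.ofMul _)]
    exact h1.symm.trans (hilbertForm_self hl (e x))
  refine ⟨α, hneg1, ?_⟩
  intro a b c a' b' c' hA hB hC
  rw [exists_rep_iff_normRel a.ne_zero, exists_rep_iff_normRel a'.ne_zero]
  have h1 := hilbertSymbol_eq_zero_iff (-1 * (a * b)) (a * c)
  have h2 := hilbertSymbol_eq_zero_iff (-1 * (a' * b')) (a' * c')
  have h3 : α (sqCl (-1 * (a * b))) = sqCl (-1 * (a' * b')) := by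
    rw [sqCl_mul, sqCl_mul, map_mul, map_mul, hneg1, hA, hB, sqCl_mul, sqCl_mul]
  have h4 : α (sqCl (a * c)) = sqCl (a' * c') := by
    rw [sqCl_mul, map_mul, hA, hC, sqCl_mul]
  rw [← h3, ← h4, hα, hα] at h2
  have h5 := he (Additive.ofMul (sqCl (-1 * (a * b)))) (Additive.ofMul (sqCl (a * c)))
  rw [hilbertForm_apply, hilbertForm_apply] at h5
  rw [h5, h1] at h2
  push_cast at h2
  simpa using h2

section Conic

variable {k : Type*} [Field k] {a b : k}

/-- The class of a coordinate function in the coordinate ring of the conic. -/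
def conicCoord (a b : k) (i : Fin 2) : ConicRing k a b := Ideal.Quotient.mk _ (X i)

lemma conicCoord_eq (a b : k) :
    algebraMap k (ConicRing k a b) a * conicCoord a b 0 ^ 2 +
      algebraMap k (ConicRing k a b) b * conicCoord a b 1 ^ 2 = 1 := by
  have h : (Ideal.Quotient.mk (Ideal.span {conicPoly k a b})) (conicPoly k a b) = 0 :=
    Ideal.Quotient.eq_zero_iff_mem.2 (Ideal.mem_span_singleton_self _)
  rw [conicPoly, map_sub, map_add, map_mul, map_mul, map_pow, map_pow, map_one, sub_eq_zero] at h
  exact h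

/-- Evaluation of the coordinate ring at a point of the conic. -/
def conicEval {M : Type*} [CommRing M] [Algebra k M] (x y : M)
    (h : algebraMap k M a * x ^ 2 + algebraMap k M b * y ^ 2 = 1) : ConicRing k a b →ₐ[k] M :=
  Ideal.Quotient.liftₐ _ (aeval ![x, y]) (by
    intro z hz
    obtain ⟨c, rfl⟩ := Ideal.mem_span_singleton'.1 hz
    rw [map_mul, conicPoly, map_sub, map_add, map_mul, map_mul, map_pow, map_pow, map_one, aeval_X,
      aeval_X, aeval_C, aeval_C]
    simp [h])

section

variable {M : Type*} [CommRing M] [Algebra k M] (x y : M)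
    (h : algebraMap k M a * x ^ 2 + algebraMap k M b * y ^ 2 = 1)

@[simp] lemma conicEval_zero : conicEval x y h (conicCoord a b 0) = x := by
  change aeval ![x, y] (X 0 : MvPolynomial (Fin 2) k) = x
  simp

@[simp] lemma conicEval_one : conicEval x y h (conicCoord a b 1) = y := by
  change aeval ![x, y] (X 1 : MvPolynomial (Fin 2) k) = y
  simp

end

lemma ConicRing.exists_normal_form (hb : b ≠ 0) (z : ConicRing k a b) :
    ∃ u w : Polynomial k, z = Polynomial.aeval (conicCoord a b 0) u +
      Polynomial.aeval (conicCoord a b 0) w * conicCoord a b 1 := by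
  obtain ⟨z, rfl⟩ := Ideal.Quotient.mk_surjective z
  induction z using MvPolynomial.induction_on with
  | C c =>
    refine ⟨Polynomial.C c, 0, ?_⟩
    simp only [Polynomial.aeval_C, map_zero, zero_mul, add_zero]
    rfl
  | add p q hp hq =>
    obtain ⟨u, w, hp⟩ := hp
    obtain ⟨u', w', hq⟩ := hq
    refine ⟨u + u', w + w', ?_⟩
    rw [map_add, hp, hq]
    simp only [map_add]
    ring
  | mul_X p i hp =>
    obtain ⟨u, w, hp⟩ := hp
    rw [map_mul, hp]
    have hi : i = 0 ∨ i = 1 := by fin_cases i <;> simp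
    rcases hi with rfl | rfl
    · refine ⟨u * Polynomial.X, w * Polynomial.X, ?_⟩
      change _ * conicCoord a b 0 = _
      simp only [map_mul, Polynomial.aeval_X]
      ring
    · refine ⟨w * (Polynomial.C b⁻¹ * (1 - Polynomial.C a * Polynomial.X ^ 2)), u, ?_⟩
      change _ * conicCoord a b 1 = _
      have h := conicCoord_eq a b
      have hb_eq : algebraMap k (ConicRing k a b) b⁻¹ * algebraMap k (ConicRing k a b) b = 1 := by
        rw [← map_mul, inv_mul_cancel₀ hb, map_one]
      simp only [map_mul, map_sub, map_one, map_pow, Polynomial.aeval_X, Polynomial.aeval_C]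
      rw [← h]
      linear_combination (-(Polynomial.aeval (conicCoord a b 0)) w * conicCoord a b 1 ^ 2) * hb_eq

/-- The polynomial `1 - a x²` is not a square up to a constant. -/
lemma Polynomial.eq_zero_of_mul_sq_eq (h2 : (2 : k) ≠ 0) (ha : a ≠ 0) {c : k} (hc : c ≠ 0)
    {u w : Polynomial k} (h : Polynomial.C c * u ^ 2 =
      (1 - Polynomial.C a * Polynomial.X ^ 2) * w ^ 2) : u = 0 ∧ w = 0 := by
  have hw : w = 0 := by
    by_contra hw
    have hdvd : w ^ 2 ∣ u ^ 2 := by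
      refine ⟨Polynomial.C c⁻¹ * (1 - Polynomial.C a * Polynomial.X ^ 2), ?_⟩
      have h1 : Polynomial.C c⁻¹ * Polynomial.C c = 1 := by
        rw [← Polynomial.C_mul, inv_mul_cancel₀ hc, Polynomial.C_1]
      linear_combination (Polynomial.C c⁻¹) * h - u ^ 2 * h1
    rw [IsIntegrallyClosed.pow_dvd_pow_iff two_ne_zero] at hdvd
    obtain ⟨v, rfl⟩ := hdvd
    have h1 : Polynomial.C c * v ^ 2 = 1 - Polynomial.C a * Polynomial.X ^ 2 := by
      apply mul_right_cancel₀ (pow_ne_zero 2 hw)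
      rw [← h]; ring
    have hd : (1 - Polynomial.C a * Polynomial.X ^ 2 : Polynomial k).natDegree = 2 := by
      compute_degree!
    have hv : v.natDegree = 1 := by
      have := congrArg Polynomial.natDegree h1
      rw [hd, Polynomial.natDegree_C_mul hc, Polynomial.natDegree_pow] at this
      omega
    obtain ⟨e, d, hv1⟩ := Polynomial.exists_eq_X_add_C_of_natDegree_le_one hv.le
    have e0 := congrArg (Polynomial.eval 0) h1
    have e1 := congrArg (Polynomial.eval 1) h1
    have e2 := congrArg (Polynomial.eval (-1)) h1
    simp only [hv1, Polynomial.eval_mul, Polynomial.eval_pow, Polynomial.eval_add, Polynomial.eval_C,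
      Polynomial.eval_X, Polynomial.eval_sub, Polynomial.eval_one] at e0 e1 e2
    have hd0 : d ≠ 0 := by
      rintro rfl
      simp at e0
    have he0 : e = 0 := by
      have : (2 * 2 * c * d) * e = 0 := by linear_combination e1 - e2
      simpa [h2, hc, hd0] using this
    rw [he0] at e1 e0
    apply ha
    linear_combination e1 - e0
  refine ⟨?_, hw⟩
  rw [hw] at h
  simpa [hc] using h

lemma conicEval_injective (h2 : (2 : k) ≠ 0) (ha : a ≠ 0) (hb : b ≠ 0) {M : Type*} [Field M]
    [Algebra k M] {x y : M} (h : algebraMap k M a * x ^ 2 + algebraMap k M b * y ^ 2 = 1)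
    (hx : Transcendental k x) {u w : Polynomial k}
    (huw : Polynomial.aeval x u + Polynomial.aeval x w * y = 0) : u = 0 ∧ w = 0 := by
  apply Polynomial.eq_zero_of_mul_sq_eq h2 ha hb
  rw [transcendental_iff] at hx
  rw [← sub_eq_zero]
  apply hx
  simp only [map_mul, map_sub, map_pow, Polynomial.aeval_C, map_one, Polynomial.aeval_X]
  linear_combination (algebraMap k M b * (Polynomial.aeval x u - Polynomial.aeval x w * y)) * huw
    + Polynomial.aeval x w ^ 2 * h

end Conic

section Param

variable {k : Type*} [Field k] {M : Type*} [Field M] [Algebra k M] {a b : k} {s t : M}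

lemma one_add_mul_sq_ne_zero (hb : b ≠ 0) (ht : Transcendental k t) :
    1 + algebraMap k M b * t ^ 2 ≠ 0 := by
  intro h
  refine ht ⟨1 + Polynomial.C b * Polynomial.X ^ 2, ?_, by simpa using h⟩
  intro h0
  have := congrArg (fun p => Polynomial.coeff p 2) h0
  simp [Polynomial.coeff_one, hb] at this

lemma conic_param_eq (ha : a ≠ 0) (hb : b ≠ 0) (hs : s ^ 2 = algebraMap k M a)
    (ht : Transcendental k t) :
    algebraMap k M a * ((algebraMap k M b * t ^ 2 - 1) /
      (s * (1 + algebraMap k M b * t ^ 2))) ^ 2 +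
      algebraMap k M b * (-2 * t / (1 + algebraMap k M b * t ^ 2)) ^ 2 = 1 := by
  have h1 := one_add_mul_sq_ne_zero hb ht
  have hs0 : s ≠ 0 := by
    rintro rfl
    exact ha ((map_eq_zero (algebraMap k M)).1 (by rw [← hs]; simp))
  rw [← hs]
  field_simp
  ring

lemma conic_param_transcendental (h2 : (2 : k) ≠ 0) (ha : a ≠ 0) (hb : b ≠ 0)
    (hs : s ^ 2 = algebraMap k M a) (ht : Transcendental k t) :
    Transcendental k ((algebraMap k M b * t ^ 2 - 1) /
      (s * (1 + algebraMap k M b * t ^ 2))) := by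
  have h1 := one_add_mul_sq_ne_zero hb ht
  have hs0 : s ≠ 0 := by
    rintro rfl
    exact ha ((map_eq_zero (algebraMap k M)).1 (by rw [← hs]; simp))
  set z := (algebraMap k M b * t ^ 2 - 1) / (s * (1 + algebraMap k M b * t ^ 2)) with hz
  have hb0 : algebraMap k M b ≠ 0 := (map_ne_zero _).2 hb
  have h2' : (2 : M) ≠ 0 := by
    have := (map_ne_zero (algebraMap k M)).2 h2
    rwa [map_ofNat] at this
  intro halg
  have hsalg : IsAlgebraic k s := by
    apply IsAlgebraic.of_pow two_pos
    rw [hs]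
    exact isAlgebraic_algebraMap a
  have hsz : s * z * (1 + algebraMap k M b * t ^ 2) = algebraMap k M b * t ^ 2 - 1 := by
    rw [hz]; field_simp
  have hne : 1 - s * z ≠ 0 := by
    intro h
    apply h2'
    linear_combination (1 + algebraMap k M b * t ^ 2) * h + hsz
  have ht2 : t ^ 2 = (1 + s * z) * (algebraMap k M b * (1 - s * z))⁻¹ := by
    rw [eq_mul_inv_iff_mul_eq₀ (mul_ne_zero hb0 hne)]
    linear_combination -hsz
  apply ht
  apply IsAlgebraic.of_pow two_pos
  rw [ht2]
  have hA : IsAlgebraic k (s * z) := hsalg.mul halg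
  exact (isAlgebraic_one.add hA).mul
    ((isAlgebraic_algebraMap b).mul (isAlgebraic_one.sub hA)).inv

end Param

/-- `x, y` are coordinates presenting `K` as the function field of the conic
`a·x² + b·y² = 1` over `k`. -/
structure ConicCoords {k K : Type*} [Field k] [Field K] [Algebra k K] (a b : k) (x y : K) :
    Prop where
  two_ne : (2 : k) ≠ 0
  a_ne : a ≠ 0
  b_ne : b ≠ 0
  eq : algebraMap k K a * x ^ 2 + algebraMap k K b * y ^ 2 = 1
  transcendental : Transcendental k x
  gen : ∀ z : K, ∃ p q r : Polynomial k, r ≠ 0 ∧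
    z * Polynomial.aeval x r = Polynomial.aeval x p + Polynomial.aeval x q * y

lemma IsConicFunctionField.exists_coords {k K : Type*} [Field k] [Field K] [Algebra k K] {a b : k}
    (h2 : (2 : k) ≠ 0) (ha : a ≠ 0) (hb : b ≠ 0)
    (h : IsConicFunctionField k a b K (algebraMap k K)) : ∃ x y : K, ConicCoords a b x y := by
  obtain ⟨f, hf, hfk, hgen⟩ := h
  let g : ConicRing k a b →ₐ[k] K := { f with commutes' := fun r => DFunLike.congr_fun hfk r }
  have hgf : ∀ z, g z = f z := fun z => rfl
  have htr : Transcendental k (g (conicCoord a b 0)) := by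
    let M := RatFunc (AlgebraicClosure k)
    obtain ⟨s, hs⟩ := IsAlgClosed.exists_pow_nat_eq (algebraMap k (AlgebraicClosure k) a) two_pos
    have hs' : (algebraMap (AlgebraicClosure k) M s) ^ 2 = algebraMap k M a := by
      rw [← map_pow, hs, ← IsScalarTower.algebraMap_apply]
    have ht : Transcendental k (RatFunc.X : M) := by
      have := RatFunc.transcendental_X (K := AlgebraicClosure k)
      exact this.restrictScalars (algebraMap k (AlgebraicClosure k)).injective
    rw [transcendental_iff]
    intro p hp
    rw [Polynomial.aeval_algHom_apply, hgf, map_eq_zero_iff f hf] at hp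
    have h1 := congrArg (conicEval _ _ (conic_param_eq ha hb hs' ht)) hp
    rw [← Polynomial.aeval_algHom_apply, conicEval_zero, map_zero] at h1
    exact (transcendental_iff.1 (conic_param_transcendental h2 ha hb hs' ht)) p h1
  have heq : algebraMap k K a * g (conicCoord a b 0) ^ 2 +
      algebraMap k K b * g (conicCoord a b 1) ^ 2 = 1 := by
    have := congrArg g (conicCoord_eq a b)
    simpa using this
  refine ⟨g (conicCoord a b 0), g (conicCoord a b 1), h2, ha, hb, heq, htr, ?_⟩
  set x := g (conicCoord a b 0)
  set y := g (conicCoord a b 1)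
  intro z
  obtain ⟨p, q, hq, hz⟩ := hgen z
  obtain ⟨u, w, rfl⟩ := ConicRing.exists_normal_form hb p
  obtain ⟨u', w', rfl⟩ := ConicRing.exists_normal_form hb q
  rw [← hgf, ← hgf, map_add, map_add, map_mul, map_mul, ← Polynomial.aeval_algHom_apply,
    ← Polynomial.aeval_algHom_apply, ← Polynomial.aeval_algHom_apply,
    ← Polynomial.aeval_algHom_apply] at hz
  rw [← hgf, map_add, map_mul, ← Polynomial.aeval_algHom_apply,
    ← Polynomial.aeval_algHom_apply] at hq
  let Q : Polynomial k := 1 - Polynomial.C a * Polynomial.X ^ 2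
  have hQ : Polynomial.aeval x Q = algebraMap k K b * y ^ 2 := by
    simp only [Q, map_sub, map_one, map_mul, map_pow, Polynomial.aeval_C, Polynomial.aeval_X]
    rw [← heq]; ring
  refine ⟨Polynomial.C b * u * u' - Q * w * w', Polynomial.C b * (w * u' - u * w'),
    Polynomial.C b * u' ^ 2 - Q * w' ^ 2, ?_, ?_⟩
  · intro h0
    obtain ⟨rfl, rfl⟩ := Polynomial.eq_zero_of_mul_sq_eq h2 ha hb (sub_eq_zero.1 h0)
    simp at hq
  · rw [eq_div_iff hq] at hz
    simp only [map_sub, map_mul, map_pow, hQ, Polynomial.aeval_C]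
    linear_combination (algebraMap k K b * (Polynomial.aeval x u' - Polynomial.aeval x w' * y)) * hz

namespace ConicCoords

variable {k K : Type*} [Field k] [Field K] [Algebra k K] {a b : k} {x y : K}
  (h : ConicCoords a b x y)
include h

lemma aeval_ne_zero {r : Polynomial k} (hr : r ≠ 0) : Polynomial.aeval x r ≠ 0 :=
  fun h0 => hr (transcendental_iff.1 h.transcendental r h0)

lemma indep {u w : Polynomial k} (huw : Polynomial.aeval x u + Polynomial.aeval x w * y = 0) :
    u = 0 ∧ w = 0 :=
  conicEval_injective h.two_ne h.a_ne h.b_ne h.eq h.transcendental huw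

lemma conicEval_injective' : Function.Injective (conicEval x y h.eq) := by
  rw [injective_iff_map_eq_zero]
  intro z hz
  obtain ⟨u, w, rfl⟩ := ConicRing.exists_normal_form h.b_ne z
  rw [map_add, map_mul, ← Polynomial.aeval_algHom_apply, ← Polynomial.aeval_algHom_apply,
    conicEval_zero, conicEval_one] at hz
  obtain ⟨rfl, rfl⟩ := h.indep hz
  simp

/-- Homomorphisms out of the function field correspond to generic points of the conic. -/
theorem exists_lift {M : Type*} [Field M] [Algebra k M] {x' y' : M}
    (h' : algebraMap k M a * x' ^ 2 + algebraMap k M b * y' ^ 2 = 1)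
    (hx' : Transcendental k x') : ∃ j : K →ₐ[k] M, j x = x' ∧ j y = y' := by
  let _ : Algebra (ConicRing k a b) K := (conicEval x y h.eq).toAlgebra
  have hmap : ∀ z, algebraMap (ConicRing k a b) K z = conicEval x y h.eq z := fun z => rfl
  have hinj := h.conicEval_injective'
  have : IsDomain (ConicRing k a b) := hinj.isDomain (conicEval x y h.eq : ConicRing k a b →+* K)
  have hx : ∀ p : Polynomial k, conicEval x y h.eq (Polynomial.aeval (conicCoord a b 0) p) =
      Polynomial.aeval x p := fun p => by
    rw [← Polynomial.aeval_algHom_apply, conicEval_zero]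
  have : FaithfulSMul (ConicRing k a b) K := (faithfulSMul_iff_algebraMap_injective _ _).2 hinj
  have : IsFractionRing (ConicRing k a b) K := by
    apply IsFractionRing.of_field
    intro z
    obtain ⟨p, q, r, hr, hz⟩ := h.gen z
    refine ⟨Polynomial.aeval (conicCoord a b 0) p +
      Polynomial.aeval (conicCoord a b 0) q * conicCoord a b 1,
      Polynomial.aeval (conicCoord a b 0) r, ?_⟩
    rw [hmap, hmap, map_add, map_mul, hx, hx, hx, conicEval_one, eq_div_iff (h.aeval_ne_zero hr), hz]
  have hinj' : Function.Injective (conicEval x' y' h' : ConicRing k a b →+* M) := by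
    rw [injective_iff_map_eq_zero]
    intro z hz
    obtain ⟨u, w, rfl⟩ := ConicRing.exists_normal_form h.b_ne z
    rw [RingHom.coe_coe, map_add, map_mul, ← Polynomial.aeval_algHom_apply,
      ← Polynomial.aeval_algHom_apply, conicEval_zero, conicEval_one] at hz
    obtain ⟨rfl, rfl⟩ := conicEval_injective h.two_ne h.a_ne h.b_ne h' hx' hz
    simp
  have hl : ∀ z, IsFractionRing.lift hinj' (conicEval x y h.eq z) = conicEval x' y' h' z :=
    fun z => IsFractionRing.lift_algebraMap hinj' z
  refine ⟨{ IsFractionRing.lift hinj' with commutes' := fun r => ?_ }, ?_, ?_⟩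
  · have := hl (algebraMap k _ r)
    rw [AlgHom.commutes, AlgHom.commutes] at this
    exact this
  · have := hl (conicCoord a b 0)
    rw [conicEval_zero, conicEval_zero] at this
    exact this
  · have := hl (conicCoord a b 1)
    rw [conicEval_one, conicEval_one] at this
    exact this

lemma hom_ext {M : Type*} [Field M] [Algebra k M] {j j' : K →ₐ[k] M} (hx : j x = j' x)
    (hy : j y = j' y) : j = j' := by
  ext z
  obtain ⟨p, q, r, hr, hz⟩ := h.gen z
  have h0 : j (Polynomial.aeval x r) ≠ 0 := (map_ne_zero j).2 (h.aeval_ne_zero hr)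
  have e : ∀ p : Polynomial k, j (Polynomial.aeval x p) = j' (Polynomial.aeval x p) := fun p => by
    rw [← Polynomial.aeval_algHom_apply, ← Polynomial.aeval_algHom_apply, hx]
  apply mul_right_cancel₀ h0
  rw [← map_mul, hz, e r, ← map_mul, hz, map_add, map_add, map_mul, map_mul, e, e, hy]

/-- The constants are relatively closed under square roots. -/
lemma exists_of_sq_eq {r : K} {e : k} (hr : r ^ 2 = algebraMap k K e) :
    ∃ c, r = algebraMap k K c := by
  obtain ⟨p, q, d, hd, hz⟩ := h.gen r
  let Q : Polynomial k := 1 - Polynomial.C a * Polynomial.X ^ 2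
  have hQ : Polynomial.aeval x Q = algebraMap k K b * y ^ 2 := by
    simp only [Q, map_sub, map_one, map_mul, map_pow, Polynomial.aeval_C, Polynomial.aeval_X]
    rw [← h.eq]; ring
  have h1 : Polynomial.aeval x (Polynomial.C b * (p ^ 2 - Polynomial.C e * d ^ 2) + Q * q ^ 2) +
      Polynomial.aeval x (2 * Polynomial.C b * p * q) * y = 0 := by
    simp only [map_add, map_mul, map_sub, map_pow, hQ, Polynomial.aeval_C, map_ofNat]
    linear_combination (-algebraMap k K b) * (Polynomial.aeval x p + Polynomial.aeval x q * y +
      r * Polynomial.aeval x d) * hz + (algebraMap k K b) * (Polynomial.aeval x d) ^ 2 * hr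
  obtain ⟨e1, e2⟩ := h.indep h1
  have e3 : p = 0 ∨ q = 0 := by
    have : (2 : Polynomial k) ≠ 0 := by
      rw [← Polynomial.C_ofNat]
      exact Polynomial.C_ne_zero.2 h.two_ne
    simpa [this, h.b_ne] using e2
  rcases e3 with rfl | rfl
  · by_cases he : e = 0
    · refine ⟨0, ?_⟩
      rw [he, map_zero] at hr
      rw [map_zero]
      exact pow_eq_zero_iff two_ne_zero |>.1 hr
    · have := Polynomial.eq_zero_of_mul_sq_eq h.two_ne h.a_ne (mul_ne_zero h.b_ne he) (u := d)
        (w := q) (by rw [Polynomial.C_mul]; linear_combination -e1)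
      exact absurd this.1 hd
  · have e4 : p ^ 2 = Polynomial.C e * d ^ 2 := by
      have : Polynomial.C b * (p ^ 2 - Polynomial.C e * d ^ 2) = 0 := by
        rw [← e1]; ring
      rw [mul_eq_zero, Polynomial.C_eq_zero, or_iff_right h.b_ne, sub_eq_zero] at this
      exact this
    have hdvd : d ∣ p := by
      rw [← IsIntegrallyClosed.pow_dvd_pow_iff two_ne_zero, e4]
      exact Dvd.intro_left _ rfl
    obtain ⟨v, rfl⟩ := hdvd
    have e5 : v ^ 2 = Polynomial.C e := by
      apply mul_left_cancel₀ (pow_ne_zero 2 hd)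
      rw [← mul_pow, e4, mul_comm]
    have hv : v.natDegree = 0 := by
      have := congrArg Polynomial.natDegree e5
      rw [Polynomial.natDegree_pow, Polynomial.natDegree_C] at this
      omega
    obtain ⟨c, rfl⟩ := Polynomial.natDegree_eq_zero.1 hv
    refine ⟨c, ?_⟩
    apply mul_right_cancel₀ (h.aeval_ne_zero hd)
    rw [hz]
    simp [mul_comm]

end ConicCoords

section Branch

variable {E F : Type*} [Field E] [Field F] [Algebra E F]

/-- Expansion of a polynomial at a point `ζ`. -/
def polyBranch (ζ : F) : Polynomial E →+* HahnSeries ℤ F :=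
  (HahnSeries.ofPowerSeries ℤ F).comp (Polynomial.coeToPowerSeries.ringHom.comp
    ((Polynomial.taylorAlgHom ζ : Polynomial F →+* Polynomial F).comp
      (Polynomial.mapRingHom (algebraMap E F))))

lemma polyBranch_apply (ζ : F) (p : Polynomial E) : polyBranch ζ p =
    HahnSeries.ofPowerSeries ℤ F (Polynomial.taylor ζ (p.map (algebraMap E F))) := rfl

lemma polyBranch_coeff (ζ : F) (p : Polynomial E) (n : ℕ) : (polyBranch ζ p).coeff n =
    (Polynomial.taylor ζ (p.map (algebraMap E F))).coeff n := by
  rw [polyBranch_apply, HahnSeries.ofPowerSeries_apply_coeff, Polynomial.coeff_coe]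

lemma polyBranch_coeff_zero (ζ : F) (p : Polynomial E) : (polyBranch ζ p).coeff 0 =
    Polynomial.aeval ζ p := by
  have := polyBranch_coeff ζ p 0
  rw [Polynomial.taylor_coeff_zero, Polynomial.eval_map_algebraMap] at this
  exact this

lemma polyBranch_coeff_one (ζ : F) (p : Polynomial E) : (polyBranch ζ p).coeff 1 =
    Polynomial.aeval ζ p.derivative := by
  have := polyBranch_coeff ζ p 1
  rw [Polynomial.taylor_coeff_one, Polynomial.derivative_map, Polynomial.eval_map_algebraMap] at this
  exact this

lemma polyBranch_injective (ζ : F) : Function.Injective (polyBranch ζ : Polynomial E →+* _) := by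
  intro p q h
  rw [polyBranch_apply, polyBranch_apply] at h
  have h1 := Polynomial.coe_injective F (HahnSeries.ofPowerSeries_injective h)
  exact Polynomial.map_injective _ (algebraMap E F).injective (Polynomial.taylor_injective ζ h1)

lemma polyBranch_C (ζ : F) (c : E) :
    polyBranch ζ (Polynomial.C c) = HahnSeries.C (algebraMap E F c) := by
  rw [polyBranch_apply, Polynomial.map_C, Polynomial.taylor_C, Polynomial.coe_C,
    HahnSeries.ofPowerSeries_C]

lemma polyBranch_order_nonneg (ζ : F) (p : Polynomial E) : 0 ≤ (polyBranch ζ p).order := by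
  by_cases hp : polyBranch ζ p = 0
  · rw [hp, HahnSeries.order_zero]
  by_contra! hneg
  apply HahnSeries.coeff_order_eq_zero.not.2 hp
  rw [polyBranch_apply, HahnSeries.ofPowerSeries_apply]
  apply HahnSeries.embDomain_of_notMem_range
  rintro ⟨n, hn⟩
  rw [polyBranch_apply, HahnSeries.ofPowerSeries_apply] at hneg
  rw [← hn] at hneg
  exact absurd hneg (by simp)

lemma polyBranch_order_zero {ζ : F} {p : Polynomial E} (h : Polynomial.aeval ζ p ≠ 0) :
    (polyBranch ζ p).order = 0 := by
  refine le_antisymm (HahnSeries.order_le_of_coeff_ne_zero ?_) (polyBranch_order_nonneg ζ p)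
  rwa [polyBranch_coeff_zero]

lemma polyBranch_order_one {ζ : F} {p : Polynomial E} (h : Polynomial.aeval ζ p = 0)
    (h' : Polynomial.aeval ζ p.derivative ≠ 0) : (polyBranch ζ p).order = 1 := by
  have h1 : (polyBranch ζ p).coeff 1 ≠ 0 := by rwa [polyBranch_coeff_one]
  have h2 := HahnSeries.order_le_of_coeff_ne_zero h1
  have h3 := polyBranch_order_nonneg ζ p
  have h4 : (polyBranch ζ p).order ≠ 0 := by
    intro h5
    have hne : polyBranch ζ p ≠ 0 := fun h0 => h1 (by rw [h0]; rfl)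
    have := HahnSeries.coeff_order_eq_zero.not.2 hne
    rw [h5, polyBranch_coeff_zero] at this
    exact this h
  omega

end Branch

/-- A polynomial with even order at every algebraic point is a square up to a constant. -/
lemma Polynomial.eq_C_mul_sq_of_even {E : Type u} [Field E] [CharZero E] (n : ℕ) :
    ∀ p : Polynomial E, p.natDegree ≤ n →
    (∀ π : Polynomial E, ∀ hπ : Irreducible π, haveI := Fact.mk hπ
      Even (polyBranch (AdjoinRoot.root π) p).order) → ∃ c g, p = Polynomial.C c * g ^ 2 := by
  induction n using Nat.strong_induction_on with
  | _ n ih =>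
  intro p hn hp
  by_cases h0 : p = 0
  · exact ⟨0, 0, by simp [h0]⟩
  by_cases hu : IsUnit p
  · obtain ⟨c, -, rfl⟩ := Polynomial.isUnit_iff.1 hu
    exact ⟨c, 1, by simp⟩
  obtain ⟨π, hπ, hdvd⟩ := WfDvdMonoid.exists_irreducible_factor hu h0
  have := Fact.mk hπ
  have hroot : Polynomial.aeval (AdjoinRoot.root π) π = 0 := by
    rw [AdjoinRoot.aeval_eq, AdjoinRoot.mk_self]
  have hsep : Polynomial.aeval (AdjoinRoot.root π) π.derivative ≠ 0 :=
    Polynomial.Separable.aeval_derivative_ne_zero hπ.separable hroot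
  have hord := polyBranch_order_one hroot hsep
  have hne : ∀ (π' : Polynomial E) (hπ' : Irreducible π') {f : Polynomial E}, f ≠ 0 →
      haveI := Fact.mk hπ'; polyBranch (AdjoinRoot.root π') f ≠ 0 := fun π' hπ' f hf => by
    have := Fact.mk hπ'
    exact (map_ne_zero_iff _ (polyBranch_injective (AdjoinRoot.root π'))).2 hf
  obtain ⟨q, rfl⟩ := hdvd
  have hq0 : q ≠ 0 := right_ne_zero_of_mul h0
  have hdvd' : π ∣ q := by
    by_contra hnd
    have h1 : (polyBranch (AdjoinRoot.root π) q).order = 0 := by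
      apply polyBranch_order_zero
      rwa [AdjoinRoot.aeval_eq, Ne, AdjoinRoot.mk_eq_zero]
    have h2 := hp π hπ
    rw [map_mul, HahnSeries.order_mul (hne π hπ hπ.ne_zero) (hne π hπ hq0), hord, h1] at h2
    exact absurd h2 (by decide)
  obtain ⟨q, rfl⟩ := hdvd'
  have hq0' : q ≠ 0 := right_ne_zero_of_mul hq0
  have hpos := hπ.natDegree_pos
  rw [Polynomial.natDegree_mul hπ.ne_zero hq0, Polynomial.natDegree_mul hπ.ne_zero hq0'] at hn
  obtain ⟨c, g, hcg⟩ := ih q.natDegree (by omega) q le_rfl (by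
    intro π' hπ'
    have := Fact.mk hπ'
    have h2 := hp π' hπ'
    rw [map_mul, map_mul, HahnSeries.order_mul (hne π' hπ' hπ.ne_zero)
      (mul_ne_zero (hne π' hπ' hπ.ne_zero) (hne π' hπ' hq0')),
      HahnSeries.order_mul (hne π' hπ' hπ.ne_zero) (hne π' hπ' hq0'), ← add_assoc] at h2
    exact (Int.even_add.1 h2).1 ⟨_, rfl⟩)
  exact ⟨c, π * g, by rw [hcg]; ring⟩

lemma exists_sqrt_extension {k : Type u} [Field k] (a : k) :
    ∃ (E : Type u) (_ : Field E) (_ : Algebra k E) (_ : FiniteDimensional k E) (s : E),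
      s ^ 2 = algebraMap k E a ∧
      ∀ c : E, ∃ α β : k, c = algebraMap k E α + algebraMap k E β * s := by
  by_cases ha : IsSquare a
  · obtain ⟨s, rfl⟩ := ha
    exact ⟨k, inferInstance, inferInstance, inferInstance, s, by simp [sq], fun c => ⟨c, 0, by simp⟩⟩
  · have : Fact (∀ r : k, r ^ 2 ≠ a + 0 * r) := ⟨fun r hr => ha ⟨r, by
      rw [← sq, hr]; ring⟩⟩
    refine ⟨QuadraticAlgebra k a 0, inferInstance, inferInstance, inferInstance, ⟨0, 1⟩, ?_, ?_⟩
    · ext <;> simp [sq, QuadraticAlgebra.algebraMap_eq]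
    · intro c
      refine ⟨c.re, c.im, ?_⟩
      ext <;> simp [QuadraticAlgebra.algebraMap_eq]

/-- `f` has even order at every place of `K/k`. -/
def EvenEverywhere (k : Type u) {K : Type v} [Field k] [Field K] [Algebra k K] (f : K) : Prop :=
  ∀ (F : Type u) [Field F] [Algebra k F] [FiniteDimensional k F] (φ : K →+* HahnSeries ℤ F),
    (∀ c, φ (algebraMap k K c) = HahnSeries.C (algebraMap k F c)) → Even (φ f).order

/-- Elements over a subfield and a square root form a subfield. -/
def quadraticSubfield {K M : Type*} [Field K] [Field M] (j : K →+* M) {s : M} {a : K}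
    (hs : s ^ 2 = j a) : Subfield M where
  carrier := {m | ∃ u w : K, m = j u + s * j w}
  mul_mem' := by
    rintro _ _ ⟨u, w, rfl⟩ ⟨u', w', rfl⟩
    refine ⟨u * u' + a * w * w', u * w' + u' * w, ?_⟩
    simp only [map_add, map_mul, ← hs]
    ring
  one_mem' := ⟨1, 0, by simp⟩
  add_mem' := by
    rintro _ _ ⟨u, w, rfl⟩ ⟨u', w', rfl⟩
    exact ⟨u + u', w + w', by simp only [map_add]; ring⟩
  zero_mem' := ⟨0, 0, by simp⟩
  neg_mem' := by
    rintro _ ⟨u, w, rfl⟩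
    exact ⟨-u, -w, by simp only [map_neg]; ring⟩
  inv_mem' := by
    rintro _ ⟨u, w, rfl⟩
    by_cases h0 : j u + s * j w = 0
    · exact ⟨0, 0, by simp [h0]⟩
    by_cases h1 : j u - s * j w = 0
    · have h2 : j u + s * j w = j (2 * u) := by
        rw [map_mul, map_ofNat]
        linear_combination -h1
      exact ⟨(2 * u)⁻¹, 0, by rw [h2, map_inv₀, map_zero, mul_zero, add_zero]⟩
    · have h2 : j (u ^ 2 - a * w ^ 2) = (j u + s * j w) * (j u - s * j w) := by
        simp only [map_sub, map_mul, map_pow, ← hs]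
        ring
      refine ⟨u / (u ^ 2 - a * w ^ 2), -w / (u ^ 2 - a * w ^ 2), ?_⟩
      rw [map_div₀, map_div₀, h2, map_neg]
      field_simp
      ring

lemma mem_quadraticSubfield {K M : Type*} [Field K] [Field M] {j : K →+* M} {s : M} {a : K}
    {hs : s ^ 2 = j a} {m : M} : m ∈ quadraticSubfield j hs ↔ ∃ u w : K, m = j u + s * j w := Iff.rfl

namespace ConicCoords

variable {k : Type u} {K : Type v} [Field k] [Field K] [Algebra k K] {a b : k} {x y : K}

theorem exists_of_evenEverywhere [CharZero k] (h : ConicCoords a b x y) {f : K} (hf : f ≠ 0)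
    (heven : EvenEverywhere k f) : ∃ (c : k) (r : K), f = algebraMap k K c * r ^ 2 := by
  obtain ⟨E, _, _, _, s, hs, hE⟩ := exists_sqrt_extension a
  have hcharE : CharZero E := charZero_of_injective_algebraMap (algebraMap k E).injective
  obtain ⟨s', hs'E⟩ : ∃ s', s' = algebraMap E (RatFunc E) s := ⟨_, rfl⟩
  have hkM : ∀ c : k, algebraMap k (RatFunc E) c = algebraMap E (RatFunc E) (algebraMap k E c) := fun c =>
    IsScalarTower.algebraMap_apply k E (RatFunc E) c
  have hs' : s' ^ 2 = algebraMap k (RatFunc E) a := by rw [hs'E, ← map_pow, hs, hkM]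
  obtain ⟨t, ht0⟩ : ∃ t : (RatFunc E), t = RatFunc.X := ⟨_, rfl⟩
  have ht : Transcendental k t := ht0 ▸
    (RatFunc.transcendental_X (K := E)).restrictScalars (algebraMap k E).injective
  obtain ⟨j, hjx, hjy⟩ := h.exists_lift (conic_param_eq h.a_ne h.b_ne hs' ht)
    (conic_param_transcendental h.two_ne h.a_ne h.b_ne hs' ht)
  have hM2 : (2 : (RatFunc E)) ≠ 0 := by
    have := (map_ne_zero (algebraMap k (RatFunc E))).2 h.two_ne
    rwa [map_ofNat] at this
  have hs0 : s' ≠ 0 := by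
    intro h0
    rw [h0] at hs'
    exact h.a_ne ((map_eq_zero (algebraMap k (RatFunc E))).1 (by rw [← hs']; simp))
  have hjinj : Function.Injective j := (j : K →+* (RatFunc E)).injective
  have hj : ∀ c, j (algebraMap k K c) = algebraMap k (RatFunc E) c := fun c => j.commutes c
  have hsj : s' ^ 2 = (j : K →+* (RatFunc E)) (algebraMap k K a) := by
    rw [hs']; exact (hj a).symm
  let S := quadraticSubfield (j : K →+* (RatFunc E)) hsj
  have hjS : ∀ z, j z ∈ S := fun z => mem_quadraticSubfield.2 ⟨z, 0, by simp⟩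
  have hsS : s' ∈ S := mem_quadraticSubfield.2 ⟨0, 1, by simp⟩
  have hES : ∀ c, algebraMap E (RatFunc E) c ∈ S := by
    intro c
    obtain ⟨α, β, rfl⟩ := hE c
    rw [map_add, map_mul, ← hs'E, ← hkM, ← hkM, ← hj, ← hj]
    exact S.add_mem (hjS _) (S.mul_mem (hjS _) hsS)
  have htS : t ∈ S := by
    have h1 := one_add_mul_sq_ne_zero h.b_ne ht
    have h2 : s' * j x - 1 ≠ 0 := by
      rw [hjx]
      intro h3
      field_simp at h3
      apply hM2
      linear_combination -h3
    have h3 : t = j y * (s' * j x - 1)⁻¹ := by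
      rw [eq_mul_inv_iff_mul_eq₀ h2, hjx, hjy]
      obtain ⟨D, hD⟩ : ∃ D, D = 1 + algebraMap k (RatFunc E) b * t ^ 2 := ⟨_, rfl⟩
      have hbt : algebraMap k (RatFunc E) b * t ^ 2 = D - 1 := by rw [hD]; ring
      rw [← hD] at h1
      simp only [hbt, add_sub_cancel]
      have h3 : s' * ((D - 1 - 1) / (s' * D)) = (D - 2) / D := by
        field_simp
        ring
      rw [h3]
      linear_combination t * mul_inv_cancel₀ h1
    rw [h3]
    exact S.mul_mem (hjS _) (S.inv_mem (S.sub_mem (S.mul_mem hsS (hjS _)) S.one_mem))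
  have hPS : ∀ p : Polynomial E, algebraMap (Polynomial E) (RatFunc E) p ∈ S := by
    intro p
    induction p using Polynomial.induction_on with
    | C c => exact hES c
    | add p q hp hq => rw [map_add]; exact S.add_mem hp hq
    | monomial n c hc =>
      rw [pow_succ, ← mul_assoc, map_mul, RatFunc.algebraMap_X, ← ht0]
      exact S.mul_mem hc htS
  have hall : ∀ m : (RatFunc E), ∃ u w : K, m = j u + s' * j w := by
    intro m
    obtain ⟨P, Q, -, rfl⟩ := IsFractionRing.div_surjective (A := Polynomial E) m
    exact mem_quadraticSubfield.1 (S.div_mem (hPS P) (hPS Q))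
  obtain ⟨P, Q, hQ, hPQ⟩ := IsFractionRing.div_surjective (A := Polynomial E) (j f)
  have hQ0 : Q ≠ 0 := nonZeroDivisors.ne_zero hQ
  have hQ0' : algebraMap (Polynomial E) (RatFunc E) Q ≠ 0 :=
    (map_ne_zero_iff _ (IsFractionRing.injective (Polynomial E) (RatFunc E))).2 hQ0
  have hPQ' : algebraMap (Polynomial E) (RatFunc E) (P * Q) = j f * algebraMap (Polynomial E) (RatFunc E) Q ^ 2 := by
    rw [← hPQ, map_mul]
    field_simp
  have heven' : ∀ π : Polynomial E, ∀ hπ : Irreducible π, haveI := Fact.mk hπ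
      Even (polyBranch (AdjoinRoot.root π) (P * Q)).order := by
    intro π hπ
    have := Fact.mk hπ
    let F := AdjoinRoot π
    have : FiniteDimensional E F := (AdjoinRoot.powerBasis hπ.ne_zero).finite
    have : FiniteDimensional k F := FiniteDimensional.trans k E F
    let l : (RatFunc E) →+* HahnSeries ℤ F := IsFractionRing.lift
      (polyBranch_injective (E := E) (AdjoinRoot.root π))
    have hl : ∀ p, l (algebraMap (Polynomial E) (RatFunc E) p) = polyBranch (AdjoinRoot.root π) p :=
      fun p => IsFractionRing.lift_algebraMap _ p
    have h1 := heven F (l.comp j) (by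
      intro c
      rw [RingHom.comp_apply, RingHom.coe_coe, hj, hkM]
      have : algebraMap E (RatFunc E) (algebraMap k E c) =
        algebraMap (Polynomial E) (RatFunc E) (Polynomial.C (algebraMap k E c)) := rfl
      rw [this, hl, polyBranch_C, ← IsScalarTower.algebraMap_apply k E F])
    have h2 : polyBranch (AdjoinRoot.root π) (P * Q) =
        (l.comp (j : K →+* (RatFunc E))) f * polyBranch (AdjoinRoot.root π) Q ^ 2 := by
      rw [← hl, hPQ', map_mul, map_pow, hl]; rfl
    have h3 : polyBranch (AdjoinRoot.root π) Q ≠ 0 :=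
      (map_ne_zero_iff _ (polyBranch_injective _)).2 hQ0
    rw [h2, HahnSeries.order_mul ((map_ne_zero _).2 hf) (pow_ne_zero 2 h3), HahnSeries.order_pow,
      two_nsmul]
    exact h1.add ⟨_, rfl⟩
  obtain ⟨c, g, hcg⟩ := Polynomial.eq_C_mul_sq_of_even (P * Q).natDegree (P * Q) le_rfl heven'
  obtain ⟨α, β, rfl⟩ := hE c
  obtain ⟨u, w, huw⟩ := hall (algebraMap (Polynomial E) (RatFunc E) g / algebraMap (Polynomial E) (RatFunc E) Q)
  have hmain : j f = (j (algebraMap k K α) + s' * j (algebraMap k K β)) * (j u + s' * j w) ^ 2 := by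
    have h1 : algebraMap (Polynomial E) (RatFunc E) (Polynomial.C (algebraMap k E α + algebraMap k E β * s)) =
        j (algebraMap k K α) + s' * j (algebraMap k K β) := by
      have : algebraMap (Polynomial E) (RatFunc E) (Polynomial.C (algebraMap k E α + algebraMap k E β * s)) =
        algebraMap E (RatFunc E) (algebraMap k E α + algebraMap k E β * s) := rfl
      rw [this, map_add, map_mul, hj, hj, hkM, hkM, hs'E]
      ring
    rw [hcg, map_mul, map_pow, h1] at hPQ'
    rw [← huw]
    field_simp
    exact hPQ'.symm
  by_cases hsK : ∃ r, j r = s'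
  · obtain ⟨r, hr⟩ := hsK
    have hr2 : r ^ 2 = algebraMap k K a := by
      apply hjinj
      rw [map_pow, hr, hj, hs']
    obtain ⟨e, rfl⟩ := h.exists_of_sq_eq hr2
    refine ⟨α + e * β, u + algebraMap k K e * w, hjinj ?_⟩
    rw [hmain, ← hr]
    simp only [map_add, map_mul, map_pow]
  have hind : ∀ u w : K, j u + s' * j w = 0 → u = 0 ∧ w = 0 := by
    intro u w h0
    have hw : w = 0 := by
      by_contra hw
      have hw' : j w ≠ 0 := (map_ne_zero _).2 hw
      refine hsK ⟨-u / w, ?_⟩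
      rw [map_div₀, map_neg]
      field_simp
      linear_combination -h0
    rw [hw, map_zero, mul_zero, add_zero, map_eq_zero] at h0
    exact ⟨h0, hw⟩
  set A := algebraMap k K α with hA
  set B := algebraMap k K β with hB
  set a' := algebraMap k K a with ha'
  have hsa : s' ^ 2 = j a' := hsj
  obtain ⟨e1, e2⟩ := hind (A * (u ^ 2 + a' * w ^ 2) + a' * B * (2 * u * w) - f)
    (A * (2 * u * w) + B * (u ^ 2 + a' * w ^ 2)) (by
    simp only [map_sub, map_add, map_mul, map_pow, map_ofNat, ← hsa]
    rw [hmain]; ring)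
  by_cases hβ : β = 0
  · have hB0 : B = 0 := by rw [hB, hβ, map_zero]
    rw [hB0] at e1 e2
    have e3 : A = 0 ∨ u = 0 ∨ w = 0 := by
      have h2K : (2 : K) ≠ 0 := by
        have := (map_ne_zero (algebraMap k K)).2 h.two_ne
        rwa [map_ofNat] at this
      simpa [h2K] using e2
    rcases e3 with e3 | rfl | rfl
    · exact absurd (by rw [e3] at e1; linear_combination -e1) hf
    · exact ⟨α * a, w, by rw [map_mul]; linear_combination -e1⟩
    · exact ⟨α, u, by linear_combination -e1⟩
  have hB0 : B ≠ 0 := (map_ne_zero _).2 hβ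
  have hw : w ≠ 0 := by
    rintro rfl
    have hu : u = 0 := by simpa [hB0] using e2
    apply hf
    rw [hu] at e1
    linear_combination -e1
  obtain ⟨n, hn⟩ := h.exists_of_sq_eq (r := (B * u + A * w) / w) (e := α ^ 2 - a * β ^ 2) (by
    rw [map_sub, map_mul, map_pow, map_pow, ← hA, ← hB, ← ha', div_pow]
    field_simp
    linear_combination B * e2)
  rw [div_eq_iff hw] at hn
  have hu : u = (algebraMap k K n - A) / B * w := by
    field_simp
    linear_combination hn
  refine ⟨α * (((n - α) / β) ^ 2 + a) + a * β * (2 * ((n - α) / β)), w, ?_⟩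
  simp only [map_add, map_mul, map_pow, map_div₀, map_sub, map_ofNat, ← hA, ← hB, ← ha']
  rw [hu] at e1
  linear_combination -e1

end ConicCoords

/-- A normalized discrete valuation together with its residue map. -/
structure DiscretePlace (K κ : Type*) [Field K] [Field κ] where
  v : K → ℤ
  res : K → κ
  v_zero : v 0 = 0
  v_mul : ∀ f g, f ≠ 0 → g ≠ 0 → v (f * g) = v f + v g
  v_add : ∀ f g, f + g ≠ 0 → min (v f) (v g) ≤ v (f + g)
  res_one : res 1 = 1
  res_mul : ∀ f g, 0 ≤ v f → 0 ≤ v g → res (f * g) = res f * res g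
  res_add : ∀ f g, 0 ≤ v f → 0 ≤ v g → res (f + g) = res f + res g
  res_eq_zero_iff : ∀ f, f ≠ 0 → 0 ≤ v f → (res f = 0 ↔ 0 < v f)
  res_surj : ∀ c, ∃ f, 0 ≤ v f ∧ res f = c
  exists_uniformizer : ∃ ϖ, ϖ ≠ 0 ∧ v ϖ = 1

namespace DiscretePlace

variable {K κ : Type*} [Field K] [Field κ] (P : DiscretePlace K κ) {f g : K}

lemma v_one : P.v 1 = 0 := by
  have := P.v_mul 1 1 one_ne_zero one_ne_zero
  rw [mul_one] at this
  omega

lemma v_inv (f : K) : P.v f⁻¹ = -P.v f := by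
  by_cases hf : f = 0
  · rw [hf, inv_zero, P.v_zero, neg_zero]
  · have := P.v_mul f f⁻¹ hf (inv_ne_zero hf)
    rw [mul_inv_cancel₀ hf, P.v_one] at this
    omega

lemma v_neg (f : K) : P.v (-f) = P.v f := by
  by_cases hf : f = 0
  · rw [hf, neg_zero]
  · have h1 := P.v_mul (-f) (-f) (neg_ne_zero.2 hf) (neg_ne_zero.2 hf)
    rw [neg_mul_neg, P.v_mul f f hf hf] at h1
    omega

lemma v_sq (f : K) : P.v (f ^ 2) = 2 * P.v f := by
  by_cases hf : f = 0
  · rw [hf, zero_pow two_ne_zero, P.v_zero, mul_zero]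
  · rw [pow_two, P.v_mul f f hf hf, two_mul]

lemma res_zero : P.res 0 = 0 := by
  have := P.res_add 0 0 P.v_zero.ge P.v_zero.ge
  rwa [add_zero, left_eq_add] at this

lemma nonneg_mul (hf : 0 ≤ P.v f) (hg : 0 ≤ P.v g) : 0 ≤ P.v (f * g) := by
  by_cases h0 : f = 0
  · rw [h0, zero_mul, P.v_zero]
  by_cases h1 : g = 0
  · rw [h1, mul_zero, P.v_zero]
  rw [P.v_mul f g h0 h1]
  omega

lemma nonneg_add (hf : 0 ≤ P.v f) (hg : 0 ≤ P.v g) : 0 ≤ P.v (f + g) := by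
  by_cases h0 : f + g = 0
  · rw [h0, P.v_zero]
  · exact (le_min hf hg).trans (P.v_add f g h0)

lemma nonneg_sq (hf : 0 ≤ P.v f) : 0 ≤ P.v (f ^ 2) := by
  rw [P.v_sq]; omega

lemma res_sq (hf : 0 ≤ P.v f) : P.res (f ^ 2) = P.res f ^ 2 := by
  rw [pow_two, P.res_mul f f hf hf, pow_two]

lemma v_eq_zero_of_res_ne (hf : 0 ≤ P.v f) (h : P.res f ≠ 0) : f ≠ 0 ∧ P.v f = 0 := by
  have h0 : f ≠ 0 := by
    rintro rfl
    exact h P.res_zero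
  refine ⟨h0, ?_⟩
  have := (P.res_eq_zero_iff f h0 hf).not.1 h
  omega

lemma res_ne_zero (h0 : f ≠ 0) (hf : P.v f = 0) : P.res f ≠ 0 := by
  rw [Ne, P.res_eq_zero_iff f h0 hf.ge]
  omega

lemma res_of_pos (hf : f = 0 ∨ 0 < P.v f) : 0 ≤ P.v f ∧ P.res f = 0 := by
  rcases hf with rfl | hf
  · exact ⟨P.v_zero.ge, P.res_zero⟩
  · refine ⟨hf.le, (P.res_eq_zero_iff f ?_ hf.le).2 hf⟩
    rintro rfl
    rw [P.v_zero] at hf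
    exact hf.false

lemma pos_of_res (hf : 0 ≤ P.v f) (h : P.res f = 0) : f = 0 ∨ 0 < P.v f := by
  by_cases h0 : f = 0
  · exact Or.inl h0
  · exact Or.inr ((P.res_eq_zero_iff f h0 hf).1 h)

lemma nonneg_one : 0 ≤ P.v 1 := P.v_one.ge

lemma one_add (hf : f = 0 ∨ 0 < P.v f) : 1 + f ≠ 0 ∧ P.v (1 + f) = 0 ∧ P.res (1 + f) = 1 := by
  obtain ⟨h1, h2⟩ := P.res_of_pos hf
  have h3 : P.res (1 + f) = 1 := by
    rw [P.res_add 1 f P.nonneg_one h1, h2, P.res_one, add_zero]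
  have h4 := P.v_eq_zero_of_res_ne (P.nonneg_add P.nonneg_one h1) (h3 ▸ one_ne_zero)
  exact ⟨h4.1, h4.2, h3⟩

lemma exists_unit {c : κ} (hc : c ≠ 0) : ∃ u : Kˣ, P.v u = 0 ∧ P.res u = c := by
  obtain ⟨f, hf, rfl⟩ := P.res_surj c
  obtain ⟨h0, h1⟩ := P.v_eq_zero_of_res_ne hf hc
  exact ⟨Units.mk0 f h0, h1, rfl⟩

/-- Square classes of units. -/
def unitClasses : Subgroup (SqClass K) where
  carrier := {y | ∃ u : Kˣ, sqCl u = y ∧ P.v u = 0}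
  mul_mem' := by
    rintro _ _ ⟨u, rfl, hu⟩ ⟨w, rfl, hw⟩
    refine ⟨u * w, rfl, ?_⟩
    rw [Units.val_mul, P.v_mul _ _ u.ne_zero w.ne_zero, hu, hw, add_zero]
  one_mem' := ⟨1, rfl, P.v_one⟩
  inv_mem' := by
    rintro _ ⟨u, rfl, hu⟩
    exact ⟨u⁻¹, rfl, by rw [Units.val_inv_eq_inv_val, P.v_inv, hu, neg_zero]⟩

/-- Square classes of principal units. -/
def principalClasses : Subgroup (SqClass K) where
  carrier := {y | ∃ u : Kˣ, sqCl u = y ∧ P.v u = 0 ∧ P.res u = 1}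
  mul_mem' := by
    rintro _ _ ⟨u, rfl, hu, hu'⟩ ⟨w, rfl, hw, hw'⟩
    refine ⟨u * w, rfl, ?_, ?_⟩
    · rw [Units.val_mul, P.v_mul _ _ u.ne_zero w.ne_zero, hu, hw, add_zero]
    · rw [Units.val_mul, P.res_mul _ _ hu.ge hw.ge, hu', hw', one_mul]
  one_mem' := ⟨1, rfl, P.v_one, P.res_one⟩
  inv_mem' := by
    rintro _ ⟨u, rfl, hu, hu'⟩
    have h0 : P.v (↑u⁻¹ : K) = 0 := by rw [Units.val_inv_eq_inv_val, P.v_inv, hu, neg_zero]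
    refine ⟨u⁻¹, rfl, h0, ?_⟩
    have := P.res_mul u (↑u⁻¹ : K) hu.ge h0.ge
    rwa [Units.mul_inv, P.res_one, hu', one_mul, eq_comm] at this

lemma mem_unitClasses {u : Kˣ} : sqCl u ∈ P.unitClasses ↔ Even (P.v u) := by
  constructor
  · rintro ⟨w, hw, hw0⟩
    obtain ⟨r, hr⟩ := sqCl_eq_iff.1 hw
    rw [hr, Units.val_mul, P.v_mul _ _ w.ne_zero (r ^ 2).ne_zero, Units.val_pow_eq_pow_val, P.v_sq,
      hw0, zero_add]
    exact even_two_mul _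
  · rintro ⟨n, hn⟩
    obtain ⟨ϖ, h0, h1⟩ := P.exists_uniformizer
    have hz : ∀ m : ℤ, P.v (ϖ ^ m) = m := by
      intro m
      induction m with
      | zero => rw [zpow_zero, P.v_one]
      | succ i ih => rw [zpow_add_one₀ h0, P.v_mul _ _ (zpow_ne_zero _ h0) h0, ih, h1]
      | pred i ih =>
        rw [zpow_sub_one₀ h0, P.v_mul _ _ (zpow_ne_zero _ h0) (inv_ne_zero h0), ih, P.v_inv, h1]
        rfl
    let r : Kˣ := Units.mk0 (ϖ ^ (-n)) (zpow_ne_zero _ h0)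
    refine ⟨u * r ^ 2, (sqCl_eq_iff.2 ⟨r, rfl⟩).symm, ?_⟩
    rw [Units.val_mul, P.v_mul _ _ u.ne_zero (r ^ 2).ne_zero, Units.val_pow_eq_pow_val, P.v_sq,
      Units.val_mk0, hz, hn]
    ring

lemma mem_principalClasses {u : Kˣ} (hu : P.v u = 0) :
    sqCl u ∈ P.principalClasses ↔ IsSquare (P.res u) := by
  constructor
  · rintro ⟨w, hw, hw0, hw1⟩
    obtain ⟨r, hr⟩ := sqCl_eq_iff.1 hw
    have hr0 : P.v r = 0 := by
      rw [hr, Units.val_mul, P.v_mul _ _ w.ne_zero (r ^ 2).ne_zero, Units.val_pow_eq_pow_val,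
        P.v_sq, hw0] at hu
      omega
    refine ⟨P.res r, ?_⟩
    rw [hr, Units.val_mul, Units.val_pow_eq_pow_val, P.res_mul _ _ hw0.ge (P.nonneg_sq hr0.ge), hw1,
      P.res_sq hr0.ge, one_mul, pow_two]
  · rintro ⟨c, hc⟩
    have hc0 : c ≠ 0 := by
      rintro rfl
      exact P.res_ne_zero u.ne_zero hu (by rw [hc, mul_zero])
    obtain ⟨r, hr0, hr⟩ := P.exists_unit (inv_ne_zero hc0)
    refine ⟨u * r ^ 2, (sqCl_eq_iff.2 ⟨r, rfl⟩).symm, ?_, ?_⟩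
    · rw [Units.val_mul, P.v_mul _ _ u.ne_zero (r ^ 2).ne_zero, Units.val_pow_eq_pow_val, P.v_sq,
        hu, hr0, mul_zero, add_zero]
    · rw [Units.val_mul, Units.val_pow_eq_pow_val, P.res_mul _ _ hu.ge (P.nonneg_sq hr0.ge),
        P.res_sq hr0.ge, hc, hr]
      field_simp

lemma mem_principalClasses_of_eq {u : Kˣ} {r m : K} (hm : m = 0 ∨ 0 < P.v m)
    (h : (u : K) = r ^ 2 * (1 + m)) : sqCl u ∈ P.principalClasses := by
  obtain ⟨h1, h2, h3⟩ := P.one_add hm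
  have hr : r ≠ 0 := by
    rintro rfl
    exact u.ne_zero (by rw [h]; ring)
  refine ⟨Units.mk0 _ h1, sqCl_eq_iff.2 ⟨Units.mk0 r hr, Units.ext ?_⟩, h2, h3⟩
  rw [h]
  simp [mul_comm]

lemma mem_principalClasses_of_res_eq {u w : Kˣ} (hu : P.v u = 0) (hw : P.v w = 0)
    (h : P.res u = P.res w) : ∃ t ∈ P.principalClasses, sqCl u = t * sqCl w := by
  have h0 : P.v (↑w⁻¹ : K) = 0 := by rw [Units.val_inv_eq_inv_val, P.v_inv, hw, neg_zero]
  refine ⟨sqCl (u * w⁻¹), ⟨_, rfl, ?_, ?_⟩, ?_⟩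
  · rw [Units.val_mul, P.v_mul _ _ u.ne_zero (w⁻¹).ne_zero, hu, h0, add_zero]
  · rw [Units.val_mul, P.res_mul _ _ hu.ge h0.ge, h, ← P.res_mul _ _ hw.ge h0.ge, Units.mul_inv,
      P.res_one]
  · rw [← sqCl_mul, inv_mul_cancel_right]

lemma pos_div (hf : f = 0 ∨ g ≠ 0 ∧ P.v g < P.v f) : f / g = 0 ∨ 0 < P.v (f / g) := by
  by_cases h0 : f = 0
  · simp [h0]
  · obtain ⟨hg, h⟩ := hf.resolve_left h0
    right
    rw [div_eq_mul_inv, P.v_mul _ _ h0 (inv_ne_zero hg), P.v_inv]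
    omega

lemma exists_unit_of_value {u w : Kˣ} {s t : K} (hu : P.v u = 0) (hns : ¬ IsSquare (-P.res u))
    (hw : (w : K) = s ^ 2 + u * t ^ 2) :
    ∃ w' : Kˣ, sqCl w = sqCl w' ∧ P.v w' = 0 ∧ NormRel (-P.res u) (P.res w') := by
  have key : ∀ (w₀ r : K), r ≠ 0 → 0 ≤ P.v w₀ → P.res w₀ ≠ 0 → NormRel (-P.res u) (P.res w₀) →
      (w : K) = r ^ 2 * w₀ → ∃ w' : Kˣ, sqCl w = sqCl w' ∧ P.v w' = 0 ∧
        NormRel (-P.res u) (P.res w') := by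
    intro w₀ r hr h1 h2 h3 h4
    obtain ⟨h5, h6⟩ := P.v_eq_zero_of_res_ne h1 h2
    refine ⟨Units.mk0 w₀ h5, (sqCl_eq_iff.2 ⟨Units.mk0 r hr, Units.ext ?_⟩).symm, h6, h3⟩
    rw [h4]
    simp [mul_comm]
  by_cases hcase : s ≠ 0 ∧ (t = 0 ∨ P.v s < P.v t)
  · obtain ⟨hs, hst⟩ := hcase
    obtain ⟨h1, h2⟩ := P.res_of_pos (P.pos_div (hst.imp id fun h => ⟨hs, h⟩))
    have h3 : P.res (1 + u * (t / s) ^ 2) = 1 := by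
      rw [P.res_add _ _ P.nonneg_one (P.nonneg_mul hu.ge (P.nonneg_sq h1)),
        P.res_mul _ _ hu.ge (P.nonneg_sq h1), P.res_sq h1, h2, P.res_one]
      ring
    refine key (1 + u * (t / s) ^ 2) s hs
      (P.nonneg_add P.nonneg_one (P.nonneg_mul hu.ge (P.nonneg_sq h1))) (h3 ▸ one_ne_zero) ?_ ?_
    · rw [h3]
      exact ⟨1, 0, by ring⟩
    · rw [hw]
      field_simp
  · push Not at hcase
    have ht : t ≠ 0 := by
      rintro rfl
      by_cases hs : s = 0
      · exact w.ne_zero (by rw [hw, hs]; ring)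
      · exact (hcase hs).1 rfl
    have h1 : 0 ≤ P.v (s / t) := by
      by_cases hs : s = 0
      · rw [hs, zero_div, P.v_zero]
      · rw [div_eq_mul_inv, P.v_mul _ _ hs (inv_ne_zero ht), P.v_inv]
        have := (hcase hs).2
        omega
    have h3 : P.res ((s / t) ^ 2 + u) = P.res (s / t) ^ 2 + P.res u := by
      rw [P.res_add _ _ (P.nonneg_sq h1) hu.ge, P.res_sq h1]
    refine key ((s / t) ^ 2 + u) t ht (P.nonneg_add (P.nonneg_sq h1) hu.ge) ?_ ?_ ?_
    · rw [h3]
      intro h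
      exact hns ⟨P.res (s / t), by linear_combination -h⟩
    · rw [h3]
      exact ⟨P.res (s / t), 1, by ring⟩
    · rw [hw]
      field_simp

end DiscretePlace

lemma HilbertField.exists_normRel_nonsquare {κ : Type*} [Field κ] (hκ : HilbertField κ)
    (hbig : ManySquareClasses κ) {y : κ} (hy : y ≠ 0) (hns : ¬ IsSquare (-y)) :
    ∃ d, d ≠ 0 ∧ NormRel (-y) d ∧ ¬ IsSquare d ∧ ¬ IsSquare (d * y) := by
  obtain ⟨w, hw, hwN⟩ := hκ.exists_not (-y) (neg_ne_zero.2 hy) hns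
  obtain ⟨u, hu, h1, h2, h3, h4⟩ := hbig y w hy hw
  by_cases huN : NormRel (-y) u
  · exact ⟨u, hu, huN, h1, h2⟩
  · refine ⟨u * w, mul_ne_zero hu hw, hκ.mul_of_not _ _ _ (neg_ne_zero.2 hy) hu hw huN hwN, h3, ?_⟩
    rwa [mul_assoc, mul_comm w y]

namespace DiscretePlace

variable {K κ : Type*} [Field K] [Field κ] (P : DiscretePlace K κ)

lemma nonneg_neg_one : 0 ≤ P.v (-1) := by rw [P.v_neg, P.v_one]

lemma res_neg_one : P.res (-1) = -1 := by
  have := P.res_add 1 (-1) P.nonneg_one P.nonneg_neg_one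
  rw [add_neg_cancel, P.res_zero, P.res_one] at this
  linear_combination -this

lemma rep_unit {y : SqClass K} (hy : y ∈ P.unitClasses) (hy' : sqCl (-1) * y ∉ P.principalClasses) :
    ∃ u : Kˣ, sqCl u = y ∧ P.v u = 0 ∧ P.res u ≠ 0 ∧ ¬ IsSquare (-P.res u) := by
  obtain ⟨u, rfl, hu⟩ := hy
  refine ⟨u, rfl, hu, P.res_ne_zero u.ne_zero hu, fun h => hy' ?_⟩
  have h0 : P.v ((-1 : Kˣ) * u : Kˣ) = 0 := by
    rw [Units.val_mul, Units.val_neg, Units.val_one, neg_one_mul, P.v_neg, hu]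
  have h1 : P.res (-1 * u) = -P.res u := by
    rw [P.res_mul _ _ P.nonneg_neg_one hu.ge, P.res_neg_one, neg_one_mul]
  rw [← sqCl_mul, P.mem_principalClasses h0, Units.val_mul, Units.val_neg, Units.val_one, h1]
  exact h

lemma value_of_res {u : Kˣ} (hu : P.v u = 0) {c : κ} (hc : c ≠ 0)
    (h : NormRel (-P.res u) c) :
    ∃ w : Kˣ, Value (sqCl u) (sqCl w) ∧ P.v w = 0 ∧ P.res w = c := by
  obtain ⟨s, t, rfl⟩ := h
  obtain ⟨s, hs, rfl⟩ := P.res_surj s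
  obtain ⟨t, ht, rfl⟩ := P.res_surj t
  have h1 := P.nonneg_mul hu.ge (P.nonneg_sq ht)
  have h2 : P.res (s ^ 2 + u * t ^ 2) = P.res s ^ 2 - -P.res u * P.res t ^ 2 := by
    rw [P.res_add _ _ (P.nonneg_sq hs) h1, P.res_mul _ _ hu.ge (P.nonneg_sq ht), P.res_sq hs,
      P.res_sq ht]
    ring
  obtain ⟨h3, h4⟩ := P.v_eq_zero_of_res_ne (P.nonneg_add (P.nonneg_sq hs) h1) (h2 ▸ hc)
  exact ⟨Units.mk0 _ h3, value_iff.2 ⟨s, t, rfl⟩, h4, h2⟩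

lemma rigid_of_odd {x : SqClass K} (hx : x ∉ P.unitClasses) (d : SqClass K) (h : Value x d) :
    d ∈ P.principalClasses ∨ d * x ∈ P.principalClasses := by
  obtain ⟨u, rfl⟩ := sqCl_surj x
  obtain ⟨w, rfl⟩ := sqCl_surj d
  obtain ⟨s, t, hw⟩ := value_iff.1 h
  rw [P.mem_unitClasses] at hx
  have hodd := Int.not_even_iff_odd.1 hx
  rw [← sqCl_mul]
  by_cases ht : t = 0
  · exact Or.inl (P.mem_principalClasses_of_eq (r := s) (m := 0) (Or.inl rfl) (by rw [hw, ht]; ring))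
  have hut : P.v (u * t ^ 2) = P.v u + 2 * P.v t := by
    rw [P.v_mul _ _ u.ne_zero (pow_ne_zero 2 ht), P.v_sq]
  have hut0 : (u * t ^ 2 : K) ≠ 0 := mul_ne_zero u.ne_zero (pow_ne_zero 2 ht)
  have hright : s ^ 2 = 0 ∨ (u * t ^ 2 : K) ≠ 0 ∧ P.v (u * t ^ 2) < P.v (s ^ 2) →
      sqCl (w * u) ∈ P.principalClasses := by
    intro h
    refine P.mem_principalClasses_of_eq (r := u * t) (P.pos_div h) ?_
    have hu0 := u.ne_zero
    rw [Units.val_mul, hw]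
    field_simp
    ring
  by_cases hs : s = 0
  · exact Or.inr (hright (Or.inl (by rw [hs]; ring)))
  rcases lt_or_ge (P.v (s ^ 2)) (P.v (u * t ^ 2)) with hlt | hge
  · refine Or.inl (P.mem_principalClasses_of_eq (r := s)
      (P.pos_div (Or.inr ⟨pow_ne_zero 2 hs, hlt⟩)) ?_)
    rw [hw]
    field_simp
  · refine Or.inr (hright (Or.inr ⟨hut0, lt_of_le_of_ne hge fun he => hx ?_⟩))
    rw [hut, P.v_sq] at he
    exact ⟨P.v s - P.v t, by omega⟩

lemma exists_gen (t : SqClass K) (ht : t ∈ P.principalClasses) : ∃ x₁ x₂ d₁ d₂,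
    x₁ ∉ P.unitClasses ∧ x₂ ∉ P.unitClasses ∧ d₁ ∈ P.unitClasses ∧ d₂ ∈ P.unitClasses ∧
      Value x₁ d₁ ∧ Value x₂ d₂ ∧ t = d₁ * d₂ := by
  obtain ⟨u, rfl, hu, hu1⟩ := ht
  have key : ∀ m : K, m ≠ 0 → 0 < P.v m → ¬ Even (P.v m) → ∀ d : Kˣ, (d : K) = 1 + m →
      ∃ x : SqClass K, x ∉ P.unitClasses ∧ sqCl d ∈ P.unitClasses ∧ Value x (sqCl d) := by
    intro m hm hpos hodd d hd
    refine ⟨sqCl (Units.mk0 m hm), ?_, ?_, value_iff.2 ⟨1, 1, by rw [hd]; simp⟩⟩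
    · rwa [P.mem_unitClasses]
    · rw [P.mem_unitClasses, hd, (P.one_add (Or.inr hpos)).2.1]
      exact Even.zero
  obtain ⟨ϖ, hϖ0, hϖ⟩ := P.exists_uniformizer
  have hϖodd : ¬ Even (P.v ϖ) := by rw [hϖ]; decide
  obtain ⟨m, hm⟩ : ∃ m, m = (u : K) - 1 := ⟨_, rfl⟩
  have hum : (u : K) = 1 + m := by rw [hm]; ring
  have hmpos : m = 0 ∨ 0 < P.v m := by
    refine P.pos_of_res ?_ ?_
    · rw [hm, sub_eq_add_neg]
      exact P.nonneg_add hu.ge P.nonneg_neg_one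
    · rw [hm, sub_eq_add_neg, P.res_add _ _ hu.ge P.nonneg_neg_one, hu1, P.res_neg_one, add_neg_cancel]
  by_cases hcase : m ≠ 0 ∧ ¬ Even (P.v m)
  · obtain ⟨x, hx, hd, hv⟩ := key m hcase.1 (hmpos.resolve_left hcase.1) hcase.2 u hum
    refine ⟨x, x, sqCl u, 1, hx, hx, hd, P.unitClasses.one_mem, hv, ?_, (mul_one (sqCl u)).symm⟩
    obtain ⟨w, rfl⟩ := sqCl_surj x
    exact value_iff.2 ⟨1, 0, by simp⟩
  · obtain ⟨h1, h2, h3⟩ := P.one_add (f := ϖ) (Or.inr (by omega))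
    have hvm : m - ϖ ≠ 0 ∧ P.v (m - ϖ) = 1 := by
      by_cases hm0 : m = 0
      · rw [hm0, zero_sub, P.v_neg]
        exact ⟨neg_ne_zero.2 hϖ0, hϖ⟩
      have hme : Even (P.v m) := by
        by_contra h
        exact hcase ⟨hm0, h⟩
      have hpos := hmpos.resolve_left hm0
      obtain ⟨n, hn⟩ := hme
      obtain ⟨h4, h5, h6⟩ := P.one_add (f := -(m / ϖ)) (by
        right
        rw [P.v_neg, div_eq_mul_inv, P.v_mul _ _ hm0 (inv_ne_zero hϖ0), P.v_inv, hϖ]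
        omega)
      have h7 : m - ϖ = -(ϖ * (1 + -(m / ϖ))) := by
        field_simp
        ring
      rw [h7, P.v_neg, P.v_mul _ _ hϖ0 h4, h5, hϖ]
      exact ⟨neg_ne_zero.2 (mul_ne_zero hϖ0 h4), rfl⟩
    have hm' : (m - ϖ) / (1 + ϖ) ≠ 0 := div_ne_zero hvm.1 h1
    have hvm' : P.v ((m - ϖ) / (1 + ϖ)) = 1 := by
      rw [div_eq_mul_inv, P.v_mul _ _ hvm.1 (inv_ne_zero h1), P.v_inv, h2, hvm.2]
      rfl
    have h4 := (P.one_add (f := (m - ϖ) / (1 + ϖ)) (Or.inr (by omega))).1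
    obtain ⟨x₁, hx₁, hd₁, hv₁⟩ := key ϖ hϖ0 (by omega) hϖodd (Units.mk0 _ h1) rfl
    obtain ⟨x₂, hx₂, hd₂, hv₂⟩ := key _ hm' (by omega) (by rw [hvm']; decide) (Units.mk0 _ h4) rfl
    refine ⟨x₁, x₂, _, _, hx₁, hx₂, hd₁, hd₂, hv₁, hv₂, ?_⟩
    rw [← sqCl_mul]
    congr 1
    ext
    rw [hum, Units.val_mul, Units.val_mk0, Units.val_mk0]
    field_simp
    ring

theorem specialPair (hκ : HilbertField κ) (hbig : ManySquareClasses κ) :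
    SpecialPair Value (sqCl (-1)) P.unitClasses P.principalClasses where
  le := by
    rintro _ ⟨u, rfl, hu, -⟩
    exact ⟨u, rfl, hu⟩
  index := by
    intro x y hx hy
    obtain ⟨u, rfl⟩ := sqCl_surj x
    obtain ⟨w, rfl⟩ := sqCl_surj y
    rw [P.mem_unitClasses, Int.not_even_iff_odd] at hx hy
    rw [← sqCl_mul, P.mem_unitClasses, Units.val_mul, P.v_mul _ _ u.ne_zero w.ne_zero]
    exact hx.add_odd hy
  neg_one := by
    rw [P.mem_unitClasses, Units.val_neg, Units.val_one, P.v_neg, P.v_one]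
    exact Even.zero
  rigid := fun x hx d h => P.rigid_of_odd hx d h
  gen := P.exists_gen
  add := by
    intro y hy hy' d hd
    obtain ⟨u, rfl, hu, -, hns⟩ := P.rep_unit hy hy'
    obtain ⟨w, rfl⟩ := sqCl_surj d
    obtain ⟨s, t, hw⟩ := value_iff.1 hd
    obtain ⟨w', h1, h2, -⟩ := P.exists_unit_of_value hu hns hw
    exact ⟨w', h1.symm, h2⟩
  unit := by
    intro y hy hy'
    obtain ⟨u, rfl, hu, hu0, hns⟩ := P.rep_unit hy hy'
    obtain ⟨d, hd0, hd, hd1, hd2⟩ := hκ.exists_normRel_nonsquare hbig hu0 hns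
    obtain ⟨w, hw, hw0, rfl⟩ := P.value_of_res hu hd0 hd
    refine ⟨sqCl w, hw, ?_, ?_⟩
    · rwa [P.mem_principalClasses hw0]
    · have h0 : P.v (w * u : Kˣ) = 0 := by
        rw [Units.val_mul, P.v_mul _ _ w.ne_zero u.ne_zero, hw0, hu, add_zero]
      rwa [← sqCl_mul, P.mem_principalClasses h0, Units.val_mul, P.res_mul _ _ hw0.ge hu.ge]
  index_two := by
    intro y hy hy'
    obtain ⟨u, rfl, hu, hu0, hns⟩ := P.rep_unit hy hy'
    obtain ⟨c, hc0, hc⟩ := hκ.exists_not _ (neg_ne_zero.2 hu0) hns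
    obtain ⟨h, hh, rfl⟩ := P.exists_unit hc0
    refine ⟨sqCl h, ⟨h, rfl, hh⟩, ?_, ?_⟩
    · rintro _ ⟨m, rfl, hm, hm1⟩ d hd heq
      obtain ⟨w, rfl⟩ := sqCl_surj d
      obtain ⟨s, t, hw⟩ := value_iff.1 hd
      obtain ⟨w', h1, h2, h3⟩ := P.exists_unit_of_value hu hns hw
      rw [h1, ← sqCl_mul] at heq
      obtain ⟨r, hr⟩ := sqCl_eq_iff.1 heq.symm
      have hr0 : P.v r = 0 := by
        have := hh
        rw [hr, Units.val_mul, Units.val_mul, Units.val_pow_eq_pow_val,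
          P.v_mul _ _ (mul_ne_zero m.ne_zero w'.ne_zero) (pow_ne_zero 2 r.ne_zero),
          P.v_mul _ _ m.ne_zero w'.ne_zero, P.v_sq, hm, h2] at this
        omega
      apply hc
      have h5 : P.res h = P.res w' * P.res r ^ 2 := by
        rw [hr, Units.val_mul, Units.val_mul, Units.val_pow_eq_pow_val,
          P.res_mul _ _ (P.nonneg_mul hm.ge h2.ge) (P.nonneg_sq hr0.ge), P.res_mul _ _ hm.ge h2.ge,
          hm1, P.res_sq hr0.ge, one_mul]
      rw [h5]
      exact h3.mul (NormRel.sq _ _)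
    · rintro _ ⟨g, rfl, hg⟩
      have hg0 := P.res_ne_zero g.ne_zero hg
      by_cases hgN : NormRel (-P.res u) (P.res g)
      · obtain ⟨w, hw, hw0, hw1⟩ := P.value_of_res hu hg0 hgN
        obtain ⟨t, ht, h1⟩ := P.mem_principalClasses_of_res_eq hg hw0 hw1.symm
        exact ⟨t, ht, sqCl w, hw, Or.inl h1⟩
      · have h2 := hκ.mul_of_not _ _ _ (neg_ne_zero.2 hu0) hg0 hc0 hgN hc
        obtain ⟨w, hw, hw0, hw1⟩ := P.value_of_res hu (mul_ne_zero hg0 hc0) h2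
        have h0 : P.v (g * h : Kˣ) = 0 := by
          rw [Units.val_mul, P.v_mul _ _ g.ne_zero h.ne_zero, hg, hh, add_zero]
        obtain ⟨t, ht, h1⟩ := P.mem_principalClasses_of_res_eq h0 hw0
          (by rw [hw1, Units.val_mul, P.res_mul _ _ hg.ge hh.ge])
        exact ⟨t, ht, sqCl w, hw, Or.inr (by rw [← sqCl_mul, h1])⟩
  nontriv := by
    obtain ⟨c, hc0, h1, h2, -⟩ := hbig (-1) (-1) (neg_ne_zero.2 one_ne_zero)
      (neg_ne_zero.2 one_ne_zero)
    obtain ⟨u, hu, rfl⟩ := P.exists_unit hc0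
    refine ⟨sqCl u, ⟨u, rfl, hu⟩, by rwa [P.mem_principalClasses hu], ?_⟩
    have h0 : P.v ((-1 : Kˣ) * u : Kˣ) = 0 := by
      rw [Units.val_mul, Units.val_neg, Units.val_one, neg_one_mul, P.v_neg, hu]
    rwa [← sqCl_mul, P.mem_principalClasses h0, Units.val_mul, Units.val_neg, Units.val_one,
      P.res_mul _ _ P.nonneg_neg_one hu.ge, P.res_neg_one, mul_comm]

end DiscretePlace

section Coeff

variable {F : Type*} [Field F] {X Y : HahnSeries ℤ F}

lemma HahnSeries.order_mul_nonneg (hX : 0 ≤ X.order) (hY : 0 ≤ Y.order) : 0 ≤ (X * Y).order := by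
  by_cases h0 : X = 0
  · simp [h0]
  by_cases h1 : Y = 0
  · simp [h1]
  rw [HahnSeries.order_mul h0 h1]
  omega

lemma HahnSeries.order_add_nonneg (hX : 0 ≤ X.order) (hY : 0 ≤ Y.order) : 0 ≤ (X + Y).order := by
  by_cases h0 : X + Y = 0
  · simp [h0]
  exact (le_min hX hY).trans (HahnSeries.min_order_le_order_add h0)

lemma HahnSeries.coeff_zero_mul (hX : 0 ≤ X.order) (hY : 0 ≤ Y.order) :
    (X * Y).coeff 0 = X.coeff 0 * Y.coeff 0 := by
  by_cases h0 : X = 0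
  · simp [h0]
  by_cases h1 : Y = 0
  · simp [h1]
  rcases hX.eq_or_lt with hX0 | hX0
  · rcases hY.eq_or_lt with hY0 | hY0
    · have := HahnSeries.coeff_mul_order_add_order X Y
      rwa [HahnSeries.leadingCoeff_eq, HahnSeries.leadingCoeff_eq,
        ← hX0, ← hY0, add_zero] at this
    · rw [HahnSeries.coeff_eq_zero_of_lt_order hY0, mul_zero, HahnSeries.coeff_eq_zero_of_lt_order]
      rw [HahnSeries.order_mul h0 h1]
      omega
  · rw [HahnSeries.coeff_eq_zero_of_lt_order hX0, zero_mul, HahnSeries.coeff_eq_zero_of_lt_order]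
    rw [HahnSeries.order_mul h0 h1]
    omega

lemma HahnSeries.order_inv (X : HahnSeries ℤ F) : X⁻¹.order = -X.order := by
  by_cases h0 : X = 0
  · simp [h0]
  have := HahnSeries.order_mul h0 (inv_ne_zero h0)
  rw [mul_inv_cancel₀ h0, HahnSeries.order_one] at this
  omega

lemma HahnSeries.coeff_zero_eq_zero_iff (h0 : X ≠ 0) (hX : 0 ≤ X.order) :
    X.coeff 0 = 0 ↔ 0 < X.order := by
  refine ⟨fun h => lt_of_le_of_ne hX fun he => ?_, HahnSeries.coeff_eq_zero_of_lt_order⟩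
  rw [he] at h
  exact h0 (HahnSeries.coeff_order_eq_zero.1 h)

end Coeff

section Place

variable {k : Type*} {K : Type*} {F : Type*} [Field k] [Field K] [Field F] [Algebra k K]
  [Algebra k F] (φ : K →+* HahnSeries ℤ F)

/-- The residue field of a place, inside the field of coefficients. -/
def placeResidueField (hφ : ∀ c, φ (algebraMap k K c) = HahnSeries.C (algebraMap k F c)) :
    IntermediateField k F where
  carrier := {c | ∃ f, 0 ≤ (φ f).order ∧ (φ f).coeff 0 = c}
  mul_mem' := by
    rintro _ _ ⟨f, hf, rfl⟩ ⟨g, hg, rfl⟩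
    refine ⟨f * g, ?_, ?_⟩
    · rw [map_mul]
      exact HahnSeries.order_mul_nonneg hf hg
    · rw [map_mul, HahnSeries.coeff_zero_mul hf hg]
  add_mem' := by
    rintro _ _ ⟨f, hf, rfl⟩ ⟨g, hg, rfl⟩
    refine ⟨f + g, ?_, ?_⟩
    · rw [map_add]
      exact HahnSeries.order_add_nonneg hf hg
    · rw [map_add, HahnSeries.coeff_add]
  algebraMap_mem' := by
    intro c
    refine ⟨algebraMap k K c, ?_, ?_⟩
    · rw [hφ, HahnSeries.order_C]
    · rw [hφ, HahnSeries.C_apply, HahnSeries.coeff_single_same]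
  inv_mem' := by
    rintro _ ⟨f, hf, rfl⟩
    by_cases h0 : (φ f).coeff 0 = 0
    · exact ⟨0, by simp, by simp [h0]⟩
    have h1 : (φ f).order = 0 := le_antisymm (HahnSeries.order_le_of_coeff_ne_zero h0) hf
    have h2 : (φ f⁻¹).order = 0 := by rw [map_inv₀, HahnSeries.order_inv, h1, neg_zero]
    have h3 : φ f ≠ 0 := by
      intro h
      exact h0 (by rw [h]; rfl)
    refine ⟨f⁻¹, h2.ge, eq_inv_of_mul_eq_one_right ?_⟩
    rw [← HahnSeries.coeff_zero_mul hf h2.ge, ← map_mul, mul_inv_cancel₀ ((map_ne_zero φ).1 h3),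
      map_one, HahnSeries.coeff_one, if_pos rfl]

theorem exists_discretePlace
    (hφ : ∀ c, φ (algebraMap k K c) = HahnSeries.C (algebraMap k F c))
    (hodd : ∃ f, ¬ Even (φ f).order) :
    ∃ P : DiscretePlace K (placeResidueField φ hφ), ∀ f, Even (P.v f) → Even (φ f).order := by
  have hne : ∀ {f}, f ≠ 0 → φ f ≠ 0 := fun h => (map_ne_zero φ).2 h
  let G : AddSubgroup ℤ :=
    { carrier := {n | ∃ f, f ≠ 0 ∧ (φ f).order = n}
      add_mem' := by
        rintro _ _ ⟨f, hf, rfl⟩ ⟨g, hg, rfl⟩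
        exact ⟨f * g, mul_ne_zero hf hg, by rw [map_mul, HahnSeries.order_mul (hne hf) (hne hg)]⟩
      zero_mem' := ⟨1, one_ne_zero, by simp⟩
      neg_mem' := by
        rintro _ ⟨f, hf, rfl⟩
        exact ⟨f⁻¹, inv_ne_zero hf, by rw [map_inv₀, HahnSeries.order_inv]⟩ }
  obtain ⟨m, hm⟩ := Int.subgroup_cyclic G
  have hG : ∀ f, ∃ n, (φ f).order = m * n := by
    intro f
    have h1 : (φ f).order ∈ G := by
      by_cases hf : f = 0
      · exact ⟨1, one_ne_zero, by simp [hf]⟩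
      · exact ⟨f, hf, rfl⟩
    rw [hm, AddSubgroup.mem_closure_singleton] at h1
    obtain ⟨n, hn⟩ := h1
    exact ⟨n, by rw [← hn, smul_eq_mul, mul_comm]⟩
  have hm0 : m ≠ 0 := by
    rintro rfl
    obtain ⟨f, hf⟩ := hodd
    obtain ⟨n, hn⟩ := hG f
    exact hf (by rw [hn, zero_mul]; exact Even.zero)
  have hmG : (|m|) ∈ G := by
    have : m ∈ G := hm ▸ AddSubgroup.mem_closure_singleton_self m
    rcases abs_choice m with h | h
    · rwa [h]
    · rw [h]; exact G.neg_mem this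
  obtain ⟨M, hM⟩ : ∃ M, M = |m| := ⟨_, rfl⟩
  have hMpos : 0 < M := hM ▸ abs_pos.2 hm0
  have hv : ∀ f, ∃ n, (φ f).order = M * n := by
    intro f
    obtain ⟨n, hn⟩ := hG f
    have : M ∣ (φ f).order := by rw [hM, abs_dvd]; exact ⟨n, hn⟩
    exact this
  choose v hv using hv
  rw [← hM] at hmG
  obtain ⟨ϖ, hϖ0, hϖ⟩ := hmG
  have hnn : ∀ f, 0 ≤ v f ↔ 0 ≤ (φ f).order := fun f => by rw [hv, mul_nonneg_iff_of_pos_left hMpos]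
  have hpos : ∀ f, 0 < v f ↔ 0 < (φ f).order := fun f => by rw [hv, mul_pos_iff_of_pos_left hMpos]
  classical
  let res : K → placeResidueField φ hφ := fun f =>
    if h : 0 ≤ (φ f).order then ⟨(φ f).coeff 0, f, h, rfl⟩ else 0
  have hres : ∀ f, 0 ≤ v f → (res f : F) = (φ f).coeff 0 := fun f hf => by
    simp only [res, dif_pos ((hnn f).1 hf)]
  have hmul : ∀ f g, 0 ≤ v f → 0 ≤ v g → 0 ≤ v (f * g) := fun f g hf hg => by
    rw [hnn] at hf hg ⊢
    rw [map_mul]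
    exact HahnSeries.order_mul_nonneg hf hg
  have hadd : ∀ f g, 0 ≤ v f → 0 ≤ v g → 0 ≤ v (f + g) := fun f g hf hg => by
    rw [hnn] at hf hg ⊢
    rw [map_add]
    exact HahnSeries.order_add_nonneg hf hg
  refine ⟨⟨v, res, ?_, ?_, ?_, ?_, ?_, ?_, ?_, ?_, ?_⟩, fun f (hf : Even (v f)) => ?_⟩
  · have := hv 0
    rw [map_zero, HahnSeries.order_zero, zero_eq_mul] at this
    exact this.resolve_left hMpos.ne'
  · intro f g hf hg
    have := HahnSeries.order_mul (hne hf) (hne hg)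
    rw [← map_mul, hv, hv, hv, ← mul_add] at this
    exact mul_left_cancel₀ hMpos.ne' this
  · intro f g hfg
    have h1 : φ f + φ g ≠ 0 := by rw [← map_add]; exact hne hfg
    have := HahnSeries.min_order_le_order_add h1
    rw [← map_add, hv, hv, hv, ← mul_min_of_nonneg _ _ hMpos.le] at this
    exact le_of_mul_le_mul_left this hMpos
  · have h1 : 0 ≤ v 1 := (hnn 1).2 (by simp)
    apply Subtype.ext
    rw [hres 1 h1, map_one, HahnSeries.coeff_one, if_pos rfl]
    rfl
  · intro f g hf hg
    apply Subtype.ext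
    rw [hres _ (hmul f g hf hg), map_mul,
      HahnSeries.coeff_zero_mul ((hnn f).1 hf) ((hnn g).1 hg), ← hres f hf, ← hres g hg]
    rfl
  · intro f g hf hg
    apply Subtype.ext
    rw [hres _ (hadd f g hf hg), map_add, HahnSeries.coeff_add, ← hres f hf, ← hres g hg]
    rfl
  · intro f hf0 hf
    rw [hpos, ← HahnSeries.coeff_zero_eq_zero_iff (hne hf0) ((hnn f).1 hf), ← hres f hf]
    exact ZeroMemClass.coe_eq_zero.symm
  · rintro ⟨_, f, hf, rfl⟩
    exact ⟨f, (hnn f).2 hf, Subtype.ext (hres f ((hnn f).2 hf))⟩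
  · refine ⟨ϖ, hϖ0, mul_left_cancel₀ hMpos.ne' ?_⟩
    rw [← hv, hϖ, mul_one]
  · rw [hv]
    exact Even.mul_left hf M

end Place

theorem even_order_of_mem_specialCore {k : Type*} {K : Type*} [Field k] [Field K] [Algebra k K]
    [Algebra ℚ_[2] k] [FiniteDimensional ℚ_[2] k] {F : Type*} [Field F] [Algebra k F]
    [FiniteDimensional k F] (φ : K →+* HahnSeries ℤ F)
    (hφ : ∀ c, φ (algebraMap k K c) = HahnSeries.C (algebraMap k F c)) {u : Kˣ}
    (hu : sqCl u ∈ specialCore K) : Even (φ u).order := by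
  by_contra hodd
  obtain ⟨P, hP⟩ := exists_discretePlace φ hφ ⟨_, hodd⟩
  let κ := placeResidueField φ hφ
  let _ : Algebra ℚ_[2] κ := ((algebraMap k κ).comp (algebraMap ℚ_[2] k)).toAlgebra
  have : IsScalarTower ℚ_[2] k κ := IsScalarTower.of_algebraMap_eq fun _ => rfl
  have : FiniteDimensional ℚ_[2] κ := FiniteDimensional.trans ℚ_[2] k κ
  have h := P.specialPair (hilbertField_local 2 κ) (manySquareClasses_of_two κ)
  exact hodd (hP _ (P.mem_unitClasses.1 (hu _ _ h)))

theorem ConicCoords.exists_of_mem_specialCore {k : Type u} {K : Type v} [Field k] [Field K]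
    [Algebra k K] [Algebra ℚ_[2] k] [FiniteDimensional ℚ_[2] k] {a b : k} {x y : K}
    (h : ConicCoords a b x y) {u : Kˣ} (hu : sqCl u ∈ specialCore K) :
    ∃ c : kˣ, sqCl u = sqCl (Units.map (algebraMap k K) c) := by
  have : CharZero k := charZero_of_injective_algebraMap (algebraMap ℚ_[2] k).injective
  obtain ⟨c, r, hcr⟩ := h.exists_of_evenEverywhere u.ne_zero
    (fun F _ _ _ φ hφ => even_order_of_mem_specialCore φ hφ hu)
  have hc : c ≠ 0 := by
    rintro rfl
    exact u.ne_zero (by rw [hcr]; simp)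
  have hr : r ≠ 0 := by
    rintro rfl
    exact u.ne_zero (by rw [hcr]; simp)
  refine ⟨Units.mk0 c hc, (sqCl_eq_iff.2 ⟨Units.mk0 r hr, Units.ext hcr⟩).symm⟩

/-- The map of square class groups induced by a field homomorphism. -/
def sqMap {K L : Type*} [Field K] [Field L] (φ : K →+* L) : SqClass K →* SqClass L :=
  QuotientGroup.map _ _ (Units.map (φ : K →* L)) (by
    rintro _ ⟨r, rfl⟩
    exact ⟨Units.map (φ : K →* L) r, (map_pow _ r 2).symm⟩)

lemma sqMap_sqCl {K L : Type*} [Field K] [Field L] (φ : K →+* L) (u : Kˣ) :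
    sqMap φ (sqCl u) = sqCl (Units.map (φ : K →* L) u) := rfl

lemma sqMap_symm_sqMap {K L : Type*} [Field K] [Field L] (σ : K ≃+* L) (y : SqClass K) :
    sqMap (σ.symm : L →+* K) (sqMap (σ : K →+* L) y) = y := by
  obtain ⟨u, rfl⟩ := sqCl_surj y
  rw [sqMap_sqCl, sqMap_sqCl]
  congr 1
  ext
  exact σ.symm_apply_apply u

/-- The isomorphism of square class groups induced by a field isomorphism. -/
def sqMapEquiv {K L : Type*} [Field K] [Field L] (σ : K ≃+* L) : SqClass K ≃* SqClass L where
  toFun := sqMap (σ : K →+* L)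
  invFun := sqMap (σ.symm : L →+* K)
  left_inv := sqMap_symm_sqMap σ
  right_inv := sqMap_symm_sqMap σ.symm
  map_mul' := map_mul _

lemma exists_represents_of_sqCl_eq {K : Type*} [Field K] {a b c a' b' c' : Kˣ}
    (ha : sqCl a = sqCl a') (hb : sqCl b = sqCl b') (hc : sqCl c = sqCl c')
    (h : ∃ x y : K, (c : K) = a * x ^ 2 + b * y ^ 2) :
    ∃ x y : K, (c' : K) = a' * x ^ 2 + b' * y ^ 2 := by
  obtain ⟨r, rfl⟩ := sqCl_eq_iff.1 ha.symm
  obtain ⟨s, rfl⟩ := sqCl_eq_iff.1 hb.symm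
  obtain ⟨t, rfl⟩ := sqCl_eq_iff.1 hc
  obtain ⟨x, y, h⟩ := h
  refine ⟨r * t * x, s * t * y, ?_⟩
  push_cast at h ⊢
  rw [h]
  ring

lemma isWittEquiv_sqMapEquiv {K L : Type*} [Field K] [Field L] (σ : K ≃+* L) :
    IsWittEquiv (sqMapEquiv σ) where
  map_neg_one := by
    change sqMap _ (sqCl (-1)) = _
    rw [sqMap_sqCl]
    congr 1
    ext
    simp
  represents := by
    intro a b c a' b' c' ha hb hc
    change sqCl _ = _ at ha hb hc
    constructor
    · rintro ⟨x, y, h⟩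
      refine exists_represents_of_sqCl_eq ha hb hc ⟨σ x, σ y, ?_⟩
      simp [h]
    · intro h
      obtain ⟨x, y, h⟩ := exists_represents_of_sqCl_eq ha.symm hb.symm hc.symm h
      refine ⟨σ.symm x, σ.symm y, σ.injective ?_⟩
      simpa using h

namespace ConicCoords

variable {k : Type u} {K : Type v} [Field k] [Field K] [Algebra k K] {a b : k} {x y : K}
  (h : ConicCoords a b x y)
include h

lemma isAlgebraic_y (X Y : K) (heq : algebraMap k K a * X ^ 2 + algebraMap k K b * Y ^ 2 = 1)
    (hX : IsAlgebraic k X) : IsAlgebraic k Y := by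
  have hb : algebraMap k K b ≠ 0 := (map_ne_zero _).2 h.b_ne
  refine IsAlgebraic.of_pow two_pos ?_
  have h1 : Y ^ 2 = (algebraMap k K b)⁻¹ * (1 - algebraMap k K a * X ^ 2) := by
    field_simp
    linear_combination heq
  rw [h1]
  exact (isAlgebraic_algebraMap b).inv.mul
    (isAlgebraic_one.sub ((isAlgebraic_algebraMap a).mul (hX.pow 2)))

lemma exists_involution {X Y : K}
    (heq : algebraMap k K a * X ^ 2 + algebraMap k K b * Y ^ 2 = 1)
    (halg : IsAlgebraic k X → IsAlgebraic k Y → IsAlgebraic k x)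
    (hback : ∀ j : K →ₐ[k] K, j x = X → j y = Y → j X = x ∧ j Y = y) :
    ∃ σ : K ≃ₐ[k] K, (∀ z, σ (σ z) = z) ∧ σ x = X ∧ σ y = Y := by
  have htr : Transcendental k X := fun hX =>
    h.transcendental (halg hX (h.isAlgebraic_y X Y heq hX))
  obtain ⟨j, hjx, hjy⟩ := h.exists_lift heq htr
  obtain ⟨h1, h2⟩ := hback j hjx hjy
  have hjj : j.comp j = AlgHom.id k K := h.hom_ext (by simp [hjx, h1]) (by simp [hjy, h2])
  exact ⟨AlgEquiv.ofAlgHom j j hjj hjj, fun z => DFunLike.congr_fun hjj z, hjx, hjy⟩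

lemma exists_reflection {u w : k} (huw : u ^ 2 + a * b * w ^ 2 = 1) :
    ∃ σ : K ≃ₐ[k] K, (∀ z, σ (σ z) = z) ∧
      σ x = algebraMap k K u * x + algebraMap k K (b * w) * y ∧
      σ y = algebraMap k K (a * w) * x - algebraMap k K u * y := by
  have huw' : algebraMap k K u ^ 2 + algebraMap k K a * algebraMap k K b * algebraMap k K w ^ 2
      = 1 := by
    rw [← map_pow, ← map_mul, ← map_pow, ← map_mul, ← map_add, huw, map_one]
  refine h.exists_involution ?_ ?_ ?_
  · have := h.eq
    simp only [map_mul]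
    linear_combination (algebraMap k K u ^ 2 +
      algebraMap k K a * algebraMap k K b * algebraMap k K w ^ 2) * this + huw'
  · intro h1 h2
    have h3 : x = algebraMap k K u * (algebraMap k K u * x + algebraMap k K (b * w) * y) +
        algebraMap k K (b * w) * (algebraMap k K (a * w) * x - algebraMap k K u * y) := by
      simp only [map_mul]
      linear_combination -x * huw'
    rw [h3]
    exact ((isAlgebraic_algebraMap u).mul h1).add ((isAlgebraic_algebraMap _).mul h2)
  · intro j hx hy
    simp only [map_add, map_sub, map_mul, AlgHom.commutes, hx, hy]
    constructor
    · linear_combination x * huw'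
    · linear_combination y * huw'

lemma exists_reflection_of_ne {γ : k} (hγ : γ ≠ 0) (hQ : a - γ ^ 2 ≠ 0) :
    ∃ σ : K ≃ₐ[k] K, (∀ z, σ (σ z) = z) ∧
      σ x * (algebraMap k K (a + γ ^ 2) - algebraMap k K (2 * γ * a) * x) =
        algebraMap k K (2 * γ) - algebraMap k K (a + γ ^ 2) * x := by
  obtain ⟨s, hs⟩ : ∃ s, s = algebraMap k K (a + γ ^ 2) := ⟨_, rfl⟩
  obtain ⟨e, he⟩ : ∃ e, e = algebraMap k K (2 * γ * a) := ⟨_, rfl⟩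
  obtain ⟨c, hc⟩ : ∃ c, c = algebraMap k K (2 * γ) := ⟨_, rfl⟩
  obtain ⟨Q, hQK⟩ : ∃ Q, Q = algebraMap k K (a - γ ^ 2) := ⟨_, rfl⟩
  have hQ0 : Q ≠ 0 := hQK ▸ (map_ne_zero _).2 hQ
  have he0 : e ≠ 0 := he ▸ (map_ne_zero _).2 (mul_ne_zero (mul_ne_zero h.two_ne hγ) h.a_ne)
  have hrel : s ^ 2 - c * e = Q ^ 2 := by
    rw [hs, he, hc, hQK, ← map_pow, ← map_pow, ← map_mul, ← map_sub]
    congr 1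
    ring
  have hac : algebraMap k K a * c = e := by
    rw [hc, he, ← map_mul]
    congr 1
    ring
  have has : algebraMap k K a * c ^ 2 + Q ^ 2 = s ^ 2 := by
    linear_combination c * hac - hrel
  obtain ⟨D, hDx⟩ : ∃ D, D = s - e * x := ⟨_, rfl⟩
  have hD : D ≠ 0 := by
    intro h0
    have h1 : x = s * e⁻¹ := by
      field_simp
      linear_combination hDx - h0
    apply h.transcendental
    rw [h1, hs, he]
    exact (isAlgebraic_algebraMap _).mul (isAlgebraic_algebraMap _).inv
  have hback : s - e * ((c - s * x) / D) = Q ^ 2 / D := by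
    field_simp
    linear_combination hrel + s * hDx
  have hx : (c - s * ((c - s * x) / D)) / (s - e * ((c - s * x) / D)) = x := by
    rw [hback, div_eq_iff (div_ne_zero (pow_ne_zero 2 hQ0) hD)]
    field_simp
    linear_combination x * hrel + c * hDx
  suffices hσ : ∃ σ : K ≃ₐ[k] K, (∀ z, σ (σ z) = z) ∧ σ x = (c - s * x) / D ∧
      σ y = Q * y / D by
    obtain ⟨σ, h1, h2, -⟩ := hσ
    refine ⟨σ, h1, ?_⟩
    rw [h2, ← hs, ← he, ← hc, ← hDx, div_mul_cancel₀ _ hD]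
  refine h.exists_involution ?_ ?_ ?_
  · have h3 := h.eq
    field_simp
    rw [hDx]
    linear_combination Q ^ 2 * h3 + has - 2 * s * x * hac + algebraMap k K a * x ^ 2 * hrel
      + e * x ^ 2 * hac
  · intro h3 _
    rw [← hx]
    have hsa : IsAlgebraic k s := hs ▸ isAlgebraic_algebraMap _
    have hea : IsAlgebraic k e := he ▸ isAlgebraic_algebraMap _
    have hca : IsAlgebraic k c := hc ▸ isAlgebraic_algebraMap _
    rw [div_eq_mul_inv]
    exact (hca.sub (hsa.mul h3)).mul (hsa.sub (hea.mul h3)).inv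
  · intro j hjx hjy
    have hjs : j s = s := by rw [hs, j.commutes]
    have hje : j e = e := by rw [he, j.commutes]
    have hjc : j c = c := by rw [hc, j.commutes]
    have hjQ : j Q = Q := by rw [hQK, j.commutes]
    have hjD : j D = s - e * ((c - s * x) / D) := by rw [hDx, map_sub, map_mul, hjs, hje, hjx, hDx]
    simp only [map_div₀, map_sub, map_mul, hjs, hjc, hjQ, hjD, hjx, hjy]
    refine ⟨hx, ?_⟩
    rw [hback]
    field_simp

end ConicCoords

section PlacePolynomial

variable {k K F : Type*} [Field k] [Field K] [Field F] [Algebra k K] [Algebra k F]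
  {φ : K →+* HahnSeries ℤ F} (hφ : ∀ c, φ (algebraMap k K c) = HahnSeries.C (algebraMap k F c))
include hφ

lemma order_algebraMap (c : k) : (φ (algebraMap k K c)).order = 0 := by
  rw [hφ, HahnSeries.order_C]

lemma coeff_zero_algebraMap (c : k) : (φ (algebraMap k K c)).coeff 0 = algebraMap k F c := by
  rw [hφ, HahnSeries.C_apply, HahnSeries.coeff_single_same]

lemma order_coeff_aeval {x : K} (hx : 0 ≤ (φ x).order) (p : Polynomial k) :
    0 ≤ (φ (Polynomial.aeval x p)).order ∧
      (φ (Polynomial.aeval x p)).coeff 0 = Polynomial.aeval ((φ x).coeff 0) p := by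
  induction p using Polynomial.induction_on with
  | C c =>
    rw [Polynomial.aeval_C, Polynomial.aeval_C]
    exact ⟨(order_algebraMap hφ c).ge, coeff_zero_algebraMap hφ c⟩
  | add p q hp hq =>
    rw [map_add, map_add, map_add]
    exact ⟨HahnSeries.order_add_nonneg hp.1 hq.1, by rw [HahnSeries.coeff_add, hp.2, hq.2]⟩
  | monomial n c ih =>
    have hsucc : ∀ z : F, Polynomial.aeval z (Polynomial.C c * Polynomial.X ^ (n + 1)) =
        Polynomial.aeval z (Polynomial.C c * Polynomial.X ^ n) * z := fun z => by
      rw [pow_succ, ← mul_assoc, map_mul (Polynomial.aeval z) _ Polynomial.X, Polynomial.aeval_X]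
    have hsucc' : Polynomial.aeval x (Polynomial.C c * Polynomial.X ^ (n + 1)) =
        Polynomial.aeval x (Polynomial.C c * Polynomial.X ^ n) * x := by
      rw [pow_succ, ← mul_assoc, map_mul (Polynomial.aeval x) _ Polynomial.X, Polynomial.aeval_X]
    rw [hsucc, hsucc', map_mul]
    exact ⟨HahnSeries.order_mul_nonneg ih.1 hx, by rw [HahnSeries.coeff_zero_mul ih.1 hx, ih.2]⟩

end PlacePolynomial

lemma quadratic_coeffs_eq_zero {F : Type*} [Field F] {A B D : F}
    (h : Polynomial.C A * Polynomial.X ^ 2 + Polynomial.C B * Polynomial.X + Polynomial.C D = 0) :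
    A = 0 ∧ B = 0 ∧ D = 0 := by
  refine ⟨?_, ?_, ?_⟩
  · simpa [Polynomial.coeff_C, Polynomial.coeff_X] using
      congrArg (fun p => Polynomial.coeff p 2) h
  · simpa [Polynomial.coeff_C, Polynomial.coeff_X] using
      congrArg (fun p => Polynomial.coeff p 1) h
  · simpa using congrArg (fun p => Polynomial.coeff p 0) h

lemma finite_rotation_roots {k F : Type*} [Field k] [Field F] [Algebra k F] {a b : k}
    (ha : a ≠ 0) (hb : b ≠ 0) (h2 : (2 : k) ≠ 0) {x₀ y₀ : F}
    (h0 : algebraMap k F a * x₀ ^ 2 + algebraMap k F b * y₀ ^ 2 = 1) (ξ : F) :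
    {m : k | algebraMap k F (1 - a * b * m ^ 2) * x₀ + algebraMap k F (2 * b * m) * y₀ =
      ξ * algebraMap k F (1 + a * b * m ^ 2)}.Finite := by
  let P : Polynomial F := Polynomial.C (algebraMap k F (a * b) * (ξ + x₀)) * Polynomial.X ^ 2 +
    Polynomial.C (-(algebraMap k F (2 * b) * y₀)) * Polynomial.X + Polynomial.C (ξ - x₀)
  have hP : P ≠ 0 := by
    intro hP
    obtain ⟨hc2, hc1, hc0⟩ := quadratic_coeffs_eq_zero hP
    rw [neg_eq_zero] at hc1
    have hy := (mul_eq_zero.1 hc1).resolve_left ((map_ne_zero _).2 (mul_ne_zero h2 hb))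
    have hx := (mul_eq_zero.1 hc2).resolve_left ((map_ne_zero _).2 (mul_ne_zero ha hb))
    have h2F : (2 : F) ≠ 0 := by
      have := (map_ne_zero (algebraMap k F)).2 h2
      rwa [map_ofNat] at this
    have hx0 : x₀ = 0 := (mul_eq_zero.1 (by linear_combination hx - hc0 : 2 * x₀ = 0)).resolve_left h2F
    rw [hx0, hy] at h0
    simp at h0
  refine Set.Finite.subset ((Polynomial.rootSet_finite P F).preimage
    (algebraMap k F).injective.injOn) fun m (hm : _ = _) => ?_
  rw [Set.mem_preimage, Polynomial.mem_rootSet]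
  refine ⟨hP, ?_⟩
  simp only [P, map_add, map_mul, Polynomial.aeval_C, Polynomial.aeval_X, map_pow, Algebra.algebraMap_self,
    RingHom.id_apply]
  simp only [map_add, map_sub, map_mul, map_pow, map_one] at hm ⊢
  linear_combination -hm

lemma finite_rotation_aeval {k F : Type*} [Field k] [Field F] [Algebra k F] {a b : k}
    (ha : a ≠ 0) (hb : b ≠ 0) (h2 : (2 : k) ≠ 0) {x₀ y₀ : F}
    (h0 : algebraMap k F a * x₀ ^ 2 + algebraMap k F b * y₀ ^ 2 = 1) {R : Polynomial k}
    (hR : R ≠ 0) :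
    {m : k | 1 + a * b * m ^ 2 ≠ 0 ∧ Polynomial.aeval
      (algebraMap k F ((1 - a * b * m ^ 2) / (1 + a * b * m ^ 2)) * x₀ +
        algebraMap k F (b * (2 * m / (1 + a * b * m ^ 2))) * y₀) R = 0}.Finite := by
  refine Set.Finite.subset ((Polynomial.rootSet_finite R F).biUnion
    fun ξ _ => finite_rotation_roots ha hb h2 h0 ξ) ?_
  rintro m ⟨hm, hroot⟩
  refine Set.mem_biUnion (Polynomial.mem_rootSet.2 ⟨hR, hroot⟩) ?_
  have hm' : algebraMap k F (1 + a * b * m ^ 2) ≠ 0 := (map_ne_zero _).2 hm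
  change _ = _ * _
  rw [mul_div_assoc', map_div₀, map_div₀]
  field_simp

namespace ConicCoords

variable {k : Type u} {K : Type v} [Field k] [Field K] [Algebra k K] {a b : k} {x y : K}
  (h : ConicCoords a b x y)
include h

section

variable {F : Type*} [Field F] [Algebra k F] {φ : K →+* HahnSeries ℤ F}
  (hφ : ∀ c, φ (algebraMap k K c) = HahnSeries.C (algebraMap k F c))
include hφ

lemma order_y_nonneg (hx : 0 ≤ (φ x).order) : 0 ≤ (φ y).order := by
  by_cases hy : φ y = 0
  · rw [hy, HahnSeries.order_zero]
  have hb : φ (algebraMap k K b) ≠ 0 := (map_ne_zero _).2 ((map_ne_zero _).2 h.b_ne)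
  have h1 : algebraMap k K b * y ^ 2 = Polynomial.aeval x (1 - Polynomial.C a * Polynomial.X ^ 2) := by
    simp only [map_sub, map_one, map_mul, map_pow, Polynomial.aeval_C, Polynomial.aeval_X]
    linear_combination h.eq
  have h2 := (order_coeff_aeval hφ hx (1 - Polynomial.C a * Polynomial.X ^ 2)).1
  rw [← h1, map_mul, map_pow, HahnSeries.order_mul hb (pow_ne_zero 2 hy), order_algebraMap hφ,
    HahnSeries.order_pow, zero_add, two_nsmul] at h2
  omega

lemma residue_eq (hx : 0 ≤ (φ x).order) :
    algebraMap k F a * (φ x).coeff 0 ^ 2 + algebraMap k F b * (φ y).coeff 0 ^ 2 = 1 := by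
  have hy := h.order_y_nonneg hφ hx
  have h1 := congrArg (fun z => (φ z).coeff 0) h.eq
  simp only [pow_two, map_add, map_mul, map_one, HahnSeries.coeff_add, HahnSeries.coeff_one,
    if_true] at h1
  rwa [HahnSeries.coeff_zero_mul (order_algebraMap hφ a).ge (HahnSeries.order_mul_nonneg hx hx),
    HahnSeries.coeff_zero_mul (order_algebraMap hφ b).ge (HahnSeries.order_mul_nonneg hy hy),
    HahnSeries.coeff_zero_mul hx hx, HahnSeries.coeff_zero_mul hy hy, coeff_zero_algebraMap hφ,
    coeff_zero_algebraMap hφ, ← pow_two, ← pow_two] at h1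

end

lemma exists_polynomial_of_odd {g : K} (hg : g ≠ 0) : ∃ R : Polynomial k, R ≠ 0 ∧
    ∀ (F : Type u) [Field F] [Algebra k F] (φ : K →+* HahnSeries ℤ F),
      (∀ c, φ (algebraMap k K c) = HahnSeries.C (algebraMap k F c)) → 0 ≤ (φ x).order →
      ¬ Even (φ g).order → Polynomial.aeval ((φ x).coeff 0) R = 0 := by
  obtain ⟨p, q, r, hr, hz⟩ := h.gen g
  obtain ⟨N, hN⟩ : ∃ N : Polynomial k, N = Polynomial.C b * p ^ 2 -
    (1 - Polynomial.C a * Polynomial.X ^ 2) * q ^ 2 := ⟨_, rfl⟩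
  have hf : Polynomial.aeval x p + Polynomial.aeval x q * y ≠ 0 := by
    rw [← hz]
    exact mul_ne_zero hg (h.aeval_ne_zero hr)
  have hN0 : N ≠ 0 := by
    intro h0
    have h1 : Polynomial.aeval x N = algebraMap k K b *
        ((Polynomial.aeval x p + Polynomial.aeval x q * y) *
          (Polynomial.aeval x p + Polynomial.aeval x (-q) * y)) := by
      rw [hN]
      simp only [map_sub, map_neg, map_one, map_mul, map_pow, Polynomial.aeval_C, Polynomial.aeval_X]
      linear_combination (Polynomial.aeval x q) ^ 2 * h.eq
    rw [h0, map_zero, eq_comm, mul_eq_zero, mul_eq_zero] at h1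
    obtain ⟨h2, h3⟩ := h.indep ((h1.resolve_left ((map_ne_zero _).2 h.b_ne)).resolve_left hf)
    rw [neg_eq_zero] at h3
    exact hf (by rw [h2, h3]; simp)
  refine ⟨r * N, mul_ne_zero hr hN0, fun F _ _ φ hφ hx hodd => ?_⟩
  have hy := h.order_y_nonneg hφ hx
  obtain ⟨hr1, hr2⟩ := order_coeff_aeval hφ hx r
  obtain ⟨hp1, hp2⟩ := order_coeff_aeval hφ hx p
  obtain ⟨hq1, hq2⟩ := order_coeff_aeval hφ hx q
  have hqy := HahnSeries.order_mul_nonneg hq1 hy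
  have hr0 : φ (Polynomial.aeval x r) ≠ 0 := (map_ne_zero φ).2 (h.aeval_ne_zero hr)
  have hf0 : φ (Polynomial.aeval x p + Polynomial.aeval x q * y) ≠ 0 := (map_ne_zero φ).2 hf
  have hf1 : 0 ≤ (φ (Polynomial.aeval x p + Polynomial.aeval x q * y)).order := by
    rw [map_add, map_mul]
    exact HahnSeries.order_add_nonneg hp1 hqy
  have hord := HahnSeries.order_mul ((map_ne_zero φ).2 hg) hr0
  rw [← map_mul, hz] at hord
  rw [map_mul]
  by_cases hcase : (φ (Polynomial.aeval x r)).coeff 0 = 0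
  · rw [← hr2, hcase, zero_mul]
  have hr3 : (φ (Polynomial.aeval x r)).order = 0 :=
    le_antisymm (HahnSeries.order_le_of_coeff_ne_zero hcase) hr1
  have hpos : 0 < (φ (Polynomial.aeval x p + Polynomial.aeval x q * y)).order := by
    refine lt_of_le_of_ne hf1 fun he => hodd ?_
    rw [hr3, ← he, add_zero] at hord
    rw [← hord]
    exact Even.zero
  have h1 := HahnSeries.coeff_eq_zero_of_lt_order hpos
  rw [map_add, map_mul, HahnSeries.coeff_add, HahnSeries.coeff_zero_mul hq1 hy, hp2, hq2] at h1
  have h2 := h.residue_eq hφ hx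
  have h3 : Polynomial.aeval ((φ x).coeff 0) N = 0 := by
    rw [hN]
    simp only [map_sub, map_one, map_mul, map_pow, Polynomial.aeval_C, Polynomial.aeval_X]
    linear_combination (Polynomial.aeval ((φ x).coeff 0) q) ^ 2 * h2 +
      algebraMap k F b * (Polynomial.aeval ((φ x).coeff 0) p -
        Polynomial.aeval ((φ x).coeff 0) q * (φ y).coeff 0) * h1
  rw [h3, mul_zero]

lemma even_of_finite_of_nonneg [Infinite k] {B : Set (SqClass K)} (hB : B.Finite)
    (hinv : ∀ σ : K ≃ₐ[k] K, ∀ y ∈ B, sqMap (σ : K →+* K) y ∈ B) {F : Type u} [Field F] [Algebra k F]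
    {φ : K →+* HahnSeries ℤ F} (hφ : ∀ c, φ (algebraMap k K c) = HahnSeries.C (algebraMap k F c))
    (hx : 0 ≤ (φ x).order) {u : Kˣ} (hu : sqCl u ∈ B) : Even (φ u).order := by
  by_contra hodd
  have hy := h.order_y_nonneg hφ hx
  have hres := h.residue_eq hφ hx
  have hab := mul_ne_zero h.a_ne h.b_ne
  let M := {m : k // 1 + a * b * m ^ 2 ≠ 0}
  have hM : Infinite M := by
    have hfin : {m : k | 1 + a * b * m ^ 2 = 0}.Finite := by
      let P : Polynomial k := Polynomial.C (a * b) * Polynomial.X ^ 2 +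
        Polynomial.C 0 * Polynomial.X + Polynomial.C 1
      have hP : P ≠ 0 := by
        intro hP
        exact one_ne_zero (quadratic_coeffs_eq_zero hP).2.2
      refine Set.Finite.subset (Polynomial.rootSet_finite P k) fun m (hm : _ = _) => ?_
      rw [Polynomial.mem_rootSet]
      refine ⟨hP, ?_⟩
      simp only [P, map_add, map_mul, map_pow, Polynomial.aeval_C, Polynomial.aeval_X,
        Algebra.algebraMap_self, RingHom.id_apply]
      linear_combination hm
    exact hfin.infinite_compl.to_subtype
  have hrot : ∀ m : M, ((1 - a * b * (m : k) ^ 2) / (1 + a * b * (m : k) ^ 2)) ^ 2 +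
      a * b * (2 * m / (1 + a * b * (m : k) ^ 2)) ^ 2 = 1 := by
    intro m
    have := m.2
    field_simp
    ring
  choose ρ hρρ hρx hρy using fun m : M => h.exists_reflection (hrot m)
  have : Finite B := hB
  obtain ⟨⟨g, hgB⟩, hg⟩ := Finite.exists_infinite_fiber
    (fun m : M => (⟨sqMap (ρ m : K →+* K) (sqCl u), hinv (ρ m) _ hu⟩ : B))
  obtain ⟨g, rfl⟩ := sqCl_surj g
  obtain ⟨R, hR, hRodd⟩ := h.exists_polynomial_of_odd g.ne_zero
  have hfin := (finite_rotation_aeval h.a_ne h.b_ne h.two_ne hres hR).preimage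
    (f := ((↑) : M → k)) Subtype.val_injective.injOn
  refine (Set.infinite_coe_iff.1 hg) (hfin.subset fun m hm => ⟨m.2, ?_⟩)
  have hm' : sqCl (Units.map ((ρ m : K →+* K) : K →* K) u) = sqCl g := congrArg Subtype.val hm
  let ψ : K →+* HahnSeries ℤ F := φ.comp (ρ m : K →+* K)
  have hψ : ∀ z, ψ z = φ (ρ m z) := fun z => rfl
  have hψk : ∀ c, ψ (algebraMap k K c) = HahnSeries.C (algebraMap k F c) := fun c => by
    rw [hψ, AlgEquiv.commutes, hφ]
  have hterm : ∀ (c : k) (z : K), 0 ≤ (φ z).order → 0 ≤ (φ (algebraMap k K c * z)).order ∧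
      (φ (algebraMap k K c * z)).coeff 0 = algebraMap k F c * (φ z).coeff 0 := by
    intro c z hz
    rw [map_mul, HahnSeries.coeff_zero_mul (order_algebraMap hφ c).ge hz,
      coeff_zero_algebraMap hφ]
    exact ⟨HahnSeries.order_mul_nonneg (order_algebraMap hφ c).ge hz, rfl⟩
  have hψx : 0 ≤ (ψ x).order := by
    rw [hψ, hρx, map_add]
    exact HahnSeries.order_add_nonneg (hterm _ _ hx).1 (hterm _ _ hy).1
  have hψx0 := hRodd F ψ hψk hψx ?_
  · rwa [hψ, hρx, map_add, HahnSeries.coeff_add, (hterm _ _ hx).2, (hterm _ _ hy).2] at hψx0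
  · obtain ⟨r, hr⟩ := sqCl_eq_iff.1 hm'
    have hr0 : ψ r ≠ 0 := (map_ne_zero ψ).2 r.ne_zero
    have hu0 : φ u ≠ 0 := (map_ne_zero φ).2 u.ne_zero
    have h1 : ψ g = φ u * ψ r ^ 2 := by
      rw [hr, Units.val_mul, Units.val_pow_eq_pow_val, map_mul, map_pow]
      change φ (ρ m (ρ m u)) * _ = _
      rw [hρρ]
    rw [h1, HahnSeries.order_mul hu0 (pow_ne_zero 2 hr0), HahnSeries.order_pow, two_nsmul]
    intro he
    exact hodd (by simpa [Int.even_add] using he)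

theorem evenEverywhere_of_finite [CharZero k] {B : Set (SqClass K)} (hB : B.Finite)
    (hinv : ∀ σ : K ≃ₐ[k] K, ∀ y ∈ B, sqMap (σ : K →+* K) y ∈ B) {u : Kˣ} (hu : sqCl u ∈ B) :
    EvenEverywhere k (u : K) := by
  intro F _ _ _ φ hφ
  by_cases hx : 0 ≤ (φ x).order
  · exact h.even_of_finite_of_nonneg hB hinv hφ hx hu
  obtain ⟨γ, hγ, hγa⟩ : ∃ γ : k, γ ≠ 0 ∧ a - γ ^ 2 ≠ 0 := by
    by_cases ha : a = 1
    · exact ⟨2, two_ne_zero, by rw [ha]; norm_num⟩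
    · exact ⟨1, one_ne_zero, by rw [one_pow]; exact sub_ne_zero.2 ha⟩
  obtain ⟨τ, hττ, hτ⟩ := h.exists_reflection_of_ne hγ hγa
  let ψ : K →+* HahnSeries ℤ F := φ.comp (τ : K →+* K)
  have hψ : ∀ z, ψ z = φ (τ z) := fun z => rfl
  have hψk : ∀ c, ψ (algebraMap k K c) = HahnSeries.C (algebraMap k F c) := fun c => by
    rw [hψ, AlgEquiv.commutes, hφ]
  have hx0 : φ x ≠ 0 := by
    intro h0
    rw [h0, HahnSeries.order_zero] at hx
    exact hx le_rfl
  have hψx : 0 ≤ (ψ x).order := by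
    rw [hψ]
    by_contra hneg
    have hτ0 : φ (τ x) ≠ 0 := by
      intro h0
      rw [h0, HahnSeries.order_zero] at hneg
      exact hneg le_rfl
    obtain ⟨e, he, s, t, hrel⟩ : ∃ e : k, e ≠ 0 ∧ ∃ s t : k, algebraMap k K e * (x * τ x) =
        algebraMap k K s * (τ x + x) - algebraMap k K t :=
      ⟨2 * γ * a, mul_ne_zero (mul_ne_zero two_ne_zero hγ) h.a_ne, a + γ ^ 2, 2 * γ, by
        linear_combination -hτ⟩
    have he' : φ (algebraMap k K e) ≠ 0 := (map_ne_zero φ).2 ((map_ne_zero _).2 he)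
    have hord : (φ (algebraMap k K e * (x * τ x))).order = (φ x).order + (φ (τ x)).order := by
      rw [map_mul, map_mul, HahnSeries.order_mul he' (mul_ne_zero hx0 hτ0), order_algebraMap hφ,
        zero_add, HahnSeries.order_mul hx0 hτ0]
    have hne : φ (algebraMap k K e * (x * τ x)) ≠ 0 := by
      rw [map_mul, map_mul]
      exact mul_ne_zero he' (mul_ne_zero hx0 hτ0)
    refine HahnSeries.coeff_order_eq_zero.not.2 hne ?_
    rw [hord, hrel, map_sub, map_mul, map_add, hφ, hφ, HahnSeries.coeff_sub,
      HahnSeries.C_mul_eq_smul, HahnSeries.coeff_smul, HahnSeries.coeff_add,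
      HahnSeries.coeff_eq_zero_of_lt_order (show _ < (φ (τ x)).order by omega),
      HahnSeries.coeff_eq_zero_of_lt_order (show _ < (φ x).order by omega), HahnSeries.C_apply,
      HahnSeries.coeff_single_of_ne (by omega)]
    simp
  have h1 := h.even_of_finite_of_nonneg hB hinv hψk hψx (hinv τ _ hu)
  rw [hψ] at h1
  change Even (φ (τ (τ u))).order at h1
  rwa [hττ] at h1

end ConicCoords

section

variable {k : Type u} {K : Type v} [Field k] [Field K] [Algebra k K] {a b : k} {x y : K}

lemma ConicCoords.sqMap_injective (h : ConicCoords a b x y) :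
    Function.Injective (sqMap (algebraMap k K)) := by
  rw [injective_iff_map_eq_one]
  intro z hz
  obtain ⟨u, rfl⟩ := sqCl_surj z
  rw [sqMap_sqCl, sqCl_eq_one_iff] at hz
  obtain ⟨r, hr⟩ := hz
  obtain ⟨c, rfl⟩ := h.exists_of_sq_eq (e := (u : k)) (r := r) (by rw [pow_two, ← hr]; rfl)
  rw [sqCl_eq_one_iff]
  refine ⟨c, (algebraMap k K).injective ?_⟩
  rw [map_mul, ← hr]
  rfl

lemma ConicCoords.isSquare_neg_one_iff (h : ConicCoords a b x y) :
    IsSquare (-1 : k) ↔ IsSquare (-1 : K) := by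
  have h1 : sqMap (algebraMap k K) (sqCl (-1)) = sqCl (-1) := by
    rw [sqMap_sqCl]
    congr 1
    ext
    simp
  have h2 := sqCl_eq_one_iff (u := (-1 : kˣ))
  have h3 := sqCl_eq_one_iff (u := (-1 : Kˣ))
  rw [Units.val_neg, Units.val_one] at h2 h3
  rw [← h2, ← h3, ← h1, map_eq_one_iff _ h.sqMap_injective]

end

lemma IsWittEquiv.isSquare_neg_one_iff {K L : Type*} [Field K] [Field L]
    {α : SqClass K ≃* SqClass L} (hα : IsWittEquiv α) :
    IsSquare (-1 : K) ↔ IsSquare (-1 : L) := by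
  have h2 := sqCl_eq_one_iff (u := (-1 : Kˣ))
  have h3 := sqCl_eq_one_iff (u := (-1 : Lˣ))
  rw [Units.val_neg, Units.val_one] at h2 h3
  rw [← h2, ← h3, ← hα.map_neg_one, EmbeddingLike.map_eq_one_iff]

lemma IsWittEquiv.card_sqClass_le {k K l L : Type*} [Field k] [Field K] [Algebra k K] [CharZero k]
    [Field l] [Field L] [Algebra l L] [Algebra ℚ_[2] l] [FiniteDimensional ℚ_[2] l]
    {a b : k} {x y : K} (h : ConicCoords a b x y) {c d : l} {z w : L} (h' : ConicCoords c d z w)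
    (hk : Finite (SqClass k)) {α : SqClass L ≃* SqClass K} (hα : IsWittEquiv α) :
    Nat.card (SqClass l) ≤ Nat.card (SqClass k) := by
  have hl : Finite (SqClass l) := Nat.finite_of_card_ne_zero (card_sqClass_ne_zero 2 l)
  have hcore : (specialCore L).Finite := by
    refine (Set.finite_range (sqMap (algebraMap l L))).subset fun e he => ?_
    obtain ⟨u, rfl⟩ := sqCl_surj e
    obtain ⟨r, hr⟩ := h'.exists_of_mem_specialCore he
    exact ⟨sqCl r, hr.symm⟩
  have hfin : (specialCore K).Finite := by
    refine (hcore.image α).subset fun e he => ⟨α.symm e, ?_, α.apply_symm_apply e⟩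
    rwa [← hα.mem_specialCore_iff, α.apply_symm_apply]
  have hinv : ∀ σ : K ≃ₐ[k] K, ∀ e ∈ specialCore K, sqMap (σ : K →+* K) e ∈ specialCore K :=
    fun σ e he => ((isWittEquiv_sqMapEquiv (σ : K ≃+* K)).mem_specialCore_iff).2 he
  have hlift : ∀ e : SqClass l, ∃ r : SqClass k,
      sqMap (algebraMap k K) r = α (sqMap (algebraMap l L) e) := by
    intro e
    obtain ⟨e, rfl⟩ := sqCl_surj e
    have hmem : α (sqMap (algebraMap l L) (sqCl e)) ∈ specialCore K := by
      rw [hα.mem_specialCore_iff]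
      intro H T hHT
      rw [sqMap_sqCl, ← coe_mem_liftSet]
      exact hHT.mem_of_dyadic (hilbertField_local 2 l) (manySquareClasses_of_two l)
        (dyadicApprox_of_two l) (algebraMap l L) e.ne_zero
    obtain ⟨u, hu⟩ := sqCl_surj (α (sqMap (algebraMap l L) (sqCl e)))
    rw [← hu] at hmem ⊢
    obtain ⟨r, s, hrs⟩ := h.exists_of_evenEverywhere u.ne_zero
      (h.evenEverywhere_of_finite hfin hinv hmem)
    have hr0 : r ≠ 0 := by
      rintro rfl
      exact u.ne_zero (by rw [hrs, map_zero, zero_mul])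
    have hs0 : s ≠ 0 := by
      rintro rfl
      exact u.ne_zero (by rw [hrs]; simp)
    refine ⟨sqCl (Units.mk0 r hr0), ?_⟩
    rw [sqMap_sqCl, sqCl_eq_iff]
    exact ⟨Units.mk0 s hs0, Units.ext hrs⟩
  choose f hf using hlift
  refine Nat.card_le_card_of_injective f fun e e' hee => ?_
  refine h'.sqMap_injective (α.injective ?_)
  rw [← hf, ← hf, hee]

lemma card_sqClass_eq_of_isWittEquiv (p q : ℕ) [Fact p.Prime] [Fact q.Prime]
    {k K l L : Type*} [Field k] [Algebra ℚ_[p] k] [FiniteDimensional ℚ_[p] k]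
    [Field l] [Algebra ℚ_[q] l] [FiniteDimensional ℚ_[q] l]
    [Field K] [Algebra k K] [Field L] [Algebra l L]
    {a b : k} {x y : K} (h : ConicCoords a b x y) {c d : l} {z w : L} (h' : ConicCoords c d z w)
    {α : SqClass K ≃* SqClass L} (hα : IsWittEquiv α) :
    Nat.card (SqClass k) = Nat.card (SqClass l) := by
  have hk : Finite (SqClass k) := Nat.finite_of_card_ne_zero (card_sqClass_ne_zero p k)
  have hl : Finite (SqClass l) := Nat.finite_of_card_ne_zero (card_sqClass_ne_zero q l)
  have : CharZero k := charZero_of_injective_algebraMap (algebraMap ℚ_[p] k).injective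
  have : CharZero l := charZero_of_injective_algebraMap (algebraMap ℚ_[q] l).injective
  by_cases hp : p = 2 <;> by_cases hq : q = 2
  · subst hp hq
    exact le_antisymm (hα.card_sqClass_le h' h hl) (hα.symm.card_sqClass_le h h' hk)
  · subst hp
    have h1 := hα.card_sqClass_le h' h hl
    have h2 := card_sqClass_of_two k
    have h3 := card_sqClass_of_odd q l hq
    omega
  · subst hq
    have h1 := hα.symm.card_sqClass_le h h' hk
    have h2 := card_sqClass_of_two l
    have h3 := card_sqClass_of_odd p k hp
    omega
  · rw [card_sqClass_of_odd p k hp, card_sqClass_of_odd q l hq]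

/-- Let `k, ℓ` be finite extensions of `ℚ_p` and `ℚ_q` respectively (nonarchimedean local
fields of characteristic `0`), `a, b ∈ kˣ`, `c, d ∈ ℓˣ`.  If `k_{a,b}` and `ℓ_{c,d}` are
Witt equivalent, then `k` and `ℓ` are Witt equivalent. -/
theorem wittEquiv_local_conic_implies_wittEquiv_base
    (p q : ℕ) [Fact p.Prime] [Fact q.Prime]
    (k : Type*) [Field k] [Algebra ℚ_[p] k] [FiniteDimensional ℚ_[p] k]
    (l : Type*) [Field l] [Algebra ℚ_[q] l] [FiniteDimensional ℚ_[q] l]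
    (a b : k) (ha : a ≠ 0) (hb : b ≠ 0) (c d : l) (hc : c ≠ 0) (hd : d ≠ 0)
    (K : Type*) [Field K] (ι : k →+* K) (hK : IsConicFunctionField k a b K ι)
    (L : Type*) [Field L] (ι' : l →+* L) (hL : IsConicFunctionField l c d L ι')
    (hWE : WittEquivalent K L) :
    WittEquivalent k l := by
  let := ι.toAlgebra
  let := ι'.toAlgebra
  have : CharZero k := charZero_of_injective_algebraMap (algebraMap ℚ_[p] k).injective
  have : CharZero l := charZero_of_injective_algebraMap (algebraMap ℚ_[q] l).injective
  obtain ⟨x, y, h⟩ := IsConicFunctionField.exists_coords two_ne_zero ha hb hK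
  obtain ⟨z, w, h'⟩ := IsConicFunctionField.exists_coords two_ne_zero hc hd hL
  obtain ⟨α, hα⟩ := hWE
  refine (hilbertField_local p k).wittEquivalent (hilbertField_local q l)
    (Nat.finite_of_card_ne_zero (card_sqClass_ne_zero p k))
    (Nat.finite_of_card_ne_zero (card_sqClass_ne_zero q l))
    (card_sqClass_eq_of_isWittEquiv p q h h' hα) ?_
  rw [h.isSquare_neg_one_iff, h'.isSquare_neg_one_iff, hα.isSquare_neg_one_iff]

end
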